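/- arXiv:1603.08125 — 3 statements merged into one kernel-verified Lean document; each statement's English description precedes it below -/
import Mathlib

section
/- Let D̂_{n,k} be the number of nodes with out-degree k in the linear preferential attachment tree Λ_n with n nodes, where k ≥ 0 is fixed (and k ≤ m in the case χ = −1, ρ = m). Then, as n → ∞, (D̂_{n,k} − μ_k·n)/√n converges in distribution to N(0, σ_k²) for some σ_k² > 0, where μ_k = (w_1/(w_0 + w_1)) · Π_{i=1}^{k} w_{i−1}/(w_i + w_1) = ((χ+ρ)/(χ+2ρ)) · Π_{i=1}^{k} (χ(i−1)+ρ)/(χ(i+1)+2ρ). -/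
open scoped BigOperators

namespace PATpaper

/-- The sample space of the preferential attachment tree with `n` nodes: node `i + 1`
(for `0 ≤ i < n - 1`) chooses its parent among the nodes `0, …, i`. -/
abbrev Omega (n : ℕ) := ∀ i : Fin (n - 1), Fin ((i : ℕ) + 1)

/-- The list of parents: entry `i` is the parent of node `i + 1`. -/
def toList {n : ℕ} (p : Omega n) : List ℕ := (List.finRange (n - 1)).map (fun i => ((p i : ℕ)))

/-- The probability, in the linear preferential attachment model with weights
`w_k = χ k + ρ`, of a given parent list: at the step adding node `i + 1` to the tree
with nodes `0, …, i`, an existing node `v` is chosen as the parent with probability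
`w_{d⁺(v)}` divided by the total weight `(i+1)(χ+ρ) − χ` of the current tree. -/
noncomputable def prob (χ ρ : ℝ) (l : List ℕ) : ℝ :=
  ∏ i ∈ Finset.range l.length,
    ((χ * ((l.take i).count (l.getD i 0) : ℝ) + ρ) / (((i : ℝ) + 1) * (χ + ρ) - χ))

/-- Expectation of a functional of the linear preferential attachment tree with
`n` nodes. -/
noncomputable def expec (χ ρ : ℝ) (n : ℕ) (f : Omega n → ℝ) : ℝ :=
  ∑ p : Omega n, prob χ ρ (toList p) * f p

/-- The list of weak ancestors of node `u` (for a valid parent list, the parent of a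
node is smaller than the node, and `min` is idle). -/
def anc (l : List ℕ) : ℕ → List ℕ
  | 0 => [0]
  | (u + 1) => (u + 1) :: anc l (min (l.getD u 0) u)
decreasing_by exact Nat.lt_succ_of_le (Nat.min_le_right _ _)

open Classical in
/-- The set of (weak) descendants of node `v` among the nodes `0, …, n - 1`:
the vertex set of the fringe subtree rooted at `v`. -/
noncomputable def descSet (l : List ℕ) (n v : ℕ) : Finset ℕ :=
  (Finset.range n).filter (fun u => v ∈ anc l u)

open Classical in
/-- The number of fringe subtrees with exactly `k` nodes. -/
noncomputable def countSize (l : List ℕ) (n k : ℕ) : ℕ :=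
  ((Finset.range n).filter (fun v => (descSet l n v).card = k)).card

open Classical in
/-- The number of nodes with out-degree `k`. -/
noncomputable def countDeg (l : List ℕ) (n k : ℕ) : ℕ :=
  ((Finset.range n).filter (fun v => l.count v = k)).card

open MeasureTheory in
/-- `W_n` converges in distribution, under the linear preferential attachment model,
to the centered normal distribution with variance `v`. -/
def TendstoGaussP (χ ρ : ℝ) (W : (n : ℕ) → Omega n → ℝ) (v : NNReal) : Prop :=
  ∀ f : BoundedContinuousFunction ℝ ℝ,
    Filter.Tendsto (fun n => expec χ ρ n (fun p => f (W n p)))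
      Filter.atTop (nhds (∫ x, f x ∂(ProbabilityTheory.gaussianReal 0 v)))

end PATpaper

namespace PATpaper

/-- The asymptotic density `μ_k` of nodes of out-degree `k` in the linear
preferential attachment tree:
`μ_k = (w₁/(w₀+w₁)) Π_{i=1}^k w_{i−1}/(w_i + w₁)`. -/
noncomputable def muDegP (χ ρ : ℝ) (k : ℕ) : ℝ :=
  ((χ + ρ) / (χ + 2 * ρ)) *
    ∏ i ∈ Finset.range k, ((χ * (i : ℝ) + ρ) / (χ * ((i : ℝ) + 2) + 2 * ρ))

section AttachmentChain

open Finset Filter Topology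

/-- The weight `w_j = χ j + ρ` of a node of out-degree `j`. -/
noncomputable def weight (χ ρ : ℝ) (j : ℕ) : ℝ := χ * j + ρ

/-- The total weight of a tree with `n + 1` nodes. -/
noncomputable def totalWeight (χ ρ : ℝ) (n : ℕ) : ℝ := ((n : ℝ) + 1) * (χ + ρ) - χ

/-- The limiting probability that a new node is attached to a node of out-degree `j`. -/
noncomputable def limProb (χ ρ : ℝ) (j : ℕ) : ℝ := weight χ ρ j * muDegP χ ρ j / (χ + ρ)

/-- The increment of the centered out-degree profile, when the new node is attached to a node of
out-degree `l`. -/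
noncomputable def incr (χ ρ : ℝ) (l j : ℕ) : ℝ :=
  (if j = 0 then 1 else 0) - muDegP χ ρ j - (if l = j then 1 else 0) + (if l + 1 = j then 1 else 0)

/-- The centered out-degree profile of a tree with `n + 1` nodes. -/
noncomputable def dev (χ ρ : ℝ) (n : ℕ) (p : Omega (n + 1)) (j : ℕ) : ℝ :=
  (countDeg (toList p) (n + 1) j : ℝ) - muDegP χ ρ j * totalWeight χ ρ n / (χ + ρ)

/-- The probability that the new node is attached to a node of out-degree `l`, in terms of the
centered out-degree profile `y`. -/
noncomputable def stepProb (χ ρ : ℝ) (n : ℕ) (y : ℕ → ℝ) (l : ℕ) : ℝ :=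
  limProb χ ρ l + weight χ ρ l * y l / totalWeight χ ρ n

/-- Expectation of a function of the centered out-degree profile of `Λ_{n+1}`. -/
noncomputable def mean (χ ρ : ℝ) {M : Type*} [AddCommMonoid M] [SMul ℝ M] (n : ℕ)
    (F : (ℕ → ℝ) → M) : M :=
  ∑ p : Omega (n + 1), prob χ ρ (toList p) • F (dev χ ρ n p)

/-- The profiles at which the attachment probabilities form a probability vector. -/
def Regular (χ ρ : ℝ) (n : ℕ) (y : ℕ → ℝ) : Prop :=
  (∀ l, 0 ≤ stepProb χ ρ n y l) ∧ ∑ l ∈ range (n + 1), stepProb χ ρ n y l = 1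

/-- The admissible parameters of the linear preferential attachment tree. -/
structure IsParam (χ ρ : ℝ) : Prop where
  slope : χ = -1 ∨ χ = 0 ∨ χ = 1
  pos : 0 < ρ
  int : χ = -1 → ∃ m : ℕ, 2 ≤ m ∧ ρ = m

section Combinatorics

variable {χ ρ : ℝ}

lemma IsParam.add_pos (h : IsParam χ ρ) : 0 < χ + ρ := by
  rcases h.slope with h1 | h1 | h1
  · obtain ⟨m, hm, h2⟩ := h.int h1
    have : (2 : ℝ) ≤ m := by exact_mod_cast hm
    rw [h1, h2]; linarith
  · have := h.pos; rw [h1]; linarith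
  · have := h.pos; rw [h1]; linarith

lemma IsParam.neg_le (h : IsParam χ ρ) : -χ ≤ χ + ρ := by
  rcases h.slope with h1 | h1 | h1
  · obtain ⟨m, hm, h2⟩ := h.int h1
    have : (2 : ℝ) ≤ m := by exact_mod_cast hm
    rw [h1, h2]; linarith
  · have := h.pos; rw [h1]; linarith
  · have := h.pos; rw [h1]; linarith

lemma IsParam.totalWeight_pos (h : IsParam χ ρ) (n : ℕ) : 0 < totalWeight χ ρ n := by
  have h1 := h.add_pos
  have h2 := h.pos
  have h3 : (0 : ℝ) ≤ n := n.cast_nonneg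
  unfold totalWeight
  nlinarith

lemma totalWeight_succ (n : ℕ) : totalWeight χ ρ (n + 1) = totalWeight χ ρ n + (χ + ρ) := by
  unfold totalWeight; push_cast; ring

lemma prob_concat (l : List ℕ) (v : ℕ) :
    prob χ ρ (l ++ [v]) =
      prob χ ρ l * (weight χ ρ (l.count v) / totalWeight χ ρ l.length) := by
  unfold prob
  rw [List.length_append, List.length_singleton, prod_range_succ]
  congr 1
  · refine prod_congr rfl fun i hi ↦ ?_
    have hi : i < l.length := mem_range.1 hi
    rw [List.take_append_of_le_length hi.le, List.getD_append _ _ _ _ hi]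
  · simp [weight, totalWeight]

lemma prob_nonneg_and (h : IsParam χ ρ) (l : List ℕ) :
    0 ≤ prob χ ρ l ∧ (prob χ ρ l ≠ 0 → ∀ v, 0 ≤ weight χ ρ (l.count v)) := by
  by_cases hχ : χ = -1
  · obtain ⟨m, hm, h2⟩ := h.int hχ
    have key : 0 ≤ prob χ ρ l ∧ (prob χ ρ l ≠ 0 → ∀ v, l.count v ≤ m) := by
      induction l using List.reverseRecOn with
      | nil => simp [prob]
      | append_singleton l v ih =>
        rw [prob_concat]
        by_cases h0 : prob χ ρ l = 0
        · simp [h0]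
        have hc := ih.2 h0
        have hw : ∀ v, weight χ ρ (l.count v) = (m : ℝ) - l.count v := fun v ↦ by
          rw [weight, hχ, h2]; ring
        refine ⟨mul_nonneg ih.1 (div_nonneg ?_ (h.totalWeight_pos _).le), fun h1 u ↦ ?_⟩
        · rw [hw]; have : (l.count v : ℝ) ≤ m := by exact_mod_cast hc v
          linarith
        · have h3 : l.count v ≠ m := by
            intro h3
            apply h1
            rw [hw, h3]; simp
          rw [List.count_append]
          have := hc u
          by_cases huv : v = u
          · subst huv; simp; omega
          · simp [huv, this]
    refine ⟨key.1, fun h0 v ↦ ?_⟩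
    have : (l.count v : ℝ) ≤ m := by exact_mod_cast key.2 h0 v
    rw [weight, hχ, h2]; linarith
  · have hχ' : 0 ≤ χ := by rcases h.slope with h1 | h1 | h1 <;> simp_all
    have hw : ∀ j, 0 ≤ weight χ ρ j := fun j ↦ by
      have := h.pos; unfold weight; positivity
    refine ⟨?_, fun _ v ↦ hw _⟩
    induction l using List.reverseRecOn with
    | nil => simp [prob]
    | append_singleton l v ih =>
      rw [prob_concat]
      exact mul_nonneg ih (div_nonneg (hw _) (h.totalWeight_pos _).le)

lemma countDeg_eq_sum (l : List ℕ) (N j : ℕ) :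
    (countDeg l N j : ℝ) = ∑ u ∈ range N, if l.count u = j then (1 : ℝ) else 0 := by
  unfold countDeg
  rw [card_filter]
  push_cast
  exact sum_congr rfl fun u _ ↦ by congr

lemma countDeg_concat {l : List ℕ} {N v : ℕ} (hv : v < N) (hl : ∀ x ∈ l, x < N) (j : ℕ) :
    (countDeg (l ++ [v]) (N + 1) j : ℝ) = countDeg l N j + (if j = 0 then 1 else 0)
      - (if l.count v = j then 1 else 0) + (if l.count v + 1 = j then 1 else 0) := by
  have h0 : (l ++ [v]).count N = 0 := by
    rw [List.count_eq_zero]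
    intro hN
    rcases List.mem_append.1 hN with h | h
    · exact (hl _ h).ne rfl
    · simp at h; omega
  have h1 : ∀ u, (if (l ++ [v]).count u = j then (1 : ℝ) else 0) =
      (if l.count u = j then 1 else 0) + if v = u then
        ((if l.count v + 1 = j then 1 else 0) - (if l.count v = j then 1 else 0)) else 0 := by
    intro u
    rw [List.count_append, List.count_singleton]
    by_cases huv : v = u
    · subst huv; simp
    · simp [huv]
  rw [countDeg_eq_sum, countDeg_eq_sum, sum_range_succ, h0, sum_congr rfl fun u _ ↦ h1 u,
    sum_add_distrib, sum_ite_eq, if_pos (mem_range.2 hv)]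
  simp only [eq_comm (a := 0) (b := j)]
  ring

lemma sum_countDeg_mul {M : Type*} [AddCommGroup M] [Module ℝ M] {l : List ℕ} {N : ℕ}
    (hl : l.length < N) (f : ℕ → M) :
    ∑ j ∈ range N, (countDeg l N j : ℝ) • f j = ∑ u ∈ range N, f (l.count u) := by
  simp_rw [countDeg_eq_sum, sum_smul]
  rw [sum_comm]
  refine sum_congr rfl fun u _ ↦ ?_
  simp_rw [ite_smul, one_smul, zero_smul]
  rw [sum_ite_eq, if_pos (mem_range.2 (List.count_le_length.trans_lt hl))]

lemma length_toList {n : ℕ} (p : Omega (n + 1)) : (toList p).length = n := by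
  simp [toList]

lemma lt_of_mem_toList {n : ℕ} (p : Omega (n + 1)) {x : ℕ} (hx : x ∈ toList p) : x < n + 1 := by
  unfold toList at hx
  obtain ⟨i, -, rfl⟩ := List.mem_map.1 hx
  have h1 := (p i).2
  have h2 := i.2
  omega

lemma toList_snoc {n : ℕ} (p : Omega (n + 1)) (v : Fin (n + 1)) :
    toList (n := n + 2) (Fin.snoc (α := fun i : Fin (n + 1) ↦ Fin ((i : ℕ) + 1)) p v) =
      toList p ++ [(v : ℕ)] := by
  unfold toList
  change (List.finRange (n + 1)).map _ = _
  rw [List.finRange_succ_last, List.map_append, List.map_map]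
  congr 1
  · refine List.map_congr_left fun i _ ↦ ?_
    simp only [Function.comp_apply, Fin.snoc_castSucc]
  · simp

lemma sum_omega_succ {M : Type*} [AddCommMonoid M] {n : ℕ} (f : List ℕ → M) :
    ∑ p : Omega (n + 2), f (toList p) =
      ∑ p : Omega (n + 1), ∑ v ∈ range (n + 1), f (toList p ++ [v]) := by
  have h := (Fin.snocEquiv (fun i : Fin (n + 1) ↦ Fin ((i : ℕ) + 1))).sum_comp
    (fun p ↦ f (toList (n := n + 2) p))
  rw [Fintype.sum_prod_type, sum_comm] at h
  refine h.symm.trans ?_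
  refine sum_congr rfl fun p _ ↦ ?_
  refine Eq.trans ?_ (Fin.sum_univ_eq_sum_range (fun v ↦ f (toList (n := n + 1) p ++ [v])) (n + 1))
  exact sum_congr rfl fun v _ ↦ congrArg f (toList_snoc p v)

lemma stepProb_dev (h : IsParam χ ρ) {n : ℕ} (p : Omega (n + 1)) (l : ℕ) :
    stepProb χ ρ n (dev χ ρ n p) l =
      countDeg (toList p) (n + 1) l * (weight χ ρ l / totalWeight χ ρ n) := by
  have h1 := (h.totalWeight_pos n).ne'
  have h2 := h.add_pos.ne'
  unfold stepProb dev limProb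
  field_simp
  ring

lemma sum_stepProb_smul (h : IsParam χ ρ) {M : Type*} [AddCommGroup M] [Module ℝ M] {n : ℕ}
    (p : Omega (n + 1)) (f : ℕ → M) :
    ∑ l ∈ range (n + 1), stepProb χ ρ n (dev χ ρ n p) l • f l =
      ∑ u ∈ range (n + 1), (weight χ ρ ((toList p).count u) / totalWeight χ ρ n) •
        f ((toList p).count u) := by
  rw [← sum_countDeg_mul (l := toList p) (by rw [length_toList]; omega)
    (fun j ↦ (weight χ ρ j / totalWeight χ ρ n) • f j)]
  simp_rw [stepProb_dev h, mul_smul]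

lemma regular_dev (h : IsParam χ ρ) {n : ℕ} (p : Omega (n + 1))
    (hp : prob χ ρ (toList p) ≠ 0) : Regular χ ρ n (dev χ ρ n p) := by
  have hw := (prob_nonneg_and h (toList p)).2 hp
  have hS := h.totalWeight_pos n
  constructor
  · intro l
    rw [stepProb_dev h]
    rcases (Nat.cast_nonneg (α := ℝ) (countDeg (toList p) (n + 1) l)).eq_or_lt with h0 | h0
    · rw [← h0, zero_mul]
    · refine mul_nonneg h0.le (div_nonneg ?_ hS.le)
      have h0 : 0 < countDeg (toList p) (n + 1) l := by exact_mod_cast h0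
      unfold countDeg at h0
      obtain ⟨v, hv⟩ := card_pos.1 h0
      rw [← (mem_filter.1 hv).2]
      exact hw v
  · have h1 := sum_stepProb_smul h p (fun _ ↦ (1 : ℝ))
    simp only [smul_eq_mul, mul_one] at h1
    rw [h1, ← sum_div, div_eq_one_iff_eq hS.ne']
    have h2 : ∑ u ∈ range (n + 1), (toList p).count u = n := by
      have := Multiset.sum_count_eq_card (s := range (n + 1)) (m := (toList p : Multiset ℕ))
        fun x hx ↦ mem_range.2 (lt_of_mem_toList p (Multiset.mem_coe.1 hx))
      simpa [length_toList] using this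
    unfold weight totalWeight
    rw [sum_add_distrib, ← mul_sum, ← Nat.cast_sum, h2]
    simp
    ring

lemma dev_concat (h : IsParam χ ρ) {n : ℕ} (l : List ℕ) (hl : ∀ x ∈ l, x < n + 1) {v : ℕ}
    (hv : v < n + 1) (j : ℕ) :
    (countDeg (l ++ [v]) (n + 2) j : ℝ) - muDegP χ ρ j * totalWeight χ ρ (n + 1) / (χ + ρ) =
      countDeg l (n + 1) j - muDegP χ ρ j * totalWeight χ ρ n / (χ + ρ)
        + incr χ ρ (l.count v) j := by
  have h2 := h.add_pos.ne'
  rw [countDeg_concat hv hl, totalWeight_succ, incr]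
  field_simp
  ring

lemma mean_succ (h : IsParam χ ρ) {M : Type*} [AddCommGroup M] [Module ℝ M] (n : ℕ)
    (F : (ℕ → ℝ) → M) :
    mean χ ρ (n + 1) F = mean χ ρ n fun y ↦
      ∑ l ∈ range (n + 1), stepProb χ ρ n y l • F (y + incr χ ρ l) := by
  unfold mean
  have h1 := sum_omega_succ (n := n) fun l ↦ prob χ ρ l • F fun j ↦
    (countDeg l (n + 2) j : ℝ) - muDegP χ ρ j * totalWeight χ ρ (n + 1) / (χ + ρ)
  refine h1.trans (sum_congr rfl fun p _ ↦ ?_)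
  beta_reduce
  rw [sum_stepProb_smul h p fun l ↦ F (dev χ ρ n p + incr χ ρ l), smul_sum]
  refine sum_congr rfl fun v hv ↦ ?_
  rw [prob_concat, length_toList, mul_smul]
  congr 3
  ext j
  rw [dev_concat h _ (fun x hx ↦ lt_of_mem_toList p hx) (mem_range.1 hv)]
  rfl

lemma mean_congr (h : IsParam χ ρ) {M : Type*} [AddCommGroup M] [Module ℝ M] {n : ℕ}
    {F G : (ℕ → ℝ) → M} (hFG : ∀ y, Regular χ ρ n y → F y = G y) :
    mean χ ρ n F = mean χ ρ n G := by
  refine sum_congr rfl fun p _ ↦ ?_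
  by_cases hp : prob χ ρ (toList p) = 0
  · rw [hp, zero_smul, zero_smul]
  · rw [hFG _ (regular_dev h p hp)]

lemma mean_mono (h : IsParam χ ρ) {n : ℕ} {F G : (ℕ → ℝ) → ℝ}
    (hFG : ∀ y, Regular χ ρ n y → F y ≤ G y) : mean χ ρ n F ≤ mean χ ρ n G := by
  refine sum_le_sum fun p _ ↦ ?_
  by_cases hp : prob χ ρ (toList p) = 0
  · rw [hp, zero_smul, zero_smul]
  · exact mul_le_mul_of_nonneg_left (hFG _ (regular_dev h p hp)) (prob_nonneg_and h _).1

lemma norm_mean_le (h : IsParam χ ρ) {M : Type*} [SeminormedAddCommGroup M] [NormedSpace ℝ M]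
    {n : ℕ} (F : (ℕ → ℝ) → M) : ‖mean χ ρ n F‖ ≤ mean χ ρ n fun y ↦ ‖F y‖ := by
  refine (norm_sum_le _ _).trans (sum_le_sum fun p _ ↦ ?_)
  rw [norm_smul, Real.norm_of_nonneg (prob_nonneg_and h _).1, smul_eq_mul]

lemma mean_add {M : Type*} [AddCommGroup M] [Module ℝ M] {n : ℕ} (F G : (ℕ → ℝ) → M) :
    mean χ ρ n (fun y ↦ F y + G y) = mean χ ρ n F + mean χ ρ n G := by
  simp only [mean, smul_add, sum_add_distrib]

lemma mean_sub {M : Type*} [AddCommGroup M] [Module ℝ M] {n : ℕ} (F G : (ℕ → ℝ) → M) :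
    mean χ ρ n (fun y ↦ F y - G y) = mean χ ρ n F - mean χ ρ n G := by
  simp only [mean, smul_sub, sum_sub_distrib]

lemma mean_mul_left {A : Type*} [Ring A] [Algebra ℝ A] {n : ℕ} (c : A) (F : (ℕ → ℝ) → A) :
    mean χ ρ n (fun y ↦ c * F y) = c * mean χ ρ n F := by
  simp only [mean, mul_sum, mul_smul_comm]

lemma mean_sum {M ι : Type*} [AddCommGroup M] [Module ℝ M] {n : ℕ} (s : Finset ι)
    (F : ι → (ℕ → ℝ) → M) :
    mean χ ρ n (fun y ↦ ∑ i ∈ s, F i y) = ∑ i ∈ s, mean χ ρ n (F i) := by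
  simp only [mean, smul_sum]
  exact sum_comm

lemma mean_const (h : IsParam χ ρ) {A : Type*} [Ring A] [Algebra ℝ A] (n : ℕ) (c : A) :
    mean χ ρ n (fun _ ↦ c) = c := by
  induction n with
  | zero =>
    have : ∀ p : Omega (0 + 1), toList p = [] := fun p ↦
      List.length_eq_zero_iff.1 (length_toList p)
    simp [mean, prob, this]
  | succ n ih =>
    rw [mean_succ h]
    refine (mean_congr h fun y hy ↦ ?_).trans ih
    rw [← sum_smul, hy.2, one_smul]

end Combinatorics

section Parameters

variable {χ ρ : ℝ}

lemma IsParam.weight_nonneg (h : IsParam χ ρ) {k j : ℕ} (hk : χ = -1 → (k : ℝ) ≤ ρ)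
    (hj : j ≤ k) : 0 ≤ weight χ ρ j := by
  have h0 := h.pos
  have h1 : (j : ℝ) ≤ k := by exact_mod_cast hj
  have h2 : (0 : ℝ) ≤ j := j.cast_nonneg
  unfold weight
  rcases h.slope with hχ | hχ | hχ
  · have := hk hχ; rw [hχ]; linarith
  · rw [hχ]; linarith
  · rw [hχ]; linarith

lemma IsParam.weight_pos (h : IsParam χ ρ) {k j : ℕ} (hk : χ = -1 → (k : ℝ) ≤ ρ)
    (hj : j < k) : 0 < weight χ ρ j := by
  have h0 := h.pos
  have h1 : (j : ℝ) < k := by exact_mod_cast hj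
  have h2 : (0 : ℝ) ≤ j := j.cast_nonneg
  unfold weight
  rcases h.slope with hχ | hχ | hχ
  · have := hk hχ; rw [hχ]; linarith
  · rw [hχ]; linarith
  · rw [hχ]; linarith

lemma IsParam.weight_le_totalWeight (h : IsParam χ ρ) {j n : ℕ} (hj : j ≤ n) :
    weight χ ρ j ≤ totalWeight χ ρ n := by
  have h0 := h.pos
  have h1 : (j : ℝ) ≤ n := by exact_mod_cast hj
  have h2 : (0 : ℝ) ≤ j := j.cast_nonneg
  have h3 : (0 : ℝ) ≤ n := h2.trans h1
  have h4 := h.neg_le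
  unfold weight totalWeight
  rcases h.slope with hχ | hχ | hχ
  · rw [hχ] at h4 ⊢; nlinarith
  · rw [hχ]; nlinarith
  · rw [hχ]; nlinarith

lemma muDegP_zero : muDegP χ ρ 0 = (χ + ρ) / (χ + 2 * ρ) := by
  simp [muDegP]

lemma IsParam.muDegP_succ (h : IsParam χ ρ) {k j : ℕ} (hk : χ = -1 → (k : ℝ) ≤ ρ)
    (hj : j < k) :
    (χ + ρ + weight χ ρ (j + 1)) * muDegP χ ρ (j + 1) = weight χ ρ j * muDegP χ ρ j := by
  have h1 := h.weight_nonneg hk (Nat.succ_le_of_lt hj)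
  have h2 := h.add_pos
  have h3 : χ * ((j : ℝ) + 2) + 2 * ρ = χ + ρ + weight χ ρ (j + 1) := by
    unfold weight; push_cast; ring
  have h4 : χ + ρ + weight χ ρ (j + 1) ≠ 0 := by positivity
  unfold muDegP
  rw [prod_range_succ, h3]
  change _ = (χ * j + ρ) * _
  field_simp

lemma IsParam.limProb_zero (h : IsParam χ ρ) : limProb χ ρ 0 = 1 - muDegP χ ρ 0 := by
  have h1 := h.add_pos
  have h2 := h.pos
  have h3 : χ + 2 * ρ ≠ 0 := by linarith
  have h4 : 1 - (χ + ρ) / (χ + 2 * ρ) = ρ / (χ + 2 * ρ) := by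
    rw [eq_div_iff h3, sub_mul, div_mul_cancel₀ _ h3]
    ring
  rw [limProb, muDegP_zero, weight, h4]
  field_simp
  push_cast
  ring

lemma IsParam.muDegP_succ_eq (h : IsParam χ ρ) {k j : ℕ} (hk : χ = -1 → (k : ℝ) ≤ ρ)
    (hj : j < k) : muDegP χ ρ (j + 1) = limProb χ ρ j - limProb χ ρ (j + 1) := by
  have h1 := h.muDegP_succ hk hj
  have h2 := h.add_pos
  unfold limProb
  field_simp
  linarith

lemma IsParam.muDegP_mem (h : IsParam χ ρ) {k j : ℕ} (hk : χ = -1 → (k : ℝ) ≤ ρ)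
    (hj : j ≤ k) : 0 < muDegP χ ρ j ∧ muDegP χ ρ j < 1 := by
  have h1 := h.add_pos
  have h2 := h.pos
  induction j with
  | zero =>
    rw [muDegP_zero]
    have : 0 < χ + 2 * ρ := by linarith
    exact ⟨by positivity, by rw [div_lt_one this]; linarith⟩
  | succ j ih =>
    obtain ⟨h3, h4⟩ := ih (by omega)
    have h5 := h.muDegP_succ hk hj
    have h6 := h.weight_pos hk hj
    have h7 := h.weight_nonneg hk hj
    have h8 : weight χ ρ j ≤ χ + ρ + weight χ ρ (j + 1) := by
      have := h.neg_le
      unfold weight; push_cast; linarith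
    have h9 : 0 < χ + ρ + weight χ ρ (j + 1) := by positivity
    constructor
    · by_contra! hc
      nlinarith [mul_pos h6 h3]
    · by_contra! hc
      nlinarith [mul_lt_mul_of_pos_left h4 h6]

/-- The rate at which nodes of out-degree `j` are created, for the profile `y`. -/
noncomputable def flow (χ ρ : ℝ) (y : ℕ → ℝ) : ℕ → ℝ
  | 0 => 0
  | j + 1 => weight χ ρ j * y j

/-- The mean of a function of the out-degree under the limiting attachment distribution, for a
function which is constant beyond `k`. -/
noncomputable def limMean (χ ρ : ℝ) (k : ℕ) (g : ℕ → ℝ) : ℝ :=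
  g (k + 1) + ∑ l ∈ range (k + 1), limProb χ ρ l * (g l - g (k + 1))

lemma sum_stepProb_mul {k n : ℕ} (hkn : k ≤ n) {y : ℕ → ℝ}
    (hy : Regular χ ρ n y) {g : ℕ → ℝ} (hg : ∀ l, k < l → g l = g (k + 1)) :
    ∑ l ∈ range (n + 1), stepProb χ ρ n y l * g l = limMean χ ρ k g +
      (∑ l ∈ range (k + 1), weight χ ρ l * y l * (g l - g (k + 1))) / totalWeight χ ρ n := by
  have h1 : ∑ l ∈ range (n + 1), stepProb χ ρ n y l * (g l - g (k + 1)) =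
      ∑ l ∈ range (k + 1), stepProb χ ρ n y l * (g l - g (k + 1)) := by
    refine (sum_subset (range_mono (by omega)) fun l _ hl ↦ ?_).symm
    rw [hg l (by simpa using hl), sub_self, mul_zero]
  have h2 : ∑ l ∈ range (n + 1), stepProb χ ρ n y l * g l =
      ∑ l ∈ range (n + 1), stepProb χ ρ n y l * (g l - g (k + 1)) + g (k + 1) := by
    simp_rw [mul_sub, sum_sub_distrib, ← sum_mul, hy.2]
    ring
  rw [h2, h1, limMean, sum_div, add_comm, add_assoc, ← sum_add_distrib]
  congr 1
  refine sum_congr rfl fun l _ ↦ ?_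
  rw [stepProb]
  ring

lemma IsParam.sum_stepProb_mul_incr (h : IsParam χ ρ) {k n j : ℕ}
    (hk : χ = -1 → (k : ℝ) ≤ ρ) (hkn : k ≤ n) (hj : j ≤ k) {y : ℕ → ℝ}
    (hy : Regular χ ρ n y) :
    ∑ l ∈ range (n + 1), stepProb χ ρ n y l * incr χ ρ l j =
      (flow χ ρ y j - weight χ ρ j * y j) / totalWeight χ ρ n := by
  have h1 : ∑ l ∈ range (n + 1), stepProb χ ρ n y l * incr χ ρ l j =
      (if j = 0 then 1 else 0) - muDegP χ ρ j - stepProb χ ρ n y j +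
        ∑ l ∈ range (n + 1), stepProb χ ρ n y l * (if l + 1 = j then 1 else 0) := by
    simp_rw [incr, mul_add, mul_sub, sum_add_distrib, sum_sub_distrib, ← sum_mul, hy.2]
    simp [show j < n + 1 by omega]
  rw [h1]
  cases j with
  | zero =>
    simp only [if_true, Nat.add_eq_zero_iff, one_ne_zero, and_false, if_false, mul_zero,
      sum_const_zero, stepProb, flow, h.limProb_zero]
    ring
  | succ j =>
    have h2 : j < n + 1 := by omega
    simp only [Nat.add_right_cancel_iff, Nat.add_eq_zero_iff, one_ne_zero, and_false, if_false,
      mul_ite, mul_one, mul_zero, sum_ite_eq', mem_range, h2, if_true, stepProb, flow,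
      h.muDegP_succ_eq hk hj]
    ring

lemma IsParam.abs_incr_le (h : IsParam χ ρ) {k j : ℕ} (hk : χ = -1 → (k : ℝ) ≤ ρ)
    (hj : j ≤ k) (l : ℕ) : |incr χ ρ l j| ≤ 3 := by
  obtain ⟨h1, h2⟩ := h.muDegP_mem hk hj
  unfold incr
  rw [abs_le]
  constructor <;> split_ifs <;> linarith

lemma IsParam.limMean_incr_sq_pos (h : IsParam χ ρ) {k : ℕ} (hk : χ = -1 → (k : ℝ) ≤ ρ) :
    0 < limMean χ ρ k fun l ↦ incr χ ρ l k * incr χ ρ l k := by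
  obtain ⟨h1, h2⟩ := h.muDegP_mem hk le_rfl
  unfold limMean
  rw [sum_range_succ]
  cases k with
  | zero =>
    simp only [incr, h.limProb_zero]
    simp
    nlinarith [mul_pos h1 (sub_pos.2 h2)]
  | succ k =>
    have h3 := h.muDegP_succ_eq hk (Nat.lt_succ_self k)
    have h4 : 0 ≤ limProb χ ρ (k + 1) :=
      div_nonneg (mul_nonneg (h.weight_nonneg hk le_rfl) h1.le) h.add_pos.le
    rw [sum_range_succ, sum_eq_zero]
    · simp only [incr]
      simp [show k + 1 + 1 ≠ k by omega]
      rw [show limProb χ ρ k = muDegP χ ρ (k + 1) + limProb χ ρ (k + 1) by linarith]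
      nlinarith
    · intro l hl
      have hl := mem_range.1 hl
      have e1 : l ≠ k + 1 := by omega
      have e2 : l ≠ k := by omega
      simp [incr, e1, e2, show k + 1 + 1 ≠ k by omega]

end Parameters

section Recursion

lemma tendsto_cast_div_of_succ_eq {S : ℕ → ℝ} {a : ℝ} (ha : 0 < a)
    (hS : ∀ n, S (n + 1) = S n + a) : Tendsto (fun n : ℕ ↦ (n : ℝ) / S n) atTop (𝓝 a⁻¹) := by
  have h1 : ∀ n : ℕ, S n = S 0 + n * a := fun n ↦ by
    induction n with
    | zero => simp
    | succ n ih => rw [hS, ih]; push_cast; ring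
  have h2 : Tendsto (fun n : ℕ ↦ (S 0 / n + a)⁻¹) atTop (𝓝 a⁻¹) := by
    have := (tendsto_const_div_atTop_nhds_zero_nat (S 0)).add_const a
    rw [zero_add] at this
    exact this.inv₀ ha.ne'
  refine h2.congr' ?_
  filter_upwards [eventually_gt_atTop 0] with n hn
  have hn : (n : ℝ) ≠ 0 := by positivity
  rw [h1 n, ← inv_div]
  field_simp

lemma tendsto_atTop_of_succ_eq {S : ℕ → ℝ} {a : ℝ} (ha : 0 < a)
    (hS : ∀ n, S (n + 1) = S n + a) : Tendsto S atTop atTop := by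
  have h1 : ∀ n : ℕ, S n = S 0 + n * a := fun n ↦ by
    induction n with
    | zero => simp
    | succ n ih => rw [hS, ih]; push_cast; ring
  rw [show S = fun n : ℕ ↦ S 0 + n * a from funext h1]
  exact tendsto_atTop_add_const_left _ _ (tendsto_natCast_atTop_atTop.atTop_mul_const ha)

/-- Solutions of `x (n + 1) = (1 - α / S n) x n + β n` grow linearly, when `S` does and `β`
converges. -/
lemma tendsto_div_of_recursion {S β x : ℕ → ℝ} {a α b : ℝ} (ha : 0 < a) (hα : 0 ≤ α)
    (hS : ∀ n, S (n + 1) = S n + a) (hβ : Tendsto β atTop (𝓝 b)) (k : ℕ)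
    (hx : ∀ n, k ≤ n → x (n + 1) = (1 - α / S n) * x n + β n) :
    Tendsto (fun n ↦ x n / S n) atTop (𝓝 (b / (a + α))) := by
  set c := b / (a + α)
  have hc : c * (a + α) = b := div_mul_cancel₀ _ (by positivity)
  have hS' := tendsto_atTop_of_succ_eq ha hS
  obtain ⟨K, hK⟩ := eventually_atTop.1
    ((hS'.eventually_ge_atTop α).and ((hS'.eventually_gt_atTop 0).and (eventually_ge_atTop k)))
  have hz : ∀ n, K ≤ n → x (n + 1) - c * S (n + 1) =
      (1 - α / S n) * (x n - c * S n) + (β n - b) := by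
    intro n hn
    obtain ⟨-, h2, h3⟩ := hK n hn
    rw [hx n h3, hS, ← hc]
    field_simp
    ring
  have hbound : ∀ n, K ≤ n →
      |x n - c * S n| ≤ |x K - c * S K| + ∑ i ∈ range n, |β i - b| := by
    intro n hn
    induction n, hn using Nat.le_induction with
    | base => exact le_add_of_nonneg_right (sum_nonneg fun _ _ ↦ abs_nonneg _)
    | succ n hn ih =>
      obtain ⟨h1, h2, -⟩ := hK n hn
      rw [hz n hn, sum_range_succ, ← add_assoc]
      refine (abs_add_le _ _).trans (add_le_add_left (le_trans ?_ ih) _)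
      rw [abs_mul]
      refine mul_le_of_le_one_left (abs_nonneg _) ?_
      have h3 : α / S n ≤ 1 := (div_le_one h2).2 h1
      have h4 : 0 ≤ α / S n := by positivity
      rw [abs_le]; constructor <;> linarith
  have hces : Tendsto (fun n : ℕ ↦ (|x K - c * S K| + ∑ i ∈ range n, |β i - b|) / S n) atTop
      (𝓝 0) := by
    have h1 : Tendsto (fun n ↦ |β n - b|) atTop (𝓝 0) := by
      simpa using (hβ.sub_const b).abs
    have h2 := h1.cesaro.mul (tendsto_cast_div_of_succ_eq ha hS)
    have h3 := (tendsto_const_nhds (x := |x K - c * S K|)).div_atTop hS'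
    have h4 := h3.add h2
    rw [zero_mul, add_zero] at h4
    refine h4.congr' ?_
    filter_upwards [eventually_gt_atTop 0] with n hn
    have hn : (n : ℝ) ≠ 0 := by positivity
    rw [add_div]
    congr 1
    field_simp
  have h5 : Tendsto (fun n ↦ x n / S n - c) atTop (𝓝 0) := by
    refine squeeze_zero_norm' ?_ hces
    filter_upwards [eventually_ge_atTop K] with n hn
    obtain ⟨-, h2, -⟩ := hK n hn
    rw [show x n / S n - c = (x n - c * S n) / S n by field_simp, Real.norm_eq_abs, abs_div,
      abs_of_pos h2]
    exact div_le_div_of_nonneg_right (hbound n hn) h2.le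
  simpa using h5.add_const c

end Recursion

section Moments

variable {χ ρ : ℝ}

lemma mean_flow (n j : ℕ) (F : (ℕ → ℝ) → ℝ) :
    mean χ ρ n (fun y ↦ flow χ ρ y j * F y) =
      flow χ ρ (fun i ↦ mean χ ρ n fun y ↦ y i * F y) j := by
  cases j with
  | zero => simp [flow, mean]
  | succ j => simp only [flow, mul_assoc, mean_mul_left]

lemma IsParam.mean_succ_apply (h : IsParam χ ρ) {k n j : ℕ}
    (hk : χ = -1 → (k : ℝ) ≤ ρ) (hkn : k ≤ n) (hj : j ≤ k) :
    mean χ ρ (n + 1) (fun y ↦ y j) =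
      (1 - weight χ ρ j / totalWeight χ ρ n) * mean χ ρ n (fun y ↦ y j) +
        flow χ ρ (fun i ↦ mean χ ρ n fun y ↦ y i) j / totalWeight χ ρ n := by
  have h1 : ∀ y, Regular χ ρ n y →
      ∑ l ∈ range (n + 1), stepProb χ ρ n y l • (y + incr χ ρ l) j =
        (1 - weight χ ρ j / totalWeight χ ρ n) * y j +
          (totalWeight χ ρ n)⁻¹ * (flow χ ρ y j * 1) := by
    intro y hy
    simp_rw [Pi.add_apply, smul_eq_mul, mul_add, sum_add_distrib, ← sum_mul, hy.2,
      h.sum_stepProb_mul_incr hk hkn hj hy]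
    ring
  rw [mean_succ h, mean_congr h h1, mean_add, mean_mul_left, mean_mul_left, mean_flow]
  simp only [mul_one]
  ring

/-- The product of two coordinates of an increment. -/
noncomputable def incrProd (χ ρ : ℝ) (i j l : ℕ) : ℝ := incr χ ρ l i * incr χ ρ l j

lemma incr_of_lt {k j l : ℕ} (hj : j ≤ k) (hl : k < l) :
    incr χ ρ l j = incr χ ρ (k + 1) j := by
  simp [incr, show l ≠ j by omega, show l + 1 ≠ j by omega, show k + 1 ≠ j by omega,
    show k + 1 + 1 ≠ j by omega]

lemma IsParam.mean_succ_mul (h : IsParam χ ρ) {k n i j : ℕ}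
    (hk : χ = -1 → (k : ℝ) ≤ ρ) (hkn : k ≤ n) (hi : i ≤ k) (hj : j ≤ k) :
    mean χ ρ (n + 1) (fun y ↦ y i * y j) =
      (1 - (weight χ ρ i + weight χ ρ j) / totalWeight χ ρ n) * mean χ ρ n (fun y ↦ y i * y j) +
        (flow χ ρ (fun u ↦ mean χ ρ n (fun y ↦ y u * y j) / totalWeight χ ρ n) i +
          flow χ ρ (fun u ↦ mean χ ρ n (fun y ↦ y u * y i) / totalWeight χ ρ n) j +
          limMean χ ρ k (incrProd χ ρ i j) +
          ∑ l ∈ range (k + 1), weight χ ρ l *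
            (incrProd χ ρ i j l - incrProd χ ρ i j (k + 1)) *
              (mean χ ρ n (fun y ↦ y l) / totalWeight χ ρ n)) := by
  have hflow : ∀ (f : ℕ → ℝ) (c : ℝ) (u : ℕ), flow χ ρ (fun u ↦ f u / c) u = flow χ ρ f u / c := by
    intro f c u
    cases u <;> simp [flow, mul_div_assoc]
  have h1 : ∀ y, Regular χ ρ n y →
      ∑ l ∈ range (n + 1), stepProb χ ρ n y l • ((y + incr χ ρ l) i * (y + incr χ ρ l) j) =
        (1 - (weight χ ρ i + weight χ ρ j) / totalWeight χ ρ n) * (y i * y j) +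
          ((totalWeight χ ρ n)⁻¹ * (flow χ ρ y i * y j) +
          (totalWeight χ ρ n)⁻¹ * (flow χ ρ y j * y i) +
          limMean χ ρ k (incrProd χ ρ i j) +
          ∑ l ∈ range (k + 1), (weight χ ρ l *
            (incrProd χ ρ i j l - incrProd χ ρ i j (k + 1)) / totalWeight χ ρ n) * y l) := by
    intro y hy
    have h2 : ∀ l, stepProb χ ρ n y l • ((y + incr χ ρ l) i * (y + incr χ ρ l) j) =
        stepProb χ ρ n y l * (y i * y j) + stepProb χ ρ n y l * incr χ ρ l j * y i +
          stepProb χ ρ n y l * incr χ ρ l i * y j +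
            stepProb χ ρ n y l * incrProd χ ρ i j l := by
      intro l
      simp only [Pi.add_apply, smul_eq_mul, incrProd]
      ring
    have h3 : ∀ l, k < l → incrProd χ ρ i j l = incrProd χ ρ i j (k + 1) := fun l hl ↦ by
      rw [incrProd, incrProd, incr_of_lt hi hl, incr_of_lt hj hl]
    simp_rw [h2, sum_add_distrib, ← sum_mul, hy.2, h.sum_stepProb_mul_incr hk hkn hj hy,
      h.sum_stepProb_mul_incr hk hkn hi hy, sum_stepProb_mul hkn hy h3]
    rw [sum_div, sum_congr rfl fun l _ ↦ show weight χ ρ l * y l *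
      (incrProd χ ρ i j l - incrProd χ ρ i j (k + 1)) / totalWeight χ ρ n = (weight χ ρ l *
            (incrProd χ ρ i j l - incrProd χ ρ i j (k + 1)) / totalWeight χ ρ n) * y l by ring]
    ring
  rw [mean_succ h, mean_congr h h1]
  simp only [mean_add, mean_mul_left, mean_sum, mean_flow, mean_const h, hflow]
  rw [sum_congr rfl fun l _ ↦ show (weight χ ρ l *
      (incrProd χ ρ i j l - incrProd χ ρ i j (k + 1)) / totalWeight χ ρ n) *
        mean χ ρ n (fun y ↦ y l) = weight χ ρ l *
            (incrProd χ ρ i j l - incrProd χ ρ i j (k + 1)) *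
              (mean χ ρ n (fun y ↦ y l) / totalWeight χ ρ n) by ring]
  ring

lemma tendsto_flow {f : ℕ → ℕ → ℝ} {c : ℕ → ℝ} {j : ℕ}
    (hf : ∀ i < j, Tendsto (f i) atTop (𝓝 (c i))) :
    Tendsto (fun n ↦ flow χ ρ (fun i ↦ f i n) j) atTop (𝓝 (flow χ ρ c j)) := by
  cases j with
  | zero => exact tendsto_const_nhds
  | succ j => exact (hf j (Nat.lt_succ_self j)).const_mul _

lemma IsParam.tendsto_mean_apply (h : IsParam χ ρ) {k j : ℕ}
    (hk : χ = -1 → (k : ℝ) ≤ ρ) (hj : j ≤ k) :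
    Tendsto (fun n ↦ mean χ ρ n (fun y ↦ y j) / totalWeight χ ρ n) atTop (𝓝 0) := by
  induction j using Nat.strong_induction_on with
  | _ j ih =>
    have h1 := tendsto_flow (χ := χ) (ρ := ρ) (j := j) (c := fun _ ↦ 0)
      (f := fun i n ↦ mean χ ρ n (fun y ↦ y i) / totalWeight χ ρ n)
      fun i hi ↦ ih i hi (by omega)
    have h0 : flow χ ρ (fun _ ↦ 0) j = 0 := by cases j <;> simp [flow]
    rw [h0] at h1
    have h2 := tendsto_div_of_recursion h.add_pos (h.weight_nonneg hk hj)
      (totalWeight_succ (χ := χ) (ρ := ρ)) h1 k (x := fun n ↦ mean χ ρ n fun y ↦ y j) ?_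
    · simpa using h2
    · intro n hn
      rw [h.mean_succ_apply hk hn hj]
      congr 1
      cases j <;> simp [flow, mul_div_assoc]

lemma IsParam.tendsto_mean_mul_of_flow (h : IsParam χ ρ) {k i j : ℕ}
    (hk : χ = -1 → (k : ℝ) ≤ ρ) (hi : i ≤ k) (hj : j ≤ k) {c d : ℕ → ℝ}
    (hc : ∀ u < i, Tendsto (fun n ↦ mean χ ρ n (fun y ↦ y u * y j) / totalWeight χ ρ n)
      atTop (𝓝 (c u)))
    (hd : ∀ u < j, Tendsto (fun n ↦ mean χ ρ n (fun y ↦ y u * y i) / totalWeight χ ρ n)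
      atTop (𝓝 (d u))) :
    Tendsto (fun n ↦ mean χ ρ n (fun y ↦ y i * y j) / totalWeight χ ρ n) atTop
      (𝓝 ((flow χ ρ c i + flow χ ρ d j + limMean χ ρ k (incrProd χ ρ i j)) /
        (χ + ρ + (weight χ ρ i + weight χ ρ j)))) := by
  refine tendsto_div_of_recursion h.add_pos
    (add_nonneg (h.weight_nonneg hk hi) (h.weight_nonneg hk hj))
    (totalWeight_succ (χ := χ) (ρ := ρ)) ?_ k (x := fun n ↦ mean χ ρ n fun y ↦ y i * y j)
    fun n hn ↦ h.mean_succ_mul hk hn hi hj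
  have h1 := tendsto_finsetSum (range (k + 1)) fun l hl ↦
    (h.tendsto_mean_apply hk (j := l) (by simpa [Nat.lt_succ_iff] using hl)).const_mul
      (weight χ ρ l * (incrProd χ ρ i j l - incrProd χ ρ i j (k + 1)))
  have h2 := (((tendsto_flow (χ := χ) (ρ := ρ) hc).add (tendsto_flow (χ := χ) (ρ := ρ) hd)).add
    (tendsto_const_nhds (x := limMean χ ρ k (incrProd χ ρ i j)))).add h1
  simpa using h2

lemma IsParam.exists_tendsto_mean_mul (h : IsParam χ ρ) {k i j : ℕ}
    (hk : χ = -1 → (k : ℝ) ≤ ρ) (hi : i ≤ k) (hj : j ≤ k) :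
    ∃ c, Tendsto (fun n ↦ mean χ ρ n (fun y ↦ y i * y j) / totalWeight χ ρ n) atTop (𝓝 c) := by
  induction hs : i + j using Nat.strong_induction_on generalizing i j with
  | _ s ih =>
    have h1 : ∀ u < i, ∃ c, Tendsto
        (fun n ↦ mean χ ρ n (fun y ↦ y u * y j) / totalWeight χ ρ n) atTop (𝓝 c) :=
      fun u hu ↦ ih (u + j) (by omega) (by omega) hj rfl
    have h2 : ∀ u < j, ∃ c, Tendsto
        (fun n ↦ mean χ ρ n (fun y ↦ y u * y i) / totalWeight χ ρ n) atTop (𝓝 c) :=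
      fun u hu ↦ ih (u + i) (by omega) (by omega) hi rfl
    choose! c hc using h1
    choose! d hd using h2
    exact ⟨_, h.tendsto_mean_mul_of_flow hk hi hj hc hd⟩

lemma IsParam.mean_mul_sq_le (h : IsParam χ ρ) (n i j : ℕ) :
    mean χ ρ n (fun y ↦ y i * y j) ^ 2 ≤
      mean χ ρ n (fun y ↦ y i * y i) * mean χ ρ n (fun y ↦ y j * y j) := by
  unfold mean
  simp only [smul_eq_mul]
  have hq : ∀ p : Omega (n + 1), 0 ≤ prob χ ρ (toList p) := fun p ↦ (prob_nonneg_and h _).1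
  refine sum_sq_le_sum_mul_sum_of_sq_le_mul _ (fun p _ ↦ ?_) (fun p _ ↦ ?_) fun p _ ↦
    le_of_eq (by ring)
  · exact mul_nonneg (hq p) (mul_self_nonneg _)
  · exact mul_nonneg (hq p) (mul_self_nonneg _)

lemma IsParam.exists_variance (h : IsParam χ ρ) {k : ℕ} (hk : χ = -1 → (k : ℝ) ≤ ρ) :
    ∃ c, 0 < c ∧
      Tendsto (fun n ↦ mean χ ρ n (fun y ↦ y k * y k) / totalWeight χ ρ n) atTop (𝓝 c) := by
  obtain ⟨c, hc⟩ := h.exists_tendsto_mean_mul hk le_rfl le_rfl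
  refine ⟨c, ?_, hc⟩
  have hc0 : 0 ≤ c := ge_of_tendsto' hc fun n ↦ div_nonneg
    (sum_nonneg fun p _ ↦ mul_nonneg (prob_nonneg_and h _).1 (mul_self_nonneg _))
      (h.totalWeight_pos n).le
  refine hc0.lt_of_ne fun h0 ↦ ?_
  have hz : ∀ u < k, Tendsto
      (fun n ↦ mean χ ρ n (fun y ↦ y u * y k) / totalWeight χ ρ n) atTop (𝓝 0) := by
    intro u hu
    obtain ⟨b, hb⟩ := h.exists_tendsto_mean_mul hk hu.le le_rfl
    obtain ⟨d, hd⟩ := h.exists_tendsto_mean_mul hk hu.le hu.le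
    have h1 : b ^ 2 ≤ d * c := by
      refine le_of_tendsto_of_tendsto' (hb.pow 2) (hd.mul hc) fun n ↦ ?_
      rw [div_pow, div_mul_div_comm, ← sq]
      exact div_le_div_of_nonneg_right (h.mean_mul_sq_le n u k) (sq_nonneg _)
    rw [← h0, mul_zero] at h1
    have h2 : b = 0 := by nlinarith
    rwa [h2] at hb
  have h1 := tendsto_nhds_unique hc
    (h.tendsto_mean_mul_of_flow hk le_rfl le_rfl (c := fun _ ↦ 0) (d := fun _ ↦ 0) hz hz)
  have h2 : flow χ ρ (fun _ ↦ 0) k = 0 := by cases k <;> simp [flow]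
  have h3 : 0 < limMean χ ρ k (incrProd χ ρ k k) := h.limMean_incr_sq_pos hk
  have h4 := h.weight_nonneg hk le_rfl
  have h5 := h.add_pos
  have h6 : 0 < (0 + 0 + limMean χ ρ k (incrProd χ ρ k k)) /
      (χ + ρ + (weight χ ρ k + weight χ ρ k)) := by positivity
  rw [h2] at h1
  linarith

end Moments

section CharacteristicFunction

open Complex (I)

variable {χ ρ : ℝ}

lemma norm_exp_mul_I_sub_le {x : ℝ} (hx : |x| ≤ 1) :
    ‖Complex.exp (x * I) - (1 + x * I - (x : ℂ) ^ 2 / 2)‖ ≤ |x| ^ 3 := by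
  have h1 : ‖(x * I : ℂ)‖ = |x| := by simp
  have h2 := Complex.exp_bound (x := x * I) (by rwa [h1]) (n := 3) (by norm_num)
  rw [h1] at h2
  have h3 : ∑ m ∈ range 3, (x * I : ℂ) ^ m / m.factorial = 1 + x * I - (x : ℂ) ^ 2 / 2 := by
    simp [sum_range_succ, Nat.factorial, mul_pow]
    ring
  rw [h3] at h2
  refine h2.trans ?_
  refine mul_le_of_le_one_right (by positivity) ?_
  norm_num [Nat.factorial]

/-- Second order expansion of the characteristic function of a centered bounded variable, taking
finitely many values. -/
lemma norm_sum_exp_sub_exp_le {ι : Type*} {t : Finset ι} {q ξ : ι → ℝ} {s B v c : ℝ}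
    (hq : ∀ l ∈ t, 0 ≤ q l) (hq1 : ∑ l ∈ t, q l = 1) (hξ : ∑ l ∈ t, q l * ξ l = 0)
    (hB : ∀ l ∈ t, |ξ l| ≤ B) (hv : ∑ l ∈ t, q l * ξ l ^ 2 = v) (hs : |s| * B ≤ 1)
    (hB0 : 0 ≤ B) (hc0 : 0 ≤ c) (hc : c ≤ B ^ 2) :
    ‖∑ l ∈ t, (q l : ℂ) * Complex.exp ((s * ξ l : ℝ) * I) - (Real.exp (-(s ^ 2 * c / 2)) : ℝ)‖ ≤
      2 * (|s| * B) ^ 3 + s ^ 2 * |v - c| := by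
  have h1 : ‖∑ l ∈ t, (q l : ℂ) * Complex.exp ((s * ξ l : ℝ) * I) -
      ((1 - s ^ 2 * v / 2 : ℝ) : ℂ)‖ ≤ (|s| * B) ^ 3 := by
    have e1 : ∑ l ∈ t, (q l : ℂ) * Complex.exp ((s * ξ l : ℝ) * I) -
        ((1 - s ^ 2 * v / 2 : ℝ) : ℂ) = ∑ l ∈ t, (q l : ℂ) * (Complex.exp ((s * ξ l : ℝ) * I) -
          (1 + (s * ξ l : ℝ) * I - ((s * ξ l : ℝ) : ℂ) ^ 2 / 2)) := by
      have e2 : ∑ l ∈ t, (q l : ℂ) * (1 + (s * ξ l : ℝ) * I - ((s * ξ l : ℝ) : ℂ) ^ 2 / 2) =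
          ((∑ l ∈ t, q l : ℝ) : ℂ) + s * ((∑ l ∈ t, q l * ξ l : ℝ) : ℂ) * I -
            s ^ 2 * ((∑ l ∈ t, q l * ξ l ^ 2 : ℝ) : ℂ) / 2 := by
        push_cast
        rw [mul_sum, sum_mul, mul_sum, sum_div, ← sum_add_distrib, ← sum_sub_distrib]
        exact sum_congr rfl fun l _ ↦ by ring
      simp_rw [mul_sub _ (Complex.exp _), sum_sub_distrib]
      rw [e2, hq1, hξ, hv]
      push_cast
      ring
    rw [e1]
    refine (norm_sum_le _ _).trans ?_
    calc _ ≤ ∑ l ∈ t, q l * (|s| * B) ^ 3 := by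
          refine sum_le_sum fun l hl ↦ ?_
          have h2 : |s * ξ l| ≤ |s| * B := by
            rw [abs_mul]
            exact mul_le_mul_of_nonneg_left (hB l hl) (abs_nonneg _)
          rw [norm_mul, Complex.norm_real, Real.norm_of_nonneg (hq l hl)]
          refine mul_le_mul_of_nonneg_left ?_ (hq l hl)
          exact (norm_exp_mul_I_sub_le (h2.trans hs)).trans
            (pow_le_pow_left₀ (abs_nonneg _) h2 3)
      _ = (|s| * B) ^ 3 := by rw [← sum_mul, hq1, one_mul]
  have h0 : 0 ≤ |s| * B := by positivity
  have h2 : |Real.exp (-(s ^ 2 * c / 2)) - 1 - -(s ^ 2 * c / 2)| ≤ (|s| * B) ^ 3 := by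
    have h3 : s ^ 2 * c ≤ (|s| * B) ^ 2 := by
      rw [mul_pow, sq_abs]
      exact mul_le_mul_of_nonneg_left hc (sq_nonneg _)
    have h4 : (|s| * B) ^ 2 ≤ 1 := pow_le_one₀ h0 hs
    have h5 : 0 ≤ s ^ 2 * c := by positivity
    refine (Real.abs_exp_sub_one_sub_id_le ?_).trans ?_
    · rw [abs_neg, abs_of_nonneg (by positivity)]
      linarith
    · have h6 : (s ^ 2 * c) ^ 2 ≤ ((|s| * B) ^ 2) ^ 2 := pow_le_pow_left₀ h5 h3 2
      have h7 : ((|s| * B) ^ 2) ^ 2 ≤ (|s| * B) ^ 3 := by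
        rw [← pow_mul]
        exact pow_le_pow_of_le_one h0 hs (by norm_num)
      have h8 : 0 ≤ (s ^ 2 * c) ^ 2 := sq_nonneg _
      nlinarith
  have h3 : ‖((1 - s ^ 2 * v / 2 : ℝ) : ℂ) - (Real.exp (-(s ^ 2 * c / 2)) : ℝ)‖ ≤
      (|s| * B) ^ 3 + s ^ 2 * |v - c| := by
    rw [← Complex.ofReal_sub, Complex.norm_real, Real.norm_eq_abs]
    have h4 : 1 - s ^ 2 * v / 2 - Real.exp (-(s ^ 2 * c / 2)) =
        -(Real.exp (-(s ^ 2 * c / 2)) - 1 - -(s ^ 2 * c / 2)) + s ^ 2 / 2 * -(v - c) := by ring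
    rw [h4]
    refine (abs_add_le _ _).trans (add_le_add ?_ ?_)
    · rwa [abs_neg]
    · rw [abs_mul, abs_neg, abs_of_nonneg (by positivity)]
      have : 0 ≤ s ^ 2 * |v - c| := by positivity
      linarith
  calc _ ≤ _ := norm_sub_le_norm_sub_add_norm_sub _ ((1 - s ^ 2 * v / 2 : ℝ) : ℂ) _
    _ ≤ _ := add_le_add h1 h3
    _ = _ := by ring

/-- The linear functional with coefficients `θ` on profiles up to out-degree `k`. -/
def dot (k : ℕ) (θ y : ℕ → ℝ) : ℝ := ∑ j ∈ range (k + 1), θ j * y j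

/-- The coefficients of the one-step conditional expectation of a linear functional. -/
noncomputable def back (χ ρ : ℝ) (n : ℕ) (θ : ℕ → ℝ) (j : ℕ) : ℝ :=
  θ j * (1 - weight χ ρ j / totalWeight χ ρ n) + θ (j + 1) * (weight χ ρ j / totalWeight χ ρ n)

/-- Coefficients bounded by one and vanishing beyond `k`. -/
def Unitary (k : ℕ) (θ : ℕ → ℝ) : Prop := (∀ j, |θ j| ≤ 1) ∧ ∀ j, k < j → θ j = 0

lemma dot_add (k : ℕ) (θ y z : ℕ → ℝ) : dot k θ (y + z) = dot k θ y + dot k θ z := by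
  simp only [dot, Pi.add_apply, mul_add, sum_add_distrib]

lemma Unitary.abs_dot_le {k : ℕ} {θ : ℕ → ℝ} (hθ : Unitary k θ) (y : ℕ → ℝ) :
    |dot k θ y| ≤ ∑ j ∈ range (k + 1), |y j| := by
  refine (abs_sum_le_sum_abs _ _).trans (sum_le_sum fun j _ ↦ ?_)
  rw [abs_mul]
  exact mul_le_of_le_one_left (abs_nonneg _) (hθ.1 j)

lemma Unitary.back (h : IsParam χ ρ) {k n : ℕ} (hk : χ = -1 → (k : ℝ) ≤ ρ) (hkn : k ≤ n)
    {θ : ℕ → ℝ} (hθ : Unitary k θ) : Unitary k (back χ ρ n θ) := by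
  have h2 : ∀ j, k < j → PATpaper.back χ ρ n θ j = 0 := fun j hj ↦ by
    rw [PATpaper.back, hθ.2 j hj, hθ.2 (j + 1) (by omega)]; ring
  refine ⟨fun j ↦ ?_, h2⟩
  rcases lt_or_ge k j with hj | hj
  · rw [h2 j hj]; simp
  have hS := h.totalWeight_pos n
  have h3 : 0 ≤ weight χ ρ j / totalWeight χ ρ n := div_nonneg (h.weight_nonneg hk hj) hS.le
  have h4 : weight χ ρ j / totalWeight χ ρ n ≤ 1 :=
    (div_le_one hS).2 (h.weight_le_totalWeight (hj.trans hkn))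
  have h5 := abs_le.1 (hθ.1 j)
  have h6 := abs_le.1 (hθ.1 (j + 1))
  rw [PATpaper.back, abs_le]
  constructor <;> nlinarith

/-- A dominating functional for the fluctuations of the conditional variance. -/
noncomputable def fluct (χ ρ : ℝ) (k : ℕ) (y : ℕ → ℝ) : ℝ :=
  ∑ l ∈ range (k + 1), weight χ ρ l * |y l|

/-- The conditional variance of a linear functional in one step of the chain. -/
noncomputable def condVar (χ ρ : ℝ) (k n : ℕ) (θ y : ℕ → ℝ) : ℝ :=
  ∑ l ∈ range (n + 1), stepProb χ ρ n y l *
    (dot k θ (incr χ ρ l) - (dot k (back χ ρ n θ) y - dot k θ y)) ^ 2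

lemma Unitary.abs_dot_incr_le (h : IsParam χ ρ) {k : ℕ} (hk : χ = -1 → (k : ℝ) ≤ ρ)
    {θ : ℕ → ℝ} (hθ : Unitary k θ) (l : ℕ) : |dot k θ (incr χ ρ l)| ≤ 3 * (k + 1) := by
  refine (hθ.abs_dot_le _).trans ?_
  calc _ ≤ ∑ j ∈ range (k + 1), (3 : ℝ) := sum_le_sum fun j hj ↦
        h.abs_incr_le hk (by simpa [Nat.lt_succ_iff] using hj) l
    _ = _ := by simp; ring

lemma Unitary.sum_stepProb_mul_dot (h : IsParam χ ρ) {k n : ℕ} (hk : χ = -1 → (k : ℝ) ≤ ρ)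
    (hkn : k ≤ n) {θ : ℕ → ℝ} (hθ : Unitary k θ) {y : ℕ → ℝ} (hy : Regular χ ρ n y) :
    ∑ l ∈ range (n + 1), stepProb χ ρ n y l * dot k θ (incr χ ρ l) =
      dot k (PATpaper.back χ ρ n θ) y - dot k θ y := by
  have h1 : ∑ l ∈ range (n + 1), stepProb χ ρ n y l * dot k θ (incr χ ρ l) =
      ∑ j ∈ range (k + 1), θ j * ((flow χ ρ y j - weight χ ρ j * y j) / totalWeight χ ρ n) := by
    simp_rw [dot, mul_sum]
    rw [sum_comm]
    refine sum_congr rfl fun j hj ↦ ?_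
    rw [← h.sum_stepProb_mul_incr hk hkn (by simpa [Nat.lt_succ_iff] using hj) hy, mul_sum]
    exact sum_congr rfl fun l _ ↦ by ring
  have h2 : ∑ j ∈ range (k + 1), θ j * flow χ ρ y j =
      ∑ j ∈ range (k + 1), θ (j + 1) * (weight χ ρ j * y j) := by
    rw [sum_range_succ', sum_range_succ (fun j ↦ θ (j + 1) * _), hθ.2 (k + 1) (by omega)]
    simp [flow]
  have h3 : ∑ j ∈ range (k + 1), θ j * ((flow χ ρ y j - weight χ ρ j * y j) /
      totalWeight χ ρ n) = (∑ j ∈ range (k + 1), θ j * flow χ ρ y j -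
        ∑ j ∈ range (k + 1), θ j * (weight χ ρ j * y j)) / totalWeight χ ρ n := by
    rw [← sum_sub_distrib, sum_div]
    exact sum_congr rfl fun j _ ↦ by ring
  rw [h1, h3, h2, dot, dot, ← sum_sub_distrib, ← sum_sub_distrib, sum_div]
  refine sum_congr rfl fun j _ ↦ ?_
  rw [PATpaper.back]
  ring

lemma Unitary.abs_drift_le (h : IsParam χ ρ) {k n : ℕ} (hk : χ = -1 → (k : ℝ) ≤ ρ)
    (hkn : k ≤ n) {θ : ℕ → ℝ} (hθ : Unitary k θ) {y : ℕ → ℝ} (hy : Regular χ ρ n y) :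
    |dot k (PATpaper.back χ ρ n θ) y - dot k θ y| ≤ 3 * (k + 1) := by
  rw [← hθ.sum_stepProb_mul_dot h hk hkn hy]
  refine (abs_sum_le_sum_abs _ _).trans ?_
  calc _ ≤ ∑ l ∈ range (n + 1), stepProb χ ρ n y l * (3 * (k + 1)) := by
        refine sum_le_sum fun l _ ↦ ?_
        rw [abs_mul, abs_of_nonneg (hy.1 l)]
        exact mul_le_mul_of_nonneg_left (hθ.abs_dot_incr_le h hk l) (hy.1 l)
    _ = _ := by rw [← sum_mul, hy.2, one_mul]

lemma Unitary.abs_drift_le_fluct (h : IsParam χ ρ) {k n : ℕ} (hk : χ = -1 → (k : ℝ) ≤ ρ)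
    {θ : ℕ → ℝ} (hθ : Unitary k θ) (y : ℕ → ℝ) :
    |dot k (PATpaper.back χ ρ n θ) y - dot k θ y| ≤
      2 * (fluct χ ρ k y / totalWeight χ ρ n) := by
  have hS := h.totalWeight_pos n
  have h1 : dot k (PATpaper.back χ ρ n θ) y - dot k θ y =
      (∑ j ∈ range (k + 1), (θ (j + 1) - θ j) * (weight χ ρ j * y j)) / totalWeight χ ρ n := by
    rw [dot, dot, ← sum_sub_distrib, sum_div]
    refine sum_congr rfl fun j _ ↦ ?_
    rw [PATpaper.back]
    ring
  rw [h1, abs_div, abs_of_pos hS, ← mul_div_assoc]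
  refine div_le_div_of_nonneg_right ((abs_sum_le_sum_abs _ _).trans ?_) hS.le
  rw [fluct, mul_sum]
  refine sum_le_sum fun j hj ↦ ?_
  have hw := h.weight_nonneg hk (j := j) (by simpa [Nat.lt_succ_iff] using hj)
  rw [abs_mul, abs_mul, abs_of_nonneg hw]
  refine mul_le_mul_of_nonneg_right ?_ (by positivity)
  have h5 := abs_le.1 (hθ.1 j)
  have h6 := abs_le.1 (hθ.1 (j + 1))
  rw [abs_le]
  constructor <;> linarith

lemma Unitary.condVar_eq (h : IsParam χ ρ) {k n : ℕ} (hk : χ = -1 → (k : ℝ) ≤ ρ)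
    (hkn : k ≤ n) {θ : ℕ → ℝ} (hθ : Unitary k θ) {y : ℕ → ℝ} (hy : Regular χ ρ n y) :
    condVar χ ρ k n θ y = ∑ l ∈ range (n + 1), stepProb χ ρ n y l * dot k θ (incr χ ρ l) ^ 2 -
      (dot k (PATpaper.back χ ρ n θ) y - dot k θ y) ^ 2 := by
  have h1 := hθ.sum_stepProb_mul_dot h hk hkn hy
  unfold condVar
  generalize dot k (PATpaper.back χ ρ n θ) y - dot k θ y = d at h1
  have h2 : ∀ l, stepProb χ ρ n y l * (dot k θ (incr χ ρ l) - d) ^ 2 =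
      stepProb χ ρ n y l * dot k θ (incr χ ρ l) ^ 2 -
        2 * d * (stepProb χ ρ n y l * dot k θ (incr χ ρ l)) + d ^ 2 * stepProb χ ρ n y l :=
    fun l ↦ by ring
  simp_rw [h2, sum_add_distrib, sum_sub_distrib, ← mul_sum, h1, hy.2]
  ring

lemma Unitary.mean_succ_dot_sq (h : IsParam χ ρ) {k n : ℕ} (hk : χ = -1 → (k : ℝ) ≤ ρ)
    (hkn : k ≤ n) {θ : ℕ → ℝ} (hθ : Unitary k θ) :
    mean χ ρ (n + 1) (fun y ↦ dot k θ y ^ 2) =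
      mean χ ρ n (fun y ↦ dot k (PATpaper.back χ ρ n θ) y ^ 2) +
        mean χ ρ n (condVar χ ρ k n θ) := by
  rw [mean_succ h, ← mean_add]
  refine mean_congr h fun y hy ↦ ?_
  rw [hθ.condVar_eq h hk hkn hy]
  have h1 := hθ.sum_stepProb_mul_dot h hk hkn hy
  have h2 : ∀ l, stepProb χ ρ n y l • dot k θ (y + incr χ ρ l) ^ 2 =
      stepProb χ ρ n y l * dot k θ (incr χ ρ l) ^ 2 +
        2 * dot k θ y * (stepProb χ ρ n y l * dot k θ (incr χ ρ l)) +
          dot k θ y ^ 2 * stepProb χ ρ n y l := fun l ↦ by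
    rw [dot_add, smul_eq_mul]; ring
  simp_rw [h2, sum_add_distrib, ← mul_sum, h1, hy.2]
  ring

lemma Unitary.abs_condVar_sub_le (h : IsParam χ ρ) {k n : ℕ} (hk : χ = -1 → (k : ℝ) ≤ ρ)
    (hkn : k ≤ n) {θ : ℕ → ℝ} (hθ : Unitary k θ) {y : ℕ → ℝ} (hy : Regular χ ρ n y) :
    |condVar χ ρ k n θ y - limMean χ ρ k fun l ↦ dot k θ (incr χ ρ l) ^ 2| ≤
      24 * (k + 1) ^ 2 * (fluct χ ρ k y / totalWeight χ ρ n) := by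
  have hS := h.totalWeight_pos n
  have hR : 0 ≤ fluct χ ρ k y := sum_nonneg fun l hl ↦ mul_nonneg
    (h.weight_nonneg hk (by simpa [Nat.lt_succ_iff] using hl)) (abs_nonneg _)
  have h0 : ∀ l, k < l → dot k θ (incr χ ρ l) ^ 2 = dot k θ (incr χ ρ (k + 1)) ^ 2 := by
    intro l hl
    congr 1
    exact sum_congr rfl fun j hj ↦ by
      rw [incr_of_lt (by simpa [Nat.lt_succ_iff] using hj) hl]
  have hsq : ∀ l, dot k θ (incr χ ρ l) ^ 2 ≤ (3 * (k + 1)) ^ 2 := fun l ↦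
    sq_le_sq.2 ((hθ.abs_dot_incr_le h hk l).trans (le_abs_self _))
  rw [hθ.condVar_eq h hk hkn hy, sum_stepProb_mul hkn hy h0]
  have h1 : |(∑ l ∈ range (k + 1), weight χ ρ l * y l * (dot k θ (incr χ ρ l) ^ 2 -
      dot k θ (incr χ ρ (k + 1)) ^ 2)) / totalWeight χ ρ n| ≤
        (3 * (k + 1)) ^ 2 * (fluct χ ρ k y / totalWeight χ ρ n) := by
    rw [abs_div, abs_of_pos hS, ← mul_div_assoc]
    refine div_le_div_of_nonneg_right ((abs_sum_le_sum_abs _ _).trans ?_) hS.le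
    rw [fluct, mul_sum]
    refine sum_le_sum fun l hl ↦ ?_
    have hw := h.weight_nonneg hk (j := l) (by simpa [Nat.lt_succ_iff] using hl)
    rw [abs_mul, abs_mul, abs_of_nonneg hw, mul_comm]
    refine mul_le_mul_of_nonneg_right ?_ (by positivity)
    have h5 := hsq l
    have h6 := hsq (k + 1)
    have h7 := sq_nonneg (dot k θ (incr χ ρ l))
    have h8 := sq_nonneg (dot k θ (incr χ ρ (k + 1)))
    rw [abs_le]
    constructor <;> linarith
  have h2 : (dot k (PATpaper.back χ ρ n θ) y - dot k θ y) ^ 2 ≤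
      3 * (k + 1) * (2 * (fluct χ ρ k y / totalWeight χ ρ n)) := by
    rw [← sq_abs, sq]
    exact mul_le_mul (hθ.abs_drift_le h hk hkn hy) (hθ.abs_drift_le_fluct h hk y)
      (abs_nonneg _) (by positivity)
  have h3 := sq_nonneg (dot k (PATpaper.back χ ρ n θ) y - dot k θ y)
  have h4 : 0 ≤ fluct χ ρ k y / totalWeight χ ρ n := div_nonneg hR hS.le
  have h5 : (1 : ℝ) ≤ k + 1 := by have := k.cast_nonneg (α := ℝ); linarith
  have h6 : ((k : ℝ) + 1) * (fluct χ ρ k y / totalWeight χ ρ n) ≤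
      ((k : ℝ) + 1) ^ 2 * (fluct χ ρ k y / totalWeight χ ρ n) :=
    mul_le_mul_of_nonneg_right (by nlinarith) h4
  have h7 := abs_le.1 h1
  have h8 : 0 ≤ ((k : ℝ) + 1) ^ 2 * (fluct χ ρ k y / totalWeight χ ρ n) := by positivity
  rw [abs_le]
  constructor <;> nlinarith

/-- A bound for the mean fluctuations of the conditional variances, uniform in the coefficients. -/
noncomputable def fluctBound (χ ρ : ℝ) (k n : ℕ) : ℝ :=
  48 * ((k : ℝ) + 1) ^ 2 * (mean χ ρ n (fluct χ ρ k) / totalWeight χ ρ n)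

lemma Unitary.mean_abs_condVar_sub_le (h : IsParam χ ρ) {k n : ℕ}
    (hk : χ = -1 → (k : ℝ) ≤ ρ) (hkn : k ≤ n) {θ : ℕ → ℝ} (hθ : Unitary k θ) :
    mean χ ρ n (fun y ↦ |condVar χ ρ k n θ y - mean χ ρ n (condVar χ ρ k n θ)|) ≤
      fluctBound χ ρ k n := by
  set A := limMean χ ρ k fun l ↦ dot k θ (incr χ ρ l) ^ 2
  have h1 : mean χ ρ n (fun y ↦ |condVar χ ρ k n θ y - A|) ≤
      24 * (k + 1) ^ 2 * (mean χ ρ n (fluct χ ρ k) / totalWeight χ ρ n) := by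
    refine (mean_mono h fun y hy ↦ hθ.abs_condVar_sub_le h hk hkn hy).trans (le_of_eq ?_)
    simp only [div_eq_inv_mul, mean_mul_left]
  have h2 : |A - mean χ ρ n (condVar χ ρ k n θ)| ≤
      mean χ ρ n (fun y ↦ |condVar χ ρ k n θ y - A|) := by
    have h3 := norm_mean_le h (n := n) fun y ↦ condVar χ ρ k n θ y - A
    rw [mean_sub, mean_const h] at h3
    rw [abs_sub_comm]
    exact h3
  calc _ ≤ mean χ ρ n (fun y ↦ |condVar χ ρ k n θ y - A| +
        |A - mean χ ρ n (condVar χ ρ k n θ)|) := mean_mono h fun y _ ↦ abs_sub_le _ _ _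
    _ ≤ _ := by
      rw [mean_add, mean_const h, fluctBound]
      linarith

lemma IsParam.tendsto_fluctBound (h : IsParam χ ρ) {k : ℕ} (hk : χ = -1 → (k : ℝ) ≤ ρ) :
    Tendsto (fluctBound χ ρ k) atTop (𝓝 0) := by
  have hS : Tendsto (fun n ↦ (√(totalWeight χ ρ n))⁻¹) atTop (𝓝 0) :=
    (Real.tendsto_sqrt_atTop.comp (tendsto_atTop_of_succ_eq h.add_pos
      (totalWeight_succ (χ := χ) (ρ := ρ)))).inv_tendsto_atTop
  have h1 : ∀ l ≤ k, Tendsto (fun n ↦ mean χ ρ n (fun y ↦ |y l|) / totalWeight χ ρ n) atTop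
      (𝓝 0) := by
    intro l hl
    obtain ⟨c, hc⟩ := h.exists_tendsto_mean_mul hk hl hl
    have h2 := (hc.mul hS).add hS
    rw [mul_zero, add_zero] at h2
    refine squeeze_zero (fun n ↦ div_nonneg ?_ (h.totalWeight_pos n).le) (fun n ↦ ?_) h2
    · exact sum_nonneg fun p _ ↦ mul_nonneg (prob_nonneg_and h _).1 (abs_nonneg _)
    · have hr := Real.sqrt_pos.2 (h.totalWeight_pos n)
      have hrs := Real.mul_self_sqrt (h.totalWeight_pos n).le
      have h3 : mean χ ρ n (fun y ↦ |y l|) ≤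
          (√(totalWeight χ ρ n))⁻¹ * mean χ ρ n (fun y ↦ y l * y l) + √(totalWeight χ ρ n) := by
        calc _ ≤ mean χ ρ n (fun y ↦ (√(totalWeight χ ρ n))⁻¹ * (y l * y l) +
              √(totalWeight χ ρ n)) := by
              refine mean_mono h fun y _ ↦ ?_
              rw [inv_mul_eq_div, div_add' _ _ _ hr.ne', le_div_iff₀ hr, ← abs_mul_abs_self (y l)]
              nlinarith [sq_nonneg (|y l| - √(totalWeight χ ρ n)),
                sq_nonneg (|y l| + √(totalWeight χ ρ n)), abs_nonneg (y l)]
          _ = _ := by rw [mean_add, mean_mul_left, mean_const h]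
      rw [div_le_iff₀ (h.totalWeight_pos n)]
      refine h3.trans (le_of_eq ?_)
      have hT := (h.totalWeight_pos n).ne'
      generalize totalWeight χ ρ n = T at *
      have h4 : (√T)⁻¹ * T = √T := by
        field_simp
        linarith [hrs]
      rw [add_mul, h4]
      field_simp
  have h2 := (tendsto_finsetSum (range (k + 1)) fun l hl ↦
    (h1 l (by simpa [Nat.lt_succ_iff] using hl)).const_mul (weight χ ρ l)).const_mul
      (48 * ((k : ℝ) + 1) ^ 2)
  simp only [mul_zero, sum_const_zero] at h2
  refine h2.congr fun n ↦ ?_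
  have h3 : mean χ ρ n (fluct χ ρ k) =
      ∑ l ∈ range (k + 1), weight χ ρ l * mean χ ρ n fun y ↦ |y l| := by
    simp_rw [← mean_mul_left]
    exact mean_sum (χ := χ) (ρ := ρ) (range (k + 1)) fun l y ↦ weight χ ρ l * |y l|
  rw [fluctBound, h3, sum_div]
  simp only [mul_div_assoc]

end CharacteristicFunction

section CentralLimit

open Complex (I)

variable {χ ρ : ℝ}

lemma mean_nonneg (h : IsParam χ ρ) {n : ℕ} {F : (ℕ → ℝ) → ℝ}
    (hF : ∀ y, Regular χ ρ n y → 0 ≤ F y) : 0 ≤ mean χ ρ n F := by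
  have h1 := mean_mono h (F := fun _ ↦ 0) hF
  rwa [mean_const h] at h1

lemma Unitary.mean_condVar_mem (h : IsParam χ ρ) {k n : ℕ} (hk : χ = -1 → (k : ℝ) ≤ ρ)
    (hkn : k ≤ n) {θ : ℕ → ℝ} (hθ : Unitary k θ) :
    0 ≤ mean χ ρ n (condVar χ ρ k n θ) ∧
      mean χ ρ n (condVar χ ρ k n θ) ≤ (6 * ((k : ℝ) + 1)) ^ 2 := by
  refine ⟨mean_nonneg h fun y hy ↦ sum_nonneg fun l _ ↦ mul_nonneg (hy.1 l) (sq_nonneg _), ?_⟩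
  refine (mean_mono h (G := fun _ ↦ (6 * ((k : ℝ) + 1)) ^ 2) fun y hy ↦ ?_).trans
    (le_of_eq (mean_const h n _))
  calc _ ≤ ∑ l ∈ range (n + 1), stepProb χ ρ n y l * (6 * ((k : ℝ) + 1)) ^ 2 := by
        refine sum_le_sum fun l _ ↦ mul_le_mul_of_nonneg_left (sq_le_sq.2 ?_) (hy.1 l)
        refine ((abs_sub _ _).trans (add_le_add (hθ.abs_dot_incr_le h hk l)
          (hθ.abs_drift_le h hk hkn hy))).trans (le_trans (le_of_eq ?_) (le_abs_self _))
        ring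
    _ = _ := by rw [← sum_mul, hy.2, one_mul]

/-- The characteristic function of a linear functional of the centered profile of `Λ_{n+1}`. -/
noncomputable def profileChar (χ ρ : ℝ) (k n : ℕ) (θ : ℕ → ℝ) (s : ℝ) : ℂ :=
  mean χ ρ n fun y ↦ Complex.exp ((s * dot k θ y : ℝ) * I)

lemma Unitary.norm_profileChar_succ_sub_le (h : IsParam χ ρ) {k n : ℕ}
    (hk : χ = -1 → (k : ℝ) ≤ ρ) (hkn : k ≤ n) {θ : ℕ → ℝ} (hθ : Unitary k θ) {s : ℝ}
    (hs : |s| * (6 * ((k : ℝ) + 1)) ≤ 1) :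
    ‖profileChar χ ρ k (n + 1) θ s -
      (Real.exp (-(s ^ 2 * mean χ ρ n (condVar χ ρ k n θ) / 2)) : ℝ) *
        profileChar χ ρ k n (PATpaper.back χ ρ n θ) s‖ ≤
      2 * (|s| * (6 * ((k : ℝ) + 1))) ^ 3 + s ^ 2 * fluctBound χ ρ k n := by
  obtain ⟨hv0, hv1⟩ := hθ.mean_condVar_mem h hk hkn
  have hfl := hθ.mean_abs_condVar_sub_le h hk hkn
  set v := mean χ ρ n (condVar χ ρ k n θ) with hv
  set θ' := PATpaper.back χ ρ n θ with hθ'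
  rw [profileChar, profileChar, mean_succ h, ← mean_mul_left, ← mean_sub]
  refine (norm_mean_le h _).trans ?_
  calc _ ≤ mean χ ρ n (fun y ↦ 2 * (|s| * (6 * ((k : ℝ) + 1))) ^ 3 +
        s ^ 2 * |condVar χ ρ k n θ y - v|) := by
        refine mean_mono h fun y hy ↦ ?_
        have h1 : ∑ l ∈ range (n + 1),
            stepProb χ ρ n y l • Complex.exp ((s * dot k θ (y + incr χ ρ l) : ℝ) * I) -
              (Real.exp (-(s ^ 2 * v / 2)) : ℝ) * Complex.exp ((s * dot k θ' y : ℝ) * I) =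
            Complex.exp ((s * dot k θ' y : ℝ) * I) * (∑ l ∈ range (n + 1),
              (stepProb χ ρ n y l : ℂ) * Complex.exp
                ((s * (dot k θ (incr χ ρ l) - (dot k θ' y - dot k θ y)) : ℝ) * I) -
              (Real.exp (-(s ^ 2 * v / 2)) : ℝ)) := by
          rw [mul_sub, mul_sum, mul_comm (Complex.ofReal _)]
          congr 1
          refine sum_congr rfl fun l _ ↦ ?_
          rw [mul_left_comm, ← Complex.exp_add, Complex.real_smul, dot_add]
          congr 2
          push_cast
          ring
        rw [h1, norm_mul, Complex.norm_exp_ofReal_mul_I, one_mul]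
        refine norm_sum_exp_sub_exp_le (fun l _ ↦ hy.1 l) hy.2 ?_ (fun l _ ↦ ?_) rfl hs
          (by positivity) hv0 hv1
        · simp_rw [mul_sub _ (dot k θ _), sum_sub_distrib, ← sum_mul, hy.2,
            hθ.sum_stepProb_mul_dot h hk hkn hy]
          ring
        · refine ((abs_sub _ _).trans (add_le_add (hθ.abs_dot_incr_le h hk l)
            (hθ.abs_drift_le h hk hkn hy))).trans (le_of_eq ?_)
          ring
    _ ≤ _ := by
        rw [mean_add, mean_const h, mean_mul_left]
        gcongr

lemma IsParam.fluctBound_nonneg (h : IsParam χ ρ) {k : ℕ} (hk : χ = -1 → (k : ℝ) ≤ ρ) (n : ℕ) :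
    0 ≤ fluctBound χ ρ k n := by
  refine mul_nonneg (by positivity) (div_nonneg (mean_nonneg h fun y _ ↦ ?_)
    (h.totalWeight_pos n).le)
  exact sum_nonneg fun l hl ↦ mul_nonneg
    (h.weight_nonneg hk (by simpa [Nat.lt_succ_iff] using hl)) (abs_nonneg _)

/-- The distance between the characteristic function of a linear functional and the Gaussian one
with the same variance, uniformly in the coefficients. -/
lemma Unitary.norm_profileChar_sub_le (h : IsParam χ ρ) {k n : ℕ}
    (hk : χ = -1 → (k : ℝ) ≤ ρ) (hkn : k ≤ n) {θ : ℕ → ℝ} (hθ : Unitary k θ) {s : ℝ}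
    (hs : |s| * (6 * ((k : ℝ) + 1)) ≤ 1) :
    ‖profileChar χ ρ k n θ s -
      (Real.exp (-(s ^ 2 * mean χ ρ n (fun y ↦ dot k θ y ^ 2) / 2)) : ℝ)‖ ≤
      |s| * mean χ ρ k (fun y ↦ ∑ j ∈ range (k + 1), |y j|) +
        s ^ 2 * mean χ ρ k (fun y ↦ (∑ j ∈ range (k + 1), |y j|) ^ 2) +
        ∑ r ∈ range n,
          (2 * (|s| * (6 * ((k : ℝ) + 1))) ^ 3 + s ^ 2 * fluctBound χ ρ k r) := by
  induction n, hkn using Nat.le_induction generalizing θ with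
  | base =>
    have h1 : ‖profileChar χ ρ k k θ s - 1‖ ≤
        |s| * mean χ ρ k (fun y ↦ ∑ j ∈ range (k + 1), |y j|) := by
      rw [profileChar, ← mean_const h k (1 : ℂ), ← mean_sub, ← mean_mul_left]
      refine (norm_mean_le h _).trans (mean_mono h fun y _ ↦ ?_)
      rw [mul_comm _ I]
      refine (Real.norm_exp_I_mul_ofReal_sub_one_le).trans ?_
      rw [Real.norm_eq_abs, abs_mul]
      exact mul_le_mul_of_nonneg_left (hθ.abs_dot_le y) (abs_nonneg _)
    have h2 : mean χ ρ k (fun y ↦ dot k θ y ^ 2) ≤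
        mean χ ρ k (fun y ↦ (∑ j ∈ range (k + 1), |y j|) ^ 2) := by
      refine mean_mono h fun y _ ↦ sq_le_sq.2 ((hθ.abs_dot_le y).trans (le_abs_self _))
    have h3 : 0 ≤ mean χ ρ k (fun y ↦ dot k θ y ^ 2) := mean_nonneg h fun y _ ↦ sq_nonneg _
    have h4 : ‖(1 : ℂ) - (Real.exp (-(s ^ 2 * mean χ ρ k (fun y ↦ dot k θ y ^ 2) / 2)) : ℝ)‖ ≤
        s ^ 2 * mean χ ρ k (fun y ↦ (∑ j ∈ range (k + 1), |y j|) ^ 2) := by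
      rw [← Complex.ofReal_one, ← Complex.ofReal_sub, Complex.norm_real, Real.norm_eq_abs]
      have h5 : 0 ≤ s ^ 2 * mean χ ρ k (fun y ↦ dot k θ y ^ 2) := by positivity
      have h6 := mul_le_mul_of_nonneg_left h2 (sq_nonneg s)
      have h7 := Real.add_one_le_exp (-(s ^ 2 * mean χ ρ k (fun y ↦ dot k θ y ^ 2) / 2))
      have h8 : Real.exp (-(s ^ 2 * mean χ ρ k (fun y ↦ dot k θ y ^ 2) / 2)) ≤ 1 :=
        Real.exp_le_one_iff.2 (by linarith)
      rw [abs_of_nonneg (by linarith)]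
      linarith
    have h5 : 0 ≤ ∑ r ∈ range k,
        (2 * (|s| * (6 * ((k : ℝ) + 1))) ^ 3 + s ^ 2 * fluctBound χ ρ k r) :=
      sum_nonneg fun r _ ↦ add_nonneg (by positivity)
        (mul_nonneg (sq_nonneg s) (h.fluctBound_nonneg hk r))
    exact (norm_sub_le_norm_sub_add_norm_sub _ 1 _).trans
      ((add_le_add h1 h4).trans (le_add_of_nonneg_right h5))
  | succ n hkn ih =>
    have h1 := hθ.norm_profileChar_succ_sub_le h hk hkn hs
    have h2 := ih (hθ.back h hk hkn)
    have hv0 := (hθ.mean_condVar_mem h hk hkn).1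
    rw [hθ.mean_succ_dot_sq h hk hkn, sum_range_succ]
    set E := Real.exp (-(s ^ 2 * mean χ ρ n (condVar χ ρ k n θ) / 2)) with hE
    have hE1 : E ≤ 1 := by
      refine Real.exp_le_one_iff.2 ?_
      have : 0 ≤ s ^ 2 * mean χ ρ n (condVar χ ρ k n θ) := by positivity
      linarith
    set m := mean χ ρ n (fun y ↦ dot k (PATpaper.back χ ρ n θ) y ^ 2)
    have h3 : Real.exp (-(s ^ 2 * (m + mean χ ρ n (condVar χ ρ k n θ)) / 2)) =
        E * Real.exp (-(s ^ 2 * m / 2)) := by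
      rw [hE, ← Real.exp_add]
      ring_nf
    rw [h3]
    refine (norm_sub_le_norm_sub_add_norm_sub _
      ((E : ℂ) * profileChar χ ρ k n (PATpaper.back χ ρ n θ) s) _).trans ?_
    rw [Complex.ofReal_mul, ← mul_sub, norm_mul, Complex.norm_real,
      Real.norm_of_nonneg (Real.exp_pos _).le]
    have h4 := mul_le_mul hE1 h2 (norm_nonneg _) zero_le_one
    linarith

lemma dot_single (k : ℕ) (y : ℕ → ℝ) : dot k (fun j ↦ if j = k then 1 else 0) y = y k := by
  simp [dot]

lemma unitary_single (k : ℕ) : Unitary k fun j ↦ if j = k then 1 else 0 := by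
  refine ⟨fun j ↦ ?_, fun j hj ↦ if_neg hj.ne'⟩
  beta_reduce
  split_ifs <;> simp

lemma IsParam.tendsto_mean_exp (h : IsParam χ ρ) {k : ℕ} (hk : χ = -1 → (k : ℝ) ≤ ρ) {c : ℝ}
    (hc : Tendsto (fun n ↦ mean χ ρ n (fun y ↦ y k * y k) / totalWeight χ ρ n) atTop (𝓝 c))
    (t : ℝ) :
    Tendsto (fun n : ℕ ↦ mean χ ρ n fun y ↦ Complex.exp ((t / √((n : ℝ) + 1) * y k : ℝ) * I))
      atTop (𝓝 (Real.exp (-(c * (χ + ρ) * t ^ 2 / 2)) : ℝ)) := by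
  set s : ℕ → ℝ := fun n ↦ t / √((n : ℝ) + 1) with hs
  have hsq : ∀ n, s n ^ 2 = t ^ 2 * ((n : ℝ) + 1)⁻¹ := fun n ↦ by
    rw [hs, div_pow, Real.sq_sqrt (by positivity), div_eq_mul_inv]
  have hn1 : Tendsto (fun n : ℕ ↦ (n : ℝ) + 1) atTop atTop :=
    tendsto_atTop_add_const_right _ _ tendsto_natCast_atTop_atTop
  have hs0 : Tendsto (fun n ↦ |s n|) atTop (𝓝 0) := by
    have := ((Real.tendsto_sqrt_atTop.comp hn1).inv_tendsto_atTop.const_mul t).abs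
    simpa [hs, div_eq_mul_inv] using this
  have hs2 : Tendsto (fun n ↦ s n ^ 2) atTop (𝓝 0) := by
    have := hn1.inv_tendsto_atTop.const_mul (t ^ 2)
    rw [mul_zero] at this
    exact this.congr fun n ↦ (hsq n).symm
  have hns : Tendsto (fun n : ℕ ↦ (n : ℝ) * s n ^ 2) atTop (𝓝 (t ^ 2)) := by
    have := (tendsto_natCast_div_add_atTop (1 : ℝ)).const_mul (t ^ 2)
    rw [mul_one] at this
    refine this.congr fun n ↦ ?_
    rw [hsq]
    ring
  have hvar : Tendsto (fun n ↦ s n ^ 2 * mean χ ρ n (fun y ↦ y k ^ 2)) atTop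
      (𝓝 (t ^ 2 * (c * (χ + ρ)))) := by
    have h1 : Tendsto (fun n : ℕ ↦ totalWeight χ ρ n * ((n : ℝ) + 1)⁻¹) atTop (𝓝 (χ + ρ)) := by
      have h2 := (hn1.inv_tendsto_atTop.const_mul χ).const_sub (χ + ρ)
      rw [mul_zero, sub_zero] at h2
      refine h2.congr fun n ↦ ?_
      have : (n : ℝ) + 1 ≠ 0 := by positivity
      simp only [totalWeight, Pi.inv_apply]
      field_simp
    refine ((hc.mul h1).const_mul (t ^ 2)).congr fun n ↦ ?_
    have := (h.totalWeight_pos n).ne'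
    rw [hsq]
    simp only [← sq]
    field_simp
  have hlim : Tendsto (fun n ↦ ((Real.exp (-(s n ^ 2 * mean χ ρ n (fun y ↦ y k ^ 2) / 2)) : ℝ) : ℂ))
      atTop (𝓝 (Real.exp (-(c * (χ + ρ) * t ^ 2 / 2)) : ℝ)) := by
    refine (Complex.continuous_ofReal.tendsto _).comp ((Real.continuous_exp.tendsto _).comp ?_)
    have := (hvar.div_const 2).neg
    rwa [mul_comm (t ^ 2)] at this
  set b : ℕ → ℝ := fun n ↦ |s n| * mean χ ρ k (fun y ↦ ∑ j ∈ range (k + 1), |y j|) +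
    s n ^ 2 * mean χ ρ k (fun y ↦ (∑ j ∈ range (k + 1), |y j|) ^ 2) +
      ∑ r ∈ range n,
        (2 * (|s n| * (6 * ((k : ℝ) + 1))) ^ 3 + s n ^ 2 * fluctBound χ ρ k r) with hb
  have hb0 : Tendsto b atTop (𝓝 0) := by
    have h1 := ((hs0.mul_const (mean χ ρ k fun y ↦ ∑ j ∈ range (k + 1), |y j|)).add
      (hs2.mul_const (mean χ ρ k fun y ↦ (∑ j ∈ range (k + 1), |y j|) ^ 2))).add
        (((hns.mul hs0).mul_const (2 * (6 * ((k : ℝ) + 1)) ^ 3)).add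
          (hns.mul (h.tendsto_fluctBound hk).cesaro))
    simp only [zero_mul, mul_zero, add_zero] at h1
    refine h1.congr fun n ↦ ?_
    rw [hb]
    congr 1
    rw [sum_add_distrib, sum_const, card_range, nsmul_eq_mul, ← mul_sum]
    congr 1
    · rw [← sq_abs (s n)]
      ring
    · rcases n.eq_zero_or_pos with rfl | hn
      · simp
      · have : (n : ℝ) ≠ 0 := by positivity
        field_simp
  refine hlim.congr_dist ?_
  refine squeeze_zero' (Eventually.of_forall fun n ↦ dist_nonneg) ?_ hb0
  have hs1 : ∀ᶠ n in atTop, |s n| * (6 * ((k : ℝ) + 1)) < 1 := by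
    have := hs0.mul_const (6 * ((k : ℝ) + 1))
    rw [zero_mul] at this
    exact this.eventually_lt_const one_pos
  filter_upwards [hs1, eventually_ge_atTop k] with n hn hkn
  have h1 := (unitary_single k).norm_profileChar_sub_le h hk hkn hn.le
  simp only [profileChar, dot_single] at h1
  rwa [dist_comm, dist_eq_norm]

section Law

open MeasureTheory ProbabilityTheory

/-- The law of a random variable on the space of parent lists of `Λ_{n+1}`. -/
noncomputable def law (χ ρ : ℝ) (n : ℕ) (W : Omega (n + 1) → ℝ) : Measure ℝ :=
  ∑ p, ENNReal.ofReal (prob χ ρ (toList p)) • Measure.dirac (W p)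

lemma IsParam.isProbabilityMeasure_law (h : IsParam χ ρ) {n : ℕ} (W : Omega (n + 1) → ℝ) :
    IsProbabilityMeasure (law χ ρ n W) := by
  refine ⟨?_⟩
  have h1 := mean_const h n (1 : ℝ)
  simp only [mean, smul_eq_mul, mul_one] at h1
  simp only [law, Measure.coe_finsetSum, Finset.sum_apply, Measure.smul_apply, measure_univ,
    smul_eq_mul, mul_one]
  rw [← ENNReal.ofReal_sum_of_nonneg fun p _ ↦ (prob_nonneg_and h _).1, h1, ENNReal.ofReal_one]

lemma IsParam.integral_law (h : IsParam χ ρ) {E : Type*} [NormedAddCommGroup E] [NormedSpace ℝ E]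
    [CompleteSpace E] {n : ℕ} (W : Omega (n + 1) → ℝ) (f : ℝ → E) :
    ∫ x, f x ∂law χ ρ n W = ∑ p, prob χ ρ (toList p) • f (W p) := by
  rw [law, integral_finsetSum_measure fun p _ ↦
    (integrable_dirac (by simp)).smul_measure ENNReal.ofReal_ne_top]
  refine sum_congr rfl fun p _ ↦ ?_
  rw [integral_smul_measure, integral_dirac, ENNReal.toReal_ofReal (prob_nonneg_and h _).1]

/-- The normalized number of nodes of out-degree `k`. -/
noncomputable def normalizedDeg (χ ρ : ℝ) (k n : ℕ) (p : Omega n) : ℝ :=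
  ((countDeg (toList p) n k : ℝ) - muDegP χ ρ k * (n : ℝ)) / Real.sqrt n

lemma IsParam.tendsto_charFun_law (h : IsParam χ ρ) {k : ℕ} (hk : χ = -1 → (k : ℝ) ≤ ρ) {c : ℝ}
    (hc : Tendsto (fun n ↦ mean χ ρ n (fun y ↦ y k * y k) / totalWeight χ ρ n) atTop (𝓝 c))
    (t : ℝ) :
    Tendsto (fun n : ℕ ↦ charFun (law χ ρ n (normalizedDeg χ ρ k (n + 1))) t) atTop
      (𝓝 (Real.exp (-(c * (χ + ρ) * t ^ 2 / 2)) : ℝ)) := by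
  set a := -(muDegP χ ρ k * χ / (χ + ρ)) with ha
  have h0 : Tendsto (fun n : ℕ ↦ Complex.exp ((t / √((n : ℝ) + 1) * a : ℝ) * I)) atTop (𝓝 1) := by
    have hn1 : Tendsto (fun n : ℕ ↦ (n : ℝ) + 1) atTop atTop :=
      tendsto_atTop_add_const_right _ _ tendsto_natCast_atTop_atTop
    have h1 := (((Real.tendsto_sqrt_atTop.comp hn1).inv_tendsto_atTop.const_mul t).mul_const a)
    have h2 : Continuous fun x : ℝ ↦ Complex.exp (x * I) := by fun_prop
    have h3 := (h2.tendsto _).comp h1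
    simpa [Function.comp_def, div_eq_mul_inv] using h3
  have h4 := h0.mul (h.tendsto_mean_exp hk hc t)
  rw [one_mul] at h4
  refine h4.congr fun n ↦ ?_
  rw [← mean_mul_left, charFun_apply_real, h.integral_law]
  refine sum_congr rfl fun p _ ↦ ?_
  beta_reduce
  rw [← Complex.exp_add]
  congr 2
  have h5 : dev χ ρ n p k + a = (countDeg (toList p) (n + 1) k : ℝ) -
      muDegP χ ρ k * ((n + 1 : ℕ) : ℝ) := by
    have := h.add_pos.ne'
    rw [dev, ha, totalWeight]
    push_cast
    field_simp
    ring
  rw [normalizedDeg, ← h5]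
  push_cast
  ring

theorem IsParam.tendstoGaussP_normalizedDeg (h : IsParam χ ρ) {k : ℕ}
    (hk : χ = -1 → (k : ℝ) ≤ ρ) :
    ∃ v : NNReal, 0 < v ∧ TendstoGaussP χ ρ (normalizedDeg χ ρ k) v := by
  obtain ⟨c, hc0, hc⟩ := h.exists_variance hk
  have hpos : 0 < c * (χ + ρ) := mul_pos hc0 h.add_pos
  obtain ⟨v, hv⟩ : ∃ v : NNReal, (v : ℝ) = c * (χ + ρ) := ⟨⟨_, hpos.le⟩, rfl⟩
  refine ⟨v, NNReal.coe_pos.1 (hv ▸ hpos), fun f ↦ ?_⟩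
  let P : ℕ → ProbabilityMeasure ℝ := fun n ↦
    ⟨law χ ρ n (normalizedDeg χ ρ k (n + 1)), h.isProbabilityMeasure_law _⟩
  let G : ProbabilityMeasure ℝ := ⟨gaussianReal 0 v, inferInstance⟩
  have hP : Tendsto P atTop (𝓝 G) := by
    refine ProbabilityMeasure.tendsto_of_tendsto_charFun fun t ↦ ?_
    have h1 : charFun (G : Measure ℝ) t = (Real.exp (-(c * (χ + ρ) * t ^ 2 / 2)) : ℝ) := by
      refine (charFun_gaussianReal t).trans ?_
      rw [← hv]
      push_cast
      congr 1
      ring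
    rw [h1]
    exact h.tendsto_charFun_law hk hc t
  have h2 := ProbabilityMeasure.tendsto_iff_forall_integral_tendsto.1 hP f
  rw [← tendsto_add_atTop_iff_nat 1]
  exact h2.congr fun n ↦ h.integral_law _ f

end Law

end CentralLimit

end AttachmentChain

/-- **Theorem (out-degrees in linear preferential attachment trees).**
Let `D̂_{n,k}` be the number of nodes with out-degree `k` in the linear preferential
attachment tree `Λ_n` with `n` nodes (`k ≤ m` when `χ = −1`, `ρ = m`). Then
`(D̂_{n,k} − μ_k n)/√n → N(0, σ_k²)` for some `σ_k² > 0`, where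
`μ_k = ((χ+ρ)/(χ+2ρ)) Π_{i=1}^k (χ(i−1)+ρ)/(χ(i+1)+2ρ)`. -/
theorem pat_outdegree_clt (χ ρ : ℝ)
    (hχ : χ = -1 ∨ χ = 0 ∨ χ = 1) (hρ : 0 < ρ)
    (hint : χ = -1 → ∃ m : ℕ, 2 ≤ m ∧ ρ = m)
    (k : ℕ) (hk : χ = -1 → (k : ℝ) ≤ ρ) :
    ∃ σ2 : NNReal, 0 < σ2 ∧
      TendstoGaussP χ ρ (fun n p =>
        ((countDeg (toList p) n k : ℝ) - muDegP χ ρ k * (n : ℝ)) / Real.sqrt n) σ2 := by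
  obtain ⟨v, hv, h⟩ := (IsParam.mk hχ hρ hint).tendstoGaussP_normalizedDeg hk
  exact ⟨v, hv, h⟩

end PATpaper
end

section
/- For m ≥ 3, the (m−1)×(m−1) matrix A_{m−1} with entries (A_{m−1})_{i,i} = −i for 1 ≤ i ≤ m−1, (A_{m−1})_{i,i−1} = i−1 for 2 ≤ i ≤ m−1, (A_{m−1})_{1,m−1} = m(m−1), and all other entries 0, has characteristic polynomial det(λI − A_{m−1}) = Π_{i=1}^{m−1}(λ + i) − m!. -/
open Polynomial

/-- The determinant of a lower bidiagonal matrix with one extra entry in the top right corner. -/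
theorem Matrix.det_bidiagonal_with_corner {R : Type*} [CommRing R] (n : ℕ)
    (M : Matrix (Fin (n + 2)) (Fin (n + 2)) R)
    (hM : ∀ i j : Fin (n + 2), (j : ℕ) + 1 ≠ i → j ≠ i → ¬ (i = 0 ∧ j = Fin.last (n + 1)) →
      M i j = 0) :
    M.det = ∏ i, M i i
      + (-1) ^ (n + 1) * M 0 (Fin.last (n + 1)) * ∏ i : Fin (n + 1), M i.succ i.castSucc := by
  have diagonal_minor : (M.submatrix Fin.succ Fin.succ).det = ∏ i : Fin (n + 1), M i.succ i.succ := by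
    rw [Matrix.det_of_isLowerTriangular]
    · rfl
    · intro i j hij
      have hlt : i < j := hij
      apply hM
      · simp only [Fin.val_succ]; have := Fin.lt_def.1 hlt; omega
      · simpa using hlt.ne'
      · simp
  have corner_minor : (M.submatrix Fin.succ Fin.castSucc).det =
      ∏ i : Fin (n + 1), M i.succ i.castSucc := by
    rw [Matrix.det_of_isUpperTriangular]
    · rfl
    · intro i j hij
      have hlt : (j : ℕ) < i := Fin.lt_def.1 hij
      apply hM
      · simp only [Fin.val_succ, Fin.val_castSucc]; omega
      · simp only [ne_eq, Fin.ext_iff, Fin.val_succ, Fin.val_castSucc]; omega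
      · simp
  rw [Matrix.det_succ_row_zero, Fin.sum_univ_succ, Fin.sum_univ_castSucc, Finset.sum_eq_zero]
  · rw [Fin.prod_univ_succ (fun i => M i i)]
    simp [diagonal_minor, corner_minor, Fin.succAbove_last, Fin.succAbove_zero]
  · intro j _
    rw [hM 0 j.castSucc.succ (by simp) (by simp) (by simp [Fin.ext_iff]; omega)]
    simp


/-- **Theorem.** For `m ≥ 3`, the `(m−1)×(m−1)` matrix `A_{m−1}` with diagonal
entries `−i` (`1 ≤ i ≤ m−1`), subdiagonal entries `(A)_{i,i−1} = i−1`
(`2 ≤ i ≤ m−1`), corner entry `(A)_{1,m−1} = m(m−1)`, and all other entries `0`,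
has characteristic polynomial `det(λI − A) = Π_{i=1}^{m−1}(λ + i) − m!`.
(Indices in the Lean statement are `0`-based.) -/
theorem mary_urn_charpoly (m : ℕ) (hm : 3 ≤ m) :
    (Matrix.of (fun i j : Fin (m - 1) =>
        if (j : ℕ) + 1 = (i : ℕ) then ((i : ℕ) : ℝ)
        else if i = j then -(((i : ℕ) : ℝ) + 1)
        else if (i : ℕ) = 0 ∧ (j : ℕ) = m - 2 then (m : ℝ) * ((m : ℝ) - 1)
        else 0)).charpoly
      = (∏ i ∈ Finset.range (m - 1), (X + C (((i : ℕ) : ℝ) + 1)))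
          - C ((Nat.factorial m : ℝ)) := by
  obtain ⟨n, rfl⟩ : ∃ n, m = n + 3 := ⟨m - 3, by omega⟩
  change Matrix.charpoly (n := Fin (n + 2)) _ = ∏ i ∈ Finset.range (n + 2), _ - _
  rw [Matrix.charpoly, Matrix.det_bidiagonal_with_corner, ← Fin.prod_univ_eq_prod_range
    (fun i : ℕ => (X + C ((i : ℝ) + 1))), sub_eq_add_neg]
  · congr 1
    · refine Finset.prod_congr rfl fun i _ => ?_
      simp only [Matrix.charmatrix_apply_eq, Matrix.of_apply, Nat.succ_ne_self, if_false, if_true,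
        C_neg, sub_neg_eq_add]
    · have subdiagonal_prod : ∏ i : Fin (n + 1), (-C ((i : ℝ) + 1)) =
          (-1) ^ (n + 1) * C ((Nat.factorial (n + 1) : ℝ)) := by
        rw [Finset.prod_neg, Finset.card_univ, Fintype.card_fin, ← map_prod,
          Fin.prod_univ_eq_prod_range (fun i : ℕ => (i : ℝ) + 1),
          ← Finset.prod_range_add_one_eq_factorial]
        push_cast
        rfl
      have subdiagonal_ne : ∀ i : Fin (n + 1), i.succ ≠ i.castSucc := fun i => by
        simp [Fin.ext_iff]
      have corner_ne : (0 : Fin (n + 2)) ≠ Fin.last (n + 1) := by simp [Fin.ext_iff]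
      rw [Matrix.charmatrix_apply_ne _ _ _ corner_ne, Finset.prod_congr rfl fun i _ =>
        (Matrix.charmatrix_apply_ne _ _ _ (subdiagonal_ne i)).trans
          (show _ = -C ((i : ℝ) + 1) by simp), subdiagonal_prod]
      have sign_sq : ((-1 : ℝ[X]) ^ (n + 1)) * (-1) ^ (n + 1) = 1 := by
        rw [← mul_pow]; simp
      have factorial_eq : (Nat.factorial (n + 3) : ℝ) =
          ((n + 3 : ℕ) : ℝ) * (((n + 3 : ℕ) : ℝ) - 1) * Nat.factorial (n + 1) := by
        rw [Nat.factorial_succ (n + 2), Nat.factorial_succ (n + 1)]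
        push_cast
        ring
      rw [factorial_eq, C_mul]
      simp only [Matrix.of_apply, Fin.val_zero, Fin.val_last, corner_ne, if_false,
        Nat.succ_ne_zero, true_and,
        show n + 3 - 2 = n + 1 by omega, if_true]
      linear_combination (-C (((n + 3 : ℕ) : ℝ) * (((n + 3 : ℕ) : ℝ) - 1)) *
        C ((Nat.factorial (n + 1) : ℝ))) * sign_sq
  · intro i j h1 h2 h3
    rw [Matrix.charmatrix_apply_ne _ _ _ h2.symm]
    have h4 : ¬ ((i : ℕ) = 0 ∧ (j : ℕ) = n + 3 - 2) := fun h =>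
      h3 ⟨Fin.ext h.1, Fin.ext (by simpa using h.2)⟩
    rw [Matrix.of_apply, if_neg h1, if_neg h2.symm, if_neg h4, C_0, neg_zero]
end

section
/- Let Y_{n,4} be the number of fringe subtrees with exactly 4 keys in the random ternary search tree 𝒯_n (m = 3) with n keys. Then, as n → ∞, n^{−1/2}(Y_{n,4} − n/25) converges in distribution to N(0, 38477/1299375), and E Y_{n,4} = n/25 + o(n^{1/2}). -/
open scoped BigOperators

namespace MSTpaper

/-- The marked ordered tree underlying an `m`-ary search tree: a node either holds
`j` keys and has no children (`lf j`, with `j ≤ m - 2`; `lf 0` is an external node),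
or is full, holding `m - 1` keys, and has `m` (possibly external) children. -/
inductive MTree (m : ℕ) : Type
  | lf : ℕ → MTree m
  | nd : (Fin m → MTree m) → MTree m

namespace MTree

/-- The number of keys of an `m`-ary search tree. -/
def keys {m : ℕ} : MTree m → ℕ
  | lf j => j
  | nd c => (m - 1) + ∑ i, keys (c i)

end MTree

/-- The `m`-ary search tree built from a list of (distinct) keys: the first `m - 1`
keys go into the root, and each further key is passed to the subtree corresponding to
the interval (among the intervals determined by the root keys) it belongs to. -/
def build (m : ℕ) (l : List ℕ) : MTree m :=
  if h : 2 ≤ m ∧ m - 1 ≤ l.length then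
    MTree.nd (fun i =>
      build m ((l.drop (m - 1)).filter
        (fun x => (l.take (m - 1)).countP (fun p => decide (p < x)) == (i : ℕ))))
  else MTree.lf l.length
termination_by l.length
decreasing_by
  exact lt_of_le_of_lt (List.length_filter_le _ _) (by rw [List.length_drop]; omega)

open Classical in
/-- The number of fringe subtrees of a tree that are isomorphic (as marked ordered
trees, i.e. equal) to the fixed tree `T`. -/
noncomputable def countEq {m : ℕ} (T : MTree m) : MTree m → ℕ
  | MTree.lf j => if MTree.lf j = T then 1 else 0
  | MTree.nd c => (if MTree.nd c = T then 1 else 0) + ∑ i, countEq T (c i)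

open Classical in
/-- The number of fringe subtrees with exactly `k` keys. -/
noncomputable def countKeys {m : ℕ} (k : ℕ) : MTree m → ℕ
  | MTree.lf j => if j = k then 1 else 0
  | MTree.nd c => (if MTree.keys (MTree.nd c) = k then 1 else 0) + ∑ i, countKeys k (c i)

/-- The random `m`-ary search tree with `n` keys, as a function of the permutation
(the order in which the keys `1, …, n` arrive). -/
def mst (m n : ℕ) (π : Equiv.Perm (Fin n)) : MTree m :=
  build m ((List.finRange n).map (fun i => ((π i : ℕ))))

/-- Expectation of a functional of the random `m`-ary search tree, i.e. the average
over the `n!` (uniformly distributed) permutations. -/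
noncomputable def pexp (n : ℕ) (f : Equiv.Perm (Fin n) → ℝ) : ℝ :=
  (∑ π : Equiv.Perm (Fin n), f π) / (Nat.factorial n : ℝ)

/-- The harmonic number `H_m`. -/
noncomputable def Hm (m : ℕ) : ℝ := ∑ i ∈ Finset.range m, (1 : ℝ) / ((i : ℝ) + 1)

open MeasureTheory in
/-- `W_n` converges in distribution, under the uniformly random permutation model,
to the centered normal distribution with variance `v`. -/
def TendstoGauss (W : (n : ℕ) → Equiv.Perm (Fin n) → ℝ) (v : NNReal) : Prop :=
  ∀ f : BoundedContinuousFunction ℝ ℝ,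
    Filter.Tendsto (fun n => pexp n (fun π => f (W n π)))
      Filter.atTop (nhds (∫ x, f x ∂(ProbabilityTheory.gaussianReal 0 v)))

end MSTpaper

namespace MSTpaper

/-- The average of `F` over all orderings of the elements of a set `S` with `k` elements. -/
noncomputable def orderMean : ℕ → Finset ℕ → (List ℕ → ℂ) → ℂ
  | 0, _, F => F []
  | k + 1, S, F => (∑ a ∈ S, orderMean k (S.erase a) (fun l => F (a :: l))) / ((k : ℂ) + 1)

lemma orderMean_congr {k : ℕ} {S : Finset ℕ} {F G : List ℕ → ℂ}
    (h : ∀ l, l.length = k → F l = G l) : orderMean k S F = orderMean k S G := by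
  induction k generalizing S F G with
  | zero => exact h [] rfl
  | succ k ih =>
    simp only [orderMean]
    congr 1
    exact Finset.sum_congr rfl fun a _ => ih fun l hl => h _ (by simp [hl])

lemma orderMean_add (k : ℕ) (S : Finset ℕ) (F G : List ℕ → ℂ) :
    orderMean k S (fun l => F l + G l) = orderMean k S F + orderMean k S G := by
  induction k generalizing S F G with
  | zero => rfl
  | succ k ih => simp only [orderMean, ih, Finset.sum_add_distrib, add_div]

lemma orderMean_const_mul (k : ℕ) (S : Finset ℕ) (c : ℂ) (F : List ℕ → ℂ) :
    orderMean k S (fun l => c * F l) = c * orderMean k S F := by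
  induction k generalizing S F with
  | zero => rfl
  | succ k ih => simp only [orderMean, ih, ← Finset.mul_sum, mul_div_assoc]

lemma orderMean_sum {ι : Type*} (k : ℕ) (S : Finset ℕ) (s : Finset ι) (F : ι → List ℕ → ℂ) :
    orderMean k S (fun l => ∑ i ∈ s, F i l) = ∑ i ∈ s, orderMean k S (F i) := by
  classical
  induction s using Finset.induction_on with
  | empty => simpa using orderMean_const_mul k S 0 (fun _ => 0)
  | insert i s hi ih => simp only [Finset.sum_insert hi, orderMean_add, ih]

lemma orderMean_const {k : ℕ} {S : Finset ℕ} (hS : S.card = k) (c : ℂ) :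
    orderMean k S (fun _ => c) = c := by
  induction k generalizing S with
  | zero => rfl
  | succ k ih =>
    have : ((k : ℂ) + 1) ≠ 0 := by exact_mod_cast k.succ_ne_zero
    simp only [orderMean]
    rw [Finset.sum_congr rfl fun a ha => ih (by rw [Finset.card_erase_of_mem ha, hS]; rfl)]
    simp [hS]
    field_simp

lemma norm_orderMean_le {k : ℕ} {S : Finset ℕ} {F : List ℕ → ℂ} {G : List ℕ → ℝ}
    (h : ∀ l, ‖F l‖ ≤ G l) : ‖orderMean k S F‖ ≤ (orderMean k S (fun l => (G l : ℂ))).re := by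
  induction k generalizing S F G with
  | zero => simpa [orderMean] using h []
  | succ k ih =>
    have hk : ((k : ℂ) + 1) = ((k + 1 : ℝ) : ℂ) := by push_cast; rfl
    simp only [orderMean]
    rw [hk, Complex.div_ofReal_re, norm_div, Complex.norm_real, Real.norm_of_nonneg (by positivity),
      Complex.re_sum]
    gcongr
    refine (norm_sum_le _ _).trans (Finset.sum_le_sum fun a _ => ih fun l => h _)

/-- The two sublists of a uniformly random ordering determined by a predicate are independent
and uniformly distributed. -/
lemma orderMean_filter {k : ℕ} {S : Finset ℕ} (hS : S.card = k) (p : ℕ → Bool)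
    (F : List ℕ → List ℕ → ℂ) :
    orderMean k S (fun l => F (l.filter p) (l.filter fun x => !p x)) =
      orderMean (S.filter (fun x => p x = true)).card (S.filter (fun x => p x = true)) fun l =>
        orderMean (S.filter (fun x => p x = false)).card (S.filter (fun x => p x = false)) fun l' =>
          F l l' := by
  induction k generalizing S F with
  | zero =>
    obtain rfl := Finset.card_eq_zero.mp hS
    simp [orderMean]
  | succ k ih =>
    have hk : ((k : ℂ) + 1) ≠ 0 := by exact_mod_cast k.succ_ne_zero
    have hcard (a) (ha : a ∈ S) : (S.erase a).card = k := by
      rw [Finset.card_erase_of_mem ha, hS]; rfl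
    set A := S.filter (fun x => p x = true) with hA
    set B := S.filter (fun x => p x = false) with hB
    have hdisj : S = A ∪ B := by ext x; simp [hA, hB]; cases p x <;> simp
    have hAB : (A.card : ℂ) + B.card = k + 1 := by
      have h2 : Disjoint A B := by
        rw [Finset.disjoint_left]; simp +contextual [hA, hB]
      rw [← Nat.cast_add, ← Finset.card_union_of_disjoint h2, ← hdisj, hS]; push_cast; rfl
    have key : ∀ a ∈ S, orderMean k (S.erase a) (fun l =>
        F ((a :: l).filter p) ((a :: l).filter fun x => !p x)) =
        if p a = true then
          orderMean (A.card - 1) (A.erase a) fun l => orderMean B.card B fun l' => F (a :: l) l'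
        else orderMean A.card A fun l => orderMean (B.card - 1) (B.erase a) fun l' => F l (a :: l')
        := by
      intro a ha
      cases hpa : p a
      · have h1 : (S.erase a).filter (fun x => p x = true) = A := by
          ext x; grind
        have h2 : (S.erase a).filter (fun x => p x = false) = B.erase a := by
          ext x; simp [hB, and_assoc]
        have h3 : a ∈ B := by simp [hB, ha, hpa]
        have := ih (hcard a ha) (fun l l' => F l (a :: l'))
        rw [h1, h2, Finset.card_erase_of_mem h3] at this
        simpa [hpa] using this
      · have h1 : (S.erase a).filter (fun x => p x = false) = B := by
          ext x; grind
        have h2 : (S.erase a).filter (fun x => p x = true) = A.erase a := by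
          ext x; simp [hA, and_assoc]
        have h3 : a ∈ A := by simp [hA, ha, hpa]
        have := ih (hcard a ha) (fun l l' => F (a :: l) l')
        rw [h1, h2, Finset.card_erase_of_mem h3] at this
        simpa [hpa] using this
    simp only [orderMean]
    rw [Finset.sum_congr rfl key, div_eq_iff hk, Finset.sum_ite]
    have hA' : S.filter (fun x => ¬ p x = true) = B := by ext x; simp [hB]
    rw [hA', ← hA, ← hAB, mul_add]
    congr 1
    · rcases hc : A.card with _ | a
      · simp [Finset.card_eq_zero.mp hc]
      · have ha0 : ((a : ℂ) + 1) ≠ 0 := by exact_mod_cast a.succ_ne_zero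
        simp only [orderMean, Nat.add_sub_cancel, Nat.cast_add, Nat.cast_one]
        field_simp
    · rcases hc : B.card with _ | b
      · simp [Finset.card_eq_zero.mp hc]
      · have hb0 : ((b : ℂ) + 1) ≠ 0 := by exact_mod_cast b.succ_ne_zero
        simp only [orderMean, Nat.add_sub_cancel, Nat.cast_add, Nat.cast_one]
        rw [← orderMean_sum, mul_comm, ← orderMean_const_mul]
        congr 1
        ext l
        field_simp

/-- The mean over permutations is the mean over orderings. -/
lemma sum_perm_eq_orderMean {n : ℕ} (g : Fin n → ℕ) (hg : Function.Injective g)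
    (F : List ℕ → ℂ) :
    ∑ π : Equiv.Perm (Fin n), F ((List.finRange n).map fun i => g (π i)) =
      n.factorial * orderMean n (Finset.univ.image g) F := by
  induction n generalizing F with
  | zero => simp [orderMean]
  | succ n ih =>
    have hn : ((n : ℂ) + 1) ≠ 0 := by exact_mod_cast n.succ_ne_zero
    rw [← (Equiv.Perm.decomposeFin (n := n)).symm.sum_comp, Fintype.sum_prod_type]
    have key (q : Fin (n + 1)) : ∑ e : Equiv.Perm (Fin n), F ((List.finRange (n + 1)).map fun i =>
        g (Equiv.Perm.decomposeFin.symm (q, e) i)) =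
        n.factorial * orderMean n ((Finset.univ.image g).erase (g q)) (fun l => F (g q :: l)) := by
      have hinj : Function.Injective fun i : Fin n => g (Equiv.swap 0 q i.succ) :=
        hg.comp ((Equiv.injective _).comp (Fin.succ_injective _))
      have := ih (fun i => g (Equiv.swap 0 q i.succ)) hinj (fun l => F (g q :: l))
      have himg : Finset.univ.image (fun i : Fin n => g (Equiv.swap 0 q i.succ)) =
          (Finset.univ.image g).erase (g q) := by
        apply Finset.eq_of_subset_of_card_le
        · intro x
          simp only [Finset.mem_image, Finset.mem_univ, true_and, Finset.mem_erase]
          rintro ⟨i, rfl⟩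
          refine ⟨fun h => ?_, _, rfl⟩
          have h1 := hg h
          rw [Equiv.swap_apply_eq_iff, Equiv.swap_apply_right] at h1
          exact Fin.succ_ne_zero _ h1
        · rw [Finset.card_erase_of_mem (by simp), Finset.card_image_of_injective _ hg,
            Finset.card_image_of_injective _ hinj]
          simp
      rw [himg] at this
      rw [← this]
      refine Finset.sum_congr rfl fun e _ => ?_
      rw [List.finRange_succ]
      simp [Function.comp_def]
    rw [Finset.sum_congr rfl fun q _ => key q, ← Finset.mul_sum]
    simp only [orderMean]
    rw [Finset.sum_image (fun a _ b _ h => hg h), Nat.factorial_succ]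
    push_cast
    field_simp

/-- The index of the interval determined by `a` and `b` that contains `x`. -/
def interval (a b x : ℕ) : ℕ := [a, b].countP fun p => decide (p < x)

lemma interval_eq (a b x : ℕ) :
    interval a b x = (if a < x then 1 else 0) + if b < x then 1 else 0 := by
  by_cases ha : a < x <;> by_cases hb : b < x <;> simp [interval, ha, hb]

lemma interval_comm (a b : ℕ) : interval a b = interval b a := by
  ext x; rw [interval_eq, interval_eq, add_comm]

lemma interval_le_two (a b x : ℕ) : interval a b x ≤ 2 := by
  rw [interval_eq]; split_ifs <;> simp

lemma build_cons_cons (a b : ℕ) (l : List ℕ) :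
    build 3 (a :: b :: l) =
      MTree.nd fun i => build 3 (l.filter fun x => interval a b x == (i : ℕ)) := by
  rw [build]; simp [interval]

lemma build_of_length_lt {l : List ℕ} (hl : l.length < 2) : build 3 l = MTree.lf l.length := by
  rw [build]; simp; omega

lemma length_filter_interval (a b : ℕ) (l : List ℕ) :
    ∑ i : Fin 3, (l.filter fun x => interval a b x == (i : ℕ)).length = l.length := by
  induction l with
  | nil => simp
  | cons x l ih =>
    have hx := interval_le_two a b x
    simp only [Fin.sum_univ_three, List.filter_cons] at ih ⊢
    interval_cases h : interval a b x <;> simp at ih ⊢ <;> omega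

lemma keys_build (l : List ℕ) : MTree.keys (build 3 l) = l.length := by
  induction hn : l.length using Nat.strong_induction_on generalizing l with
  | _ n ih =>
    subst hn
    match l with
    | [] => rw [build_of_length_lt (by simp)]; rfl
    | [a] => rw [build_of_length_lt (by simp)]; rfl
    | a :: b :: l =>
      rw [build_cons_cons, MTree.keys, Finset.sum_congr rfl fun i _ => ih _ ?_ _ rfl,
        length_filter_interval, List.length_cons, List.length_cons]
      · omega
      · simp only [List.length_cons]
        exact Nat.lt_of_le_of_lt (List.length_filter_le _ _) (by omega)

/-- The number of fringe subtrees with four keys in the ternary search tree built from `l`. -/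
noncomputable def fourCount (l : List ℕ) : ℕ := countKeys 4 (build 3 l)

lemma fourCount_of_length_lt {l : List ℕ} (hl : l.length < 2) : fourCount l = 0 := by
  rw [fourCount, build_of_length_lt hl, countKeys, if_neg (by omega)]

lemma fourCount_cons_cons (a b : ℕ) (l : List ℕ) :
    fourCount (a :: b :: l) =
      fourCount (l.filter fun x => interval a b x == 0) +
      fourCount (l.filter fun x => interval a b x == 1) +
      fourCount (l.filter fun x => interval a b x == 2) + if l.length = 2 then 1 else 0 := by
  have hk := keys_build (a :: b :: l)
  rw [fourCount, build_cons_cons] at *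
  rw [countKeys, hk, Fin.sum_univ_three, add_comm]
  simp [fourCount]

/-- The expectation of `F (Y_n)`, where `Y_n` is the number of fringe subtrees with four keys in
the random ternary search tree with `n` keys. -/
noncomputable def law (n : ℕ) (F : ℕ → ℂ) : ℂ :=
  orderMean n (Finset.range n) fun l => F (fourCount l)

lemma orderMean_three {S : Finset ℕ} {n : ℕ} (hS : S.card = n) (a b : ℕ)
    (F : List ℕ → List ℕ → List ℕ → ℂ) :
    orderMean n S (fun l => F (l.filter fun x => interval a b x == 0)
      (l.filter fun x => interval a b x == 1) (l.filter fun x => interval a b x == 2)) =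
    orderMean (S.filter fun x => interval a b x = 0).card (S.filter fun x => interval a b x = 0)
      fun l₀ =>
    orderMean (S.filter fun x => interval a b x = 1).card (S.filter fun x => interval a b x = 1)
      fun l₁ =>
    orderMean (S.filter fun x => interval a b x = 2).card (S.filter fun x => interval a b x = 2)
      fun l₂ => F l₀ l₁ l₂ := by
  have h1 (x : ℕ) : ((interval a b x == 1) && !(interval a b x == 0)) = (interval a b x == 1) := by
    generalize interval a b x = c; grind
  have h2 (x : ℕ) : ((!(interval a b x == 1)) && !(interval a b x == 0)) =
      (interval a b x == 2) := by
    have := interval_le_two a b x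
    generalize interval a b x = c at *; interval_cases c <;> rfl
  have e1 : (S.filter fun x => (interval a b x == 0) = false).filter
      (fun x => (interval a b x == 1) = true) = S.filter fun x => interval a b x = 1 := by
    ext x; simp; grind
  have e2 : (S.filter fun x => (interval a b x == 0) = false).filter
      (fun x => (interval a b x == 1) = false) = S.filter fun x => interval a b x = 2 := by
    ext x; have := interval_le_two a b x; simp; grind
  have e0 : (S.filter fun x => (interval a b x == 0) = true) =
      S.filter fun x => interval a b x = 0 := by ext x; simp
  have := orderMean_filter hS (fun x => interval a b x == 0)
    (fun l l' => F l (l'.filter fun x => interval a b x == 1)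
      (l'.filter fun x => !(interval a b x == 1)))
  simp only [List.filter_filter, h1, h2] at this
  rw [this, e0]
  congr 1
  ext l₀
  rw [orderMean_filter rfl (fun x => interval a b x == 1) (F l₀), e1, e2]

lemma card_filter_interval {N : ℕ} (f : Fin N ↪o ℕ) {i j : Fin N} (hij : i < j) (c : ℕ) :
    ((((Finset.univ.map f.toEmbedding).erase (f i)).erase (f j)).filter
      fun x => interval (f i) (f j) x = c).card =
    if c = 0 then (i : ℕ) else if c = 1 then (j : ℕ) - i - 1 else if c = 2 then N - 1 - j else 0
    := by
  have : (((Finset.univ.map f.toEmbedding).erase (f i)).erase (f j)).filter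
      (fun x => interval (f i) (f j) x = c) =
    (if c = 0 then Finset.Iio i else if c = 1 then Finset.Ioo i j else
      if c = 2 then Finset.Ioi j else ∅).map f.toEmbedding := by
    ext x
    simp only [Finset.mem_filter, Finset.mem_erase, Finset.mem_map, Finset.mem_univ, true_and,
      interval_eq, RelEmbedding.coe_toEmbedding]
    constructor
    · rintro ⟨⟨h1, h2, k, rfl⟩, h⟩
      refine ⟨k, ?_, rfl⟩
      simp only [f.lt_iff_lt, ne_eq, f.injective.eq_iff] at *
      split_ifs at * <;> simp <;> omega
    · rintro ⟨k, hk, rfl⟩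
      simp only [f.lt_iff_lt, ne_eq, f.injective.eq_iff]
      refine ⟨⟨?_, ?_, k, rfl⟩, ?_⟩ <;> split_ifs at * <;> simp at hk <;> omega
  rw [this, Finset.card_map]
  split_ifs <;> simp

/-- The sum of `H a b c` over all `a + b + c = n`. -/
def tripleSum {M : Type*} [AddCommMonoid M] (n : ℕ) (H : ℕ → ℕ → ℕ → M) : M :=
  ∑ x ∈ Finset.HasAntidiagonal.antidiagonal n,
    ∑ y ∈ Finset.HasAntidiagonal.antidiagonal x.1, H y.1 y.2 x.2

lemma sum_pairs_eq (n : ℕ) (H : ℕ → ℕ → ℕ → ℂ) :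
    ∑ i : Fin (n + 2), ∑ j : Fin (n + 2),
      (if i < j then H i (j - i - 1) (n + 2 - 1 - j) else 0) =
    tripleSum n H := by
  rw [tripleSum, ← Finset.sum_product', ← Finset.sum_filter, Finset.sum_sigma']
  symm
  refine Finset.sum_bij (fun z hz => ((⟨z.2.1, ?_⟩ : Fin (n + 2)),
    (⟨z.2.1 + z.2.2 + 1, ?_⟩ : Fin (n + 2)))) ?_ ?_ ?_ ?_
  · simp at hz; omega
  · simp at hz; omega
  · intro z hz; simp at hz ⊢
  · rintro ⟨⟨a, b⟩, c, d⟩ h1 ⟨⟨a', b'⟩, c', d'⟩ h2 h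
    simp at h1 h2 h
    have : c = c' := h.1
    have : d = d' := by omega
    have : a = a' := by omega
    have : b = b' := by omega
    subst_vars; rfl
  · rintro ⟨i, j⟩ h
    simp at h
    refine ⟨⟨(j - 1, n + 1 - j), (i, j - i - 1)⟩, ?_, ?_⟩
    · have := j.2
      simp; omega
    · ext <;> simp; omega
  · rintro ⟨⟨a, b⟩, c, d⟩ h
    simp at h ⊢
    congr 1 <;> omega

lemma sum_pairs_erase {S : Finset ℕ} {n : ℕ} (hS : S.card = n + 2) (H : ℕ → ℕ → ℕ → ℂ) :
    ∑ a ∈ S, ∑ b ∈ S.erase a,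
      H (((S.erase a).erase b).filter fun x => interval a b x = 0).card
        (((S.erase a).erase b).filter fun x => interval a b x = 1).card
        (((S.erase a).erase b).filter fun x => interval a b x = 2).card =
    2 * tripleSum n H := by
  set f := S.orderEmbOfFin hS with hf
  have hSf : S = Finset.univ.map f.toEmbedding := by
    simp [hf]
  have e (i : Fin (n + 2)) : (Finset.univ.map f.toEmbedding).erase (f i) =
      (Finset.univ.erase i).map f.toEmbedding := by
    rw [Finset.map_erase]; rfl
  rw [hSf, Finset.sum_map]
  simp only [RelEmbedding.coe_toEmbedding]
  have key (i j : Fin (n + 2)) (hij : j ∈ Finset.univ.erase i) :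
      H ((((Finset.univ.map f.toEmbedding).erase (f i)).erase (f j)).filter
          fun x => interval (f i) (f j) x = 0).card
        ((((Finset.univ.map f.toEmbedding).erase (f i)).erase (f j)).filter
          fun x => interval (f i) (f j) x = 1).card
        ((((Finset.univ.map f.toEmbedding).erase (f i)).erase (f j)).filter
          fun x => interval (f i) (f j) x = 2).card =
      (if i < j then H i (j - i - 1) (n + 2 - 1 - j) else 0) +
      (if j < i then H j (i - j - 1) (n + 2 - 1 - i) else 0) := by
    have hne : j ≠ i := by simpa using hij
    rcases lt_or_gt_of_ne hne with h | h
    · rw [interval_comm, Finset.erase_right_comm]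
      simp only [card_filter_interval f h]
      simp [h, h.not_gt]
    · simp only [card_filter_interval f h]
      simp [h, h.not_gt]
  have key2 (i : Fin (n + 2)) : ∑ b ∈ (Finset.univ.map f.toEmbedding).erase (f i),
      H ((((Finset.univ.map f.toEmbedding).erase (f i)).erase b).filter
          fun x => interval (f i) b x = 0).card
        ((((Finset.univ.map f.toEmbedding).erase (f i)).erase b).filter
          fun x => interval (f i) b x = 1).card
        ((((Finset.univ.map f.toEmbedding).erase (f i)).erase b).filter
          fun x => interval (f i) b x = 2).card =
      ∑ j : Fin (n + 2), ((if i < j then H i (j - i - 1) (n + 2 - 1 - j) else 0) +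
      (if j < i then H j (i - j - 1) (n + 2 - 1 - i) else 0)) := by
    conv_lhs => rw [show ∀ g : ℕ → ℂ, ∑ b ∈ (Finset.univ.map f.toEmbedding).erase (f i), g b =
      ∑ j ∈ Finset.univ.erase i, g (f j) from fun g => by rw [e, Finset.sum_map]; rfl]
    rw [Finset.sum_congr rfl fun j hj => key i j hj]
    apply Finset.sum_erase
    simp
  rw [Finset.sum_congr rfl fun i _ => key2 i]
  simp only [Finset.sum_add_distrib]
  rw [← sum_pairs_eq, two_mul]
  congr 1
  exact Finset.sum_comm

lemma orderMean_fourCount_step {n : ℕ}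
    (ih : ∀ k ≤ n, ∀ S : Finset ℕ, S.card = k → ∀ F : ℕ → ℂ,
      orderMean k S (fun l => F (fourCount l)) = law k F)
    {S : Finset ℕ} (hS : S.card = n + 2) (F : ℕ → ℂ) :
    orderMean (n + 2) S (fun l => F (fourCount l)) =
      (2 * tripleSum n fun a b c =>
        law a fun i => law b fun j => law c fun k => F (i + j + k + if n = 2 then 1 else 0)) /
      (((n : ℂ) + 1) * (n + 2)) := by
  have hn1 : ((n : ℂ) + 1) ≠ 0 := by exact_mod_cast n.succ_ne_zero
  have hn2 : ((n : ℂ) + 2) ≠ 0 := by exact_mod_cast (n + 1).succ_ne_zero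
  simp only [orderMean]
  rw [← sum_pairs_erase hS]
  simp only [← Finset.sum_div]
  rw [div_div, show ((n + 1 : ℕ) : ℂ) + 1 = n + 2 by push_cast; ring]
  congr 1
  refine Finset.sum_congr rfl fun a ha => Finset.sum_congr rfl fun b hb => ?_
  have hcard : ((S.erase a).erase b).card = n := by
    rw [Finset.card_erase_of_mem hb, Finset.card_erase_of_mem ha, hS]; rfl
  rw [orderMean_congr (G := fun l => F (fourCount (l.filter fun x => interval a b x == 0) +
      fourCount (l.filter fun x => interval a b x == 1) +
      fourCount (l.filter fun x => interval a b x == 2) + if n = 2 then 1 else 0))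
      fun l hl => by rw [fourCount_cons_cons, hl]]
  have hle (p : ℕ → Prop) [DecidablePred p] : (((S.erase a).erase b).filter p).card ≤ n :=
    (Finset.card_filter_le _ _).trans hcard.le
  rw [orderMean_three hcard a b fun l₀ l₁ l₂ => F (fourCount l₀ + fourCount l₁ + fourCount l₂ +
    if n = 2 then 1 else 0)]
  rw [← ih _ (hle _) _ rfl]
  congr 1
  ext l₀
  rw [← ih _ (hle _) _ rfl]
  congr 1
  ext l₁
  rw [← ih _ (hle _) _ rfl]

lemma orderMean_fourCount {n : ℕ} {S : Finset ℕ} (hS : S.card = n) (F : ℕ → ℂ) :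
    orderMean n S (fun l => F (fourCount l)) = law n F := by
  induction n using Nat.strong_induction_on generalizing S F with
  | _ n ih =>
    match n with
    | 0 => rfl
    | 1 =>
      have h (l : List ℕ) (hl : l.length = 1) : F (fourCount l) = F 0 := by
        rw [fourCount_of_length_lt (by omega)]
      rw [law, orderMean_congr h, orderMean_congr h, orderMean_const hS,
        orderMean_const (Finset.card_range 1)]
    | n + 2 =>
      have ih' : ∀ k ≤ n, ∀ S : Finset ℕ, S.card = k → ∀ F : ℕ → ℂ,
          orderMean k S (fun l => F (fourCount l)) = law k F :=
        fun k hk S hS F => ih k (by omega) hS F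
      rw [law, orderMean_fourCount_step ih' hS, orderMean_fourCount_step ih' (Finset.card_range _)]

/-- The recursive description of the law of `Y_n`. -/
lemma law_add_two (n : ℕ) (F : ℕ → ℂ) :
    ((n : ℂ) + 1) * (n + 2) * law (n + 2) F =
      2 * tripleSum n fun a b c =>
        law a fun i => law b fun j => law c fun k => F (i + j + k + if n = 2 then 1 else 0) := by
  have hn1 : ((n : ℂ) + 1) ≠ 0 := by exact_mod_cast n.succ_ne_zero
  have hn2 : ((n : ℂ) + 2) ≠ 0 := by exact_mod_cast (n + 1).succ_ne_zero
  rw [law, orderMean_fourCount_step (fun k _ S hS F => orderMean_fourCount hS F)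
    (Finset.card_range _)]
  field_simp

lemma law_of_lt_two {n : ℕ} (hn : n < 2) (F : ℕ → ℂ) : law n F = F 0 := by
  rw [law, orderMean_congr (G := fun _ => F 0) fun l hl => by
    rw [fourCount_of_length_lt (by omega)], orderMean_const (Finset.card_range n)]

lemma law_add (n : ℕ) (F G : ℕ → ℂ) : law n (fun y => F y + G y) = law n F + law n G :=
  orderMean_add _ _ _ _

lemma law_const_mul (n : ℕ) (c : ℂ) (F : ℕ → ℂ) : law n (fun y => c * F y) = c * law n F :=
  orderMean_const_mul _ _ _ _

lemma law_const (n : ℕ) (c : ℂ) : law n (fun _ => c) = c :=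
  orderMean_const (Finset.card_range n) c

lemma law_sub (n : ℕ) (F G : ℕ → ℂ) : law n (fun y => F y - G y) = law n F - law n G := by
  have := law_add n F (fun y => -1 * G y)
  rw [law_const_mul] at this
  simpa [sub_eq_add_neg] using this

lemma norm_law_le {n : ℕ} {F : ℕ → ℂ} {G : ℕ → ℝ} (h : ∀ y, ‖F y‖ ≤ G y) :
    ‖law n F‖ ≤ (law n fun y => (G y : ℂ)).re :=
  norm_orderMean_le fun _ => h _

lemma sum_perm_mst (n : ℕ) (F : ℕ → ℂ) :
    ∑ π : Equiv.Perm (Fin n), F (countKeys 4 (mst 3 n π)) = n.factorial * law n F := by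
  have := sum_perm_eq_orderMean (n := n) (fun i => (i : ℕ)) Fin.val_injective
    (fun l => F (fourCount l))
  rw [orderMean_fourCount (by simp [Finset.card_image_of_injective _ Fin.val_injective])] at this
  exact this

section Coefficients

open PowerSeries

lemma coeff_mul_mul (n : ℕ) (A B C : ℝ⟦X⟧) :
    coeff n (A * B * C) = tripleSum n fun a b c => coeff a A * coeff b B * coeff c C := by
  rw [coeff_mul, tripleSum]
  refine Finset.sum_congr rfl fun x _ => ?_
  rw [coeff_mul, Finset.sum_mul]

lemma tripleSum_add {M : Type*} [AddCommMonoid M] (n : ℕ) (F G : ℕ → ℕ → ℕ → M) :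
    tripleSum n (fun a b c => F a b c + G a b c) = tripleSum n F + tripleSum n G := by
  simp only [tripleSum, Finset.sum_add_distrib]

lemma tripleSum_mul_left {R : Type*} [Semiring R] (n : ℕ) (r : R) (F : ℕ → ℕ → ℕ → R) :
    tripleSum n (fun a b c => r * F a b c) = r * tripleSum n F := by
  simp only [tripleSum, Finset.mul_sum]

lemma tripleSum_congr {M : Type*} [AddCommMonoid M] {n : ℕ} {F G : ℕ → ℕ → ℕ → M}
    (h : ∀ a b c, a + b + c = n → F a b c = G a b c) : tripleSum n F = tripleSum n G := by
  refine Finset.sum_congr rfl fun x hx => Finset.sum_congr rfl fun y hy => h _ _ _ ?_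
  rw [Finset.HasAntidiagonal.mem_antidiagonal.mp hy,
    Finset.HasAntidiagonal.mem_antidiagonal.mp hx]

/-- The geometric series `1 / (1 - X)`. -/
noncomputable def geomSeries : ℝ⟦X⟧ := mk 1

/-- The power series of `log (1 - X)`. -/
noncomputable def logSeries : ℝ⟦X⟧ := mk fun n => -(1 / (n : ℝ))

lemma geomSeries_mul : geomSeries * (1 - X) = 1 := mk_one_mul_one_sub_eq_one ℝ

lemma coeff_geomSeries (n : ℕ) : coeff n geomSeries = 1 := by simp [geomSeries]

lemma derivative_logSeries : d⁄dX ℝ logSeries = -geomSeries := by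
  ext n
  rw [coeff_derivative, logSeries, coeff_mk, map_neg, coeff_geomSeries]
  push_cast
  field_simp

lemma derivative_one_sub : d⁄dX ℝ (1 - X : ℝ⟦X⟧) = -1 := by
  rw [map_sub, derivative_X, derivative_one]; simp

lemma derivative_one_sub_pow (k : ℕ) :
    d⁄dX ℝ ((1 - X : ℝ⟦X⟧) ^ k) = -((k : ℝ⟦X⟧) * (1 - X) ^ (k - 1)) := by
  rw [derivative_pow, derivative_one_sub]; ring

lemma derivative_pow_mul_log (k : ℕ) : d⁄dX ℝ ((1 - X) ^ (k + 1) * logSeries) =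
    -(((k : ℝ⟦X⟧) + 1) * ((1 - X) ^ k * logSeries)) - (1 - X) ^ k := by
  rw [Derivation.leibniz, derivative_logSeries, derivative_one_sub_pow]
  simp only [smul_eq_mul, Nat.add_sub_cancel, Nat.cast_add, Nat.cast_one]
  linear_combination (-(1 - X) ^ k) * geomSeries_mul

lemma derivative_pow_mul_log_sq (k : ℕ) : d⁄dX ℝ ((1 - X) ^ (k + 1) * logSeries ^ 2) =
    -(((k : ℝ⟦X⟧) + 1) * ((1 - X) ^ k * logSeries ^ 2)) - 2 * ((1 - X) ^ k * logSeries) := by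
  rw [Derivation.leibniz, derivative_pow, derivative_logSeries, derivative_one_sub_pow]
  simp only [smul_eq_mul, Nat.add_sub_cancel, Nat.cast_add, Nat.cast_one]
  push_cast
  linear_combination (-2 * logSeries * (1 - X) ^ k) * geomSeries_mul

/-- The generating function of the centred means, up to a factor `25`. -/
noncomputable def meanSeries : ℝ⟦X⟧ :=
  24 * (1 - X) ^ 3 - 75 * (1 - X) ^ 2 + 50 * (1 - X) ^ 4 - 120 * ((1 - X) ^ 3 * logSeries)

/-- The generating function of the deviation of the second moments from their linear part, up to
a factor `1299375`. -/
noncomputable def varSeries : ℝ⟦X⟧ :=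
  407484 * (1 - X) ^ 3 - 2338875 * (1 - X) ^ 2 + 1559250 * (1 - X) ^ 4 + 10023750 * (1 - X) ^ 5
  - 12318075 * (1 - X) ^ 6 - 1308692 * (1 - X) ^ 7 + 2993760 * (1 - X) ^ 8 + 945000 * (1 - X) ^ 9
  - 3742200 * ((1 - X) ^ 3 * logSeries) + 18711000 * ((1 - X) ^ 6 * logSeries)
  - 11198880 * ((1 - X) ^ 7 * logSeries) - 5987520 * ((1 - X) ^ 8 * logSeries)
  + 9979200 * ((1 - X) ^ 7 * logSeries ^ 2)

lemma derivative_ofNat_mul (c : ℕ) [c.AtLeastTwo] (f : ℝ⟦X⟧) :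
    d⁄dX ℝ (ofNat(c) * f) = ofNat(c) * d⁄dX ℝ f := by
  rw [← Nat.cast_ofNat (R := ℝ⟦X⟧), ← nsmul_eq_mul, map_nsmul, nsmul_eq_mul]

lemma derivative_meanSeries : d⁄dX ℝ meanSeries =
    150 * (1 - X) ^ 1 + 48 * (1 - X) ^ 2 - 200 * (1 - X) ^ 3 + 360 * ((1 - X) ^ 2 * logSeries) := by
  simp only [meanSeries, map_add, map_sub, derivative_ofNat_mul, derivative_one_sub_pow,
    derivative_pow_mul_log]
  push_cast
  ring

lemma derivative_derivative_meanSeries : d⁄dX ℝ (d⁄dX ℝ meanSeries) =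
    6 * (meanSeries * geomSeries * geomSeries) + 300 * X ^ 2 := by
  rw [derivative_meanSeries]
  simp only [map_add, map_sub, derivative_ofNat_mul, derivative_one_sub_pow,
    derivative_pow_mul_log, meanSeries]
  have h : (1 - X) ^ 2 * geomSeries ^ 2 = 1 := by
    rw [← mul_pow, mul_comm, geomSeries_mul, one_pow]
  push_cast
  linear_combination (-6 * (24 * (1 - X) - 75 + 50 * (1 - X) ^ 2
    - 120 * ((1 - X) * logSeries))) * h

lemma derivative_varSeries : d⁄dX ℝ varSeries =
    2519748 * (1 - X) ^ 2 + 4677750 * (1 - X) ^ 1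
    - 6237000 * (1 - X) ^ 3 - 50118750 * (1 - X) ^ 4 + 55197450 * (1 - X) ^ 5
    + 20359724 * (1 - X) ^ 6 - 17962560 * (1 - X) ^ 7
    - 8505000 * (1 - X) ^ 8 + 11226600 * ((1 - X) ^ 2 * logSeries)
    - 112266000 * ((1 - X) ^ 5 * logSeries) + 78392160 * ((1 - X) ^ 6 * logSeries)
    - 19958400 * ((1 - X) ^ 6 * logSeries)
    + 47900160 * ((1 - X) ^ 7 * logSeries) - 69854400 * ((1 - X) ^ 6 * logSeries ^ 2) := by
  simp only [varSeries, map_add, map_sub, derivative_ofNat_mul, derivative_one_sub_pow,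
    derivative_pow_mul_log, derivative_pow_mul_log_sq]
  push_cast
  ring

lemma derivative_derivative_varSeries : d⁄dX ℝ (d⁄dX ℝ varSeries) =
    6 * (varSeries * geomSeries * geomSeries) + 24948 * (meanSeries * meanSeries * geomSeries)
      + 9355500 * X ^ 2 := by
  have h : (1 - X) ^ 2 * geomSeries ^ 2 = 1 := by
    rw [← mul_pow, mul_comm, geomSeries_mul, one_pow]
  have h2 : varSeries = (1 - X) ^ 2 * (407484 * (1 - X) - 2338875 + 1559250 * (1 - X) ^ 2
      + 10023750 * (1 - X) ^ 3 - 12318075 * (1 - X) ^ 4 - 1308692 * (1 - X) ^ 5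
      + 2993760 * (1 - X) ^ 6 + 945000 * (1 - X) ^ 7
      - 3742200 * ((1 - X) * logSeries) + 18711000 * ((1 - X) ^ 4 * logSeries)
      - 11198880 * ((1 - X) ^ 5 * logSeries) - 5987520 * ((1 - X) ^ 6 * logSeries)
      + 9979200 * ((1 - X) ^ 5 * logSeries ^ 2)) := by
    rw [varSeries]; ring
  have h3 : meanSeries = (1 - X) * (24 * (1 - X) ^ 2 - 75 * (1 - X) + 50 * (1 - X) ^ 3
      - 120 * ((1 - X) ^ 2 * logSeries)) := by
    rw [meanSeries]; ring
  rw [show varSeries * geomSeries * geomSeries = varSeries * geomSeries ^ 2 by ring, h2,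
    mul_right_comm ((1 - X) ^ 2), h, h3,
    show ∀ a : ℝ⟦X⟧, (1 - X) * a * ((1 - X) * a) * geomSeries =
      (geomSeries * (1 - X)) * ((1 - X) * a ^ 2) by intro a; ring, geomSeries_mul, ← h2,
    derivative_varSeries]
  simp only [map_add, map_sub, derivative_ofNat_mul, derivative_one_sub_pow,
    derivative_pow_mul_log, derivative_pow_mul_log_sq]
  push_cast
  ring

/-- The mean of `Y_n - (n + 1) / 25`. -/
noncomputable def meanDev (n : ℕ) : ℝ := coeff n meanSeries / 25

/-- The difference between the second moment of `Y_n - (n + 1) / 25` and its linear part. -/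
noncomputable def varDev (n : ℕ) : ℝ := coeff n varSeries / 1299375

/-- The second moment of `Y_n - (n + 1) / 25`. -/
noncomputable def secondMoment (n : ℕ) : ℝ := 38477 / 1299375 * (n + 1) + varDev n

lemma tripleSum_sum {A : ℝ⟦X⟧} (n : ℕ) :
    tripleSum n (fun a b c => coeff a A + coeff b A + coeff c A) =
      3 * coeff n (A * geomSeries * geomSeries) := by
  simp only [tripleSum_add]
  rw [show 3 * coeff n (A * geomSeries * geomSeries) = coeff n (A * geomSeries * geomSeries) +
    coeff n (geomSeries * A * geomSeries) + coeff n (geomSeries * geomSeries * A) by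
      rw [mul_comm geomSeries A, mul_comm (geomSeries * geomSeries) A, ← mul_assoc]; ring]
  simp only [coeff_mul_mul, coeff_geomSeries, mul_one, one_mul]

lemma tripleSum_mul {A : ℝ⟦X⟧} (n : ℕ) :
    tripleSum n (fun a b c => coeff a A * coeff b A + coeff a A * coeff c A +
      coeff b A * coeff c A) = 3 * coeff n (A * A * geomSeries) := by
  simp only [tripleSum_add]
  rw [show 3 * coeff n (A * A * geomSeries) = coeff n (A * A * geomSeries) +
    coeff n (A * geomSeries * A) + coeff n (geomSeries * A * A) by
      rw [mul_right_comm A geomSeries A, mul_comm geomSeries A, mul_right_comm A geomSeries A]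
      ring]
  simp only [coeff_mul_mul, coeff_geomSeries, mul_one, one_mul]

lemma tripleSum_one (n : ℕ) :
    2 * tripleSum n (fun _ _ _ => (1 : ℝ)) = (n + 1) * (n + 2) := by
  simp only [tripleSum, Finset.sum_const, Finset.Nat.card_antidiagonal, nsmul_eq_mul, mul_one]
  rw [Finset.Nat.sum_antidiagonal_eq_sum_range_succ_mk]
  induction n with
  | zero => simp
  | succ n ih =>
    rw [Finset.sum_range_succ, mul_add, ih]
    push_cast
    ring

lemma coeff_derivative_derivative (n : ℕ) (f : ℝ⟦X⟧) :
    coeff n (d⁄dX ℝ (d⁄dX ℝ f)) = (n + 1) * (n + 2) * coeff (n + 2) f := by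
  rw [coeff_derivative, coeff_derivative]
  push_cast
  ring

lemma coeff_ofNat_mul (n c : ℕ) [c.AtLeastTwo] (f : ℝ⟦X⟧) :
    coeff n (ofNat(c) * f) = ofNat(c) * coeff n f := by
  rw [← Nat.cast_ofNat (R := ℝ⟦X⟧), ← nsmul_eq_mul, map_nsmul, nsmul_eq_mul]
  simp

lemma meanDev_add_two (n : ℕ) : ((n : ℝ) + 1) * (n + 2) * meanDev (n + 2) =
    2 * tripleSum n (fun a b c => meanDev a + meanDev b + meanDev c) +
      if n = 2 then 12 else 0 := by
  have h := congr_arg (coeff n) derivative_derivative_meanSeries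
  rw [coeff_derivative_derivative, map_add, coeff_ofNat_mul, coeff_ofNat_mul, coeff_X_pow] at h
  have h2 := tripleSum_sum (A := meanSeries) n
  have h3 : tripleSum n (fun a b c => meanDev a + meanDev b + meanDev c) =
      1 / 25 * tripleSum n (fun a b c => coeff a meanSeries + coeff b meanSeries +
        coeff c meanSeries) := by
    rw [← tripleSum_mul_left]; simp only [meanDev]; congr 1; ext; ring
  rw [h3, h2, meanDev]
  split_ifs at * <;> linear_combination h / 25

lemma tripleSum_add_one (n : ℕ) :
    2 * tripleSum n (fun a b c => ((a : ℝ) + 1) + (b + 1) + (c + 1)) =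
      (n + 1) * (n + 2) * (n + 3) := by
  have : tripleSum n (fun a b c => ((a : ℝ) + 1) + (b + 1) + (c + 1)) =
      (n + 3) * tripleSum n (fun _ _ _ => (1 : ℝ)) := by
    rw [← tripleSum_mul_left]
    refine tripleSum_congr fun a b c h => ?_
    rw [← h]; push_cast; ring
  rw [this]
  linear_combination ((n : ℝ) + 3) * tripleSum_one n

lemma secondMoment_add_two (n : ℕ) : ((n : ℝ) + 1) * (n + 2) * secondMoment (n + 2) =
    2 * tripleSum n (fun a b c => secondMoment a + secondMoment b + secondMoment c +
      2 * (meanDev a * meanDev b + meanDev a * meanDev c + meanDev b * meanDev c)) +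
      if n = 2 then 36 / 5 else 0 := by
  have h := congr_arg (coeff n) derivative_derivative_varSeries
  rw [coeff_derivative_derivative, map_add, map_add, coeff_ofNat_mul, coeff_ofNat_mul,
    coeff_ofNat_mul, coeff_X_pow] at h
  have h2 := tripleSum_sum (A := varSeries) n
  have h4 := tripleSum_mul (A := meanSeries) n
  have h5 := tripleSum_add_one n
  have h3 : tripleSum n (fun a b c => secondMoment a + secondMoment b + secondMoment c +
      2 * (meanDev a * meanDev b + meanDev a * meanDev c + meanDev b * meanDev c)) =
      38477 / 1299375 * tripleSum n (fun a b c => ((a : ℝ) + 1) + (b + 1) + (c + 1)) +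
      1 / 1299375 * tripleSum n (fun a b c => coeff a varSeries + coeff b varSeries +
        coeff c varSeries) +
      2 / 625 * tripleSum n (fun a b c => coeff a meanSeries * coeff b meanSeries +
        coeff a meanSeries * coeff c meanSeries + coeff b meanSeries * coeff c meanSeries) := by
    rw [← tripleSum_mul_left, ← tripleSum_mul_left, ← tripleSum_mul_left, ← tripleSum_add,
      ← tripleSum_add]
    simp only [meanDev, secondMoment, varDev]; congr 1; ext; ring
  rw [h3, h2, h4, secondMoment, varDev]
  push_cast
  split_ifs at * <;> linear_combination h / 1299375 - 38477 / 1299375 * h5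

lemma constantCoeff_logSeries : constantCoeff logSeries = 0 := by
  rw [← coeff_zero_eq_constantCoeff_apply, logSeries, coeff_mk]; simp

lemma coeff_one_eq (f : ℝ⟦X⟧) : coeff 1 f = constantCoeff (d⁄dX ℝ f) := by
  rw [← coeff_zero_eq_constantCoeff_apply, coeff_derivative]; simp

lemma meanDev_zero : meanDev 0 = -1 / 25 := by
  rw [meanDev, coeff_zero_eq_constantCoeff_apply, meanSeries]
  simp [constantCoeff_logSeries, map_ofNat]; norm_num

lemma meanDev_one : meanDev 1 = -2 / 25 := by
  rw [meanDev, coeff_one_eq, derivative_meanSeries]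
  simp [constantCoeff_logSeries, map_ofNat]; norm_num

lemma meanDev_two : meanDev 2 = -3 / 25 := by
  have := meanDev_add_two 0
  simp [tripleSum, meanDev_zero] at this
  linarith

lemma secondMoment_zero : secondMoment 0 = 1 / 625 := by
  rw [secondMoment, varDev, coeff_zero_eq_constantCoeff_apply, varSeries]
  simp [constantCoeff_logSeries, map_ofNat]; norm_num

lemma secondMoment_one : secondMoment 1 = 4 / 625 := by
  rw [secondMoment, varDev, coeff_one_eq, derivative_varSeries]
  simp [constantCoeff_logSeries, map_ofNat]; norm_num

lemma tripleSum_two_meanDev :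
    tripleSum 2 (fun a b c => meanDev a + meanDev b + meanDev c) = -6 / 5 := by
  simp [tripleSum, Finset.Nat.antidiagonal_succ, meanDev_zero, meanDev_one, meanDev_two]
  norm_num

/-- Sums of the absolute values of the first `n` coefficients. -/
noncomputable def absSum (n : ℕ) (f : ℝ⟦X⟧) : ℝ := ∑ i ∈ Finset.range n, |coeff i f|

lemma absSum_nonneg (n : ℕ) (f : ℝ⟦X⟧) : 0 ≤ absSum n f :=
  Finset.sum_nonneg fun _ _ => abs_nonneg _

lemma absSum_add_le (n : ℕ) (f g : ℝ⟦X⟧) : absSum n (f + g) ≤ absSum n f + absSum n g := by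
  rw [absSum, absSum, absSum, ← Finset.sum_add_distrib]
  exact Finset.sum_le_sum fun i _ => by rw [map_add]; exact abs_add_le _ _

lemma absSum_neg (n : ℕ) (f : ℝ⟦X⟧) : absSum n (-f) = absSum n f := by
  simp [absSum]

lemma absSum_mul_le (n : ℕ) (f g : ℝ⟦X⟧) : absSum n (f * g) ≤ absSum n f * absSum n g := by
  rw [absSum, absSum, absSum, Finset.sum_mul_sum, ← Finset.sum_product']
  calc ∑ i ∈ Finset.range n, |coeff i (f * g)|
      ≤ ∑ i ∈ Finset.range n, ∑ x ∈ Finset.HasAntidiagonal.antidiagonal i,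
          |coeff x.1 f| * |coeff x.2 g| := by
        refine Finset.sum_le_sum fun i _ => ?_
        rw [coeff_mul]
        refine (Finset.abs_sum_le_sum_abs _ _).trans_eq ?_
        simp only [abs_mul]
    _ = ∑ z ∈ (Finset.range n).sigma fun i => Finset.HasAntidiagonal.antidiagonal i,
          |coeff z.2.1 f| * |coeff z.2.2 g| := by rw [Finset.sum_sigma]
    _ ≤ _ := by
        have hinj : Set.InjOn (fun z : (_ : ℕ) × (ℕ × ℕ) => z.2)
            ((Finset.range n).sigma fun i => Finset.HasAntidiagonal.antidiagonal i) := by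
          rintro ⟨i, x⟩ hx ⟨j, y⟩ hy (rfl : x = y)
          simp at hx hy
          rw [← hx.2, ← hy.2]
        rw [← Finset.sum_image (f := fun x : ℕ × ℕ => |coeff x.1 f| * |coeff x.2 g|) hinj]
        refine Finset.sum_le_sum_of_subset_of_nonneg ?_ fun _ _ _ => by positivity
        rintro x hx
        simp at hx ⊢
        omega

/-- The coefficients of `f` are summable. -/
def SummableCoeff (f : ℝ⟦X⟧) : Prop := ∃ C, ∀ n, absSum n f ≤ C

lemma SummableCoeff.add {f g : ℝ⟦X⟧} (hf : SummableCoeff f) (hg : SummableCoeff g) :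
    SummableCoeff (f + g) := by
  obtain ⟨C, hC⟩ := hf
  obtain ⟨D, hD⟩ := hg
  exact ⟨C + D, fun n => (absSum_add_le n f g).trans (add_le_add (hC n) (hD n))⟩

lemma SummableCoeff.neg {f : ℝ⟦X⟧} (hf : SummableCoeff f) : SummableCoeff (-f) := by
  obtain ⟨C, hC⟩ := hf
  exact ⟨C, fun n => (absSum_neg n f).trans_le (hC n)⟩

lemma SummableCoeff.sub {f g : ℝ⟦X⟧} (hf : SummableCoeff f) (hg : SummableCoeff g) :
    SummableCoeff (f - g) := by
  rw [sub_eq_add_neg]; exact hf.add hg.neg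

lemma SummableCoeff.mul {f g : ℝ⟦X⟧} (hf : SummableCoeff f) (hg : SummableCoeff g) :
    SummableCoeff (f * g) := by
  obtain ⟨C, hC⟩ := hf
  obtain ⟨D, hD⟩ := hg
  exact ⟨C * D, fun n => (absSum_mul_le n f g).trans (mul_le_mul (hC n) (hD n)
    (absSum_nonneg _ _) ((absSum_nonneg 0 f).trans (hC 0)))⟩

lemma summableCoeff_C (a : ℝ) : SummableCoeff (C a) := by
  refine ⟨|a|, fun n => ?_⟩
  have h (i : ℕ) : |coeff i (C a)| = if i = 0 then |a| else 0 := by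
    rw [coeff_C]; split_ifs <;> simp
  simp only [absSum, h, Finset.sum_ite_eq']
  split_ifs <;> simp

lemma summableCoeff_X : SummableCoeff X := by
  refine ⟨1, fun n => ?_⟩
  have h (i : ℕ) : |coeff i (X : ℝ⟦X⟧)| = if i = 1 then 1 else 0 := by
    rw [coeff_X]; split_ifs <;> simp
  simp only [absSum, h, Finset.sum_ite_eq']
  split_ifs <;> simp

lemma summableCoeff_ofNat (c : ℕ) [c.AtLeastTwo] : SummableCoeff (ofNat(c)) := by
  have := summableCoeff_C (ofNat(c) : ℝ)
  rwa [map_ofNat] at this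

lemma summableCoeff_one_sub : SummableCoeff (1 - X) := by
  simpa using (summableCoeff_C 1).sub summableCoeff_X

lemma summableCoeff_one_sub_pow (k : ℕ) : SummableCoeff ((1 - X) ^ k) := by
  induction k with
  | zero => simpa using summableCoeff_C 1
  | succ k ih => rw [pow_succ]; exact ih.mul summableCoeff_one_sub

lemma summableCoeff_one_sub_mul_log : SummableCoeff ((1 - X) * logSeries) := by
  refine ⟨2, fun n => ?_⟩
  have hc (k : ℕ) : |coeff (k + 2) ((1 - X) * logSeries)| = 1 / ((k : ℝ) + 1) - 1 / (k + 2) := by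
    rw [sub_mul, one_mul, map_sub, coeff_succ_X_mul, logSeries, coeff_mk, coeff_mk]
    push_cast
    rw [abs_of_nonneg]
    · ring
    · have : 1 / ((k : ℝ) + 2) ≤ 1 / (k + 1) := by gcongr; norm_num
      linarith
  have h1 : coeff 1 ((1 - X) * logSeries) = -1 := by
    rw [sub_mul, one_mul, map_sub, coeff_succ_X_mul, logSeries, coeff_mk, coeff_mk]; simp
  have key (m : ℕ) : absSum (m + 2) ((1 - X) * logSeries) = 2 - 1 / ((m : ℝ) + 1) := by
    induction m with
    | zero => simp [absSum, Finset.sum_range_succ, h1, constantCoeff_logSeries]; norm_num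
    | succ m ih =>
      rw [absSum, Finset.sum_range_succ, hc, ← absSum, ih]
      push_cast
      ring
  refine le_trans (Finset.sum_le_sum_of_subset_of_nonneg
    (Finset.range_mono (show n ≤ n + 2 by omega)) fun _ _ _ => abs_nonneg _) ?_
  rw [← absSum, key]
  have : (0 : ℝ) ≤ 1 / (n + 1) := by positivity
  linarith

lemma summableCoeff_one_sub_pow_mul_log (k : ℕ) :
    SummableCoeff ((1 - X) ^ (k + 1) * logSeries) := by
  rw [pow_succ, mul_assoc]
  exact (summableCoeff_one_sub_pow k).mul summableCoeff_one_sub_mul_log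

lemma summableCoeff_meanSeries : SummableCoeff meanSeries := by
  unfold meanSeries
  exact ((((summableCoeff_ofNat _).mul (summableCoeff_one_sub_pow _)).sub
    ((summableCoeff_ofNat _).mul (summableCoeff_one_sub_pow _))).add
    ((summableCoeff_ofNat _).mul (summableCoeff_one_sub_pow _))).sub
    ((summableCoeff_ofNat _).mul (summableCoeff_one_sub_pow_mul_log _))

lemma summableCoeff_pow_mul_log_sq (k : ℕ) :
    SummableCoeff ((1 - X) ^ (k + 2) * logSeries ^ 2) := by
  rw [show (1 - X) ^ (k + 2) * logSeries ^ 2 =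
    (1 - X) ^ k * (((1 - X) * logSeries) * ((1 - X) * logSeries)) by ring]
  exact (summableCoeff_one_sub_pow k).mul
    (summableCoeff_one_sub_mul_log.mul summableCoeff_one_sub_mul_log)

lemma summableCoeff_varSeries : SummableCoeff varSeries := by
  have hp (c k : ℕ) [c.AtLeastTwo] : SummableCoeff (ofNat(c) * (1 - X) ^ k) :=
    (summableCoeff_ofNat _).mul (summableCoeff_one_sub_pow _)
  have hl (c k : ℕ) [c.AtLeastTwo] : SummableCoeff (ofNat(c) * ((1 - X) ^ (k + 1) * logSeries)) :=
    (summableCoeff_ofNat _).mul (summableCoeff_one_sub_pow_mul_log _)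
  unfold varSeries
  exact ((((((((((((hp _ 3).sub (hp _ 2)).add (hp _ 4)).add (hp _ 5)).sub (hp _ 6)).sub
    (hp _ 7)).add (hp _ 8)).add (hp _ 9)).sub (hl _ 2)).add (hl _ 5)).sub (hl _ 6)).sub
    (hl _ 7)).add ((summableCoeff_ofNat _).mul (summableCoeff_pow_mul_log_sq 5))

lemma SummableCoeff.exists_bound {f : ℝ⟦X⟧} (hf : SummableCoeff f) {r : ℝ} (hr : 0 < r) :
    ∃ C, 0 < C ∧ ∀ n, ∑ i ∈ Finset.range n, |coeff i f / r| ≤ C := by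
  obtain ⟨C, hC⟩ := hf
  refine ⟨C / r + 1, ?_, fun n => ?_⟩
  · have := (absSum_nonneg 0 f).trans (hC 0)
    positivity
  · simp only [abs_div, abs_of_pos hr, ← Finset.sum_div]
    have := div_le_div_of_nonneg_right (hC n) hr.le
    rw [absSum] at this
    linarith

lemma exists_bound_meanDev : ∃ C, 0 < C ∧ ∀ n, ∑ i ∈ Finset.range n, |meanDev i| ≤ C :=
  summableCoeff_meanSeries.exists_bound (by norm_num)

lemma exists_bound_varDev : ∃ C, 0 < C ∧ ∀ n, ∑ i ∈ Finset.range n, |varDev i| ≤ C :=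
  summableCoeff_varSeries.exists_bound (by norm_num)

end Coefficients

section Fourier

open Complex Filter Topology MeasureTheory ProbabilityTheory

/-- The deviation of `y` from `(n + 1) / 25`. -/
noncomputable def dev (n y : ℕ) : ℝ := y - (n + 1) / 25

lemma dev_add (a b c i j k δ : ℕ) :
    dev (a + b + c + 2) (i + j + k + δ) = dev a i + dev b j + dev c k + δ := by
  simp only [dev]; push_cast; ring

lemma ofReal_tripleSum (n : ℕ) (F : ℕ → ℕ → ℕ → ℝ) :
    ((tripleSum n F : ℝ) : ℂ) = tripleSum n fun a b c => (F a b c : ℂ) := by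
  simp [tripleSum]

lemma mul_succ_ne_zero (n : ℕ) : ((n : ℂ) + 1) * (n + 2) ≠ 0 := by
  refine mul_ne_zero ?_ ?_
  · exact_mod_cast n.succ_ne_zero
  · exact_mod_cast (n + 1).succ_ne_zero

lemma law_mul_const (n : ℕ) (c : ℂ) (F : ℕ → ℂ) : law n (fun y => F y * c) = law n F * c := by
  simp only [mul_comm _ c, law_const_mul]

lemma law_dev_recursion (n : ℕ) (f : ℝ → ℂ) :
    ((n : ℂ) + 1) * (n + 2) * law (n + 2) (fun y => f (dev (n + 2) y)) =
      2 * tripleSum n fun a b c => law a fun i => law b fun j => law c fun k =>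
        f (dev a i + dev b j + dev c k + if n = 2 then 1 else 0) := by
  rw [law_add_two]
  congr 1
  refine tripleSum_congr fun a b c h => ?_
  subst h
  simp only [dev_add]
  push_cast
  rfl

lemma ofReal_tripleSum_one (n : ℕ) :
    2 * tripleSum n (fun _ _ _ => (1 : ℂ)) = (n + 1) * (n + 2) := by
  have := congr_arg ((↑) : ℝ → ℂ) (tripleSum_one n)
  push_cast [ofReal_tripleSum] at this
  exact this

lemma law_dev (n : ℕ) : law n (fun y => (dev n y : ℂ)) = meanDev n := by
  induction n using Nat.strong_induction_on with
  | _ n ih =>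
    match n with
    | 0 => rw [law_of_lt_two (by omega), meanDev_zero, dev]; norm_num
    | 1 => rw [law_of_lt_two (by omega), meanDev_one, dev]; norm_num
    | n + 2 =>
      refine mul_left_cancel₀ (mul_succ_ne_zero n) ?_
      rw [law_dev_recursion n (fun x => (x : ℂ))]
      have h := congr_arg ((↑) : ℝ → ℂ) (meanDev_add_two n)
      push_cast [ofReal_tripleSum] at h
      rw [h, tripleSum_congr (G := fun a b c => ((meanDev a : ℂ) + meanDev b + meanDev c) +
        (if n = 2 then 1 else 0) * 1), tripleSum_add, tripleSum_mul_left, mul_add]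
      · congr 1
        by_cases hn : n = 2
        · subst hn
          have := ofReal_tripleSum_one 2
          norm_num at this ⊢
          linear_combination this
        · simp [hn]
      · intro a b c habc
        push_cast
        simp only [law_add, law_const, ih a (by omega), ih b (by omega), ih c (by omega)]
        split_ifs <;> simp

lemma law_dev_sq (n : ℕ) : law n (fun y => (dev n y : ℂ) ^ 2) = secondMoment n := by
  induction n using Nat.strong_induction_on with
  | _ n ih =>
    match n with
    | 0 => rw [law_of_lt_two (by omega), secondMoment_zero, dev]; norm_num
    | 1 => rw [law_of_lt_two (by omega), secondMoment_one, dev]; norm_num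
    | n + 2 =>
      refine mul_left_cancel₀ (mul_succ_ne_zero n) ?_
      rw [law_dev_recursion n (fun x => (x : ℂ) ^ 2)]
      have h := congr_arg ((↑) : ℝ → ℂ) (secondMoment_add_two n)
      push_cast [ofReal_tripleSum] at h
      rw [h, tripleSum_congr (G := fun a b c => ((secondMoment a : ℂ) + secondMoment b +
        secondMoment c + 2 * ((meanDev a : ℂ) * meanDev b + meanDev a * meanDev c +
          meanDev b * meanDev c)) +
        ((if n = 2 then 2 else 0) * ((meanDev a : ℂ) + meanDev b + meanDev c) +
        (if n = 2 then 1 else 0) * 1))]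
      · simp only [tripleSum_add, tripleSum_mul_left]
        by_cases hn : n = 2
        · subst hn
          have := ofReal_tripleSum_one 2
          have h2 := congr_arg ((↑) : ℝ → ℂ) tripleSum_two_meanDev
          push_cast [ofReal_tripleSum, tripleSum_add] at h2
          norm_num at this h2 ⊢
          linear_combination this + 4 * h2
        · simp [hn]
      · intro a b c habc
        have hsq (x y z d : ℂ) : (x + y + z + d) ^ 2 = x ^ 2 + y ^ 2 + z ^ 2 +
            (2 * x * y + 2 * x * z + 2 * y * z) + (2 * d * x + 2 * d * y + 2 * d * z) + d ^ 2 := by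
          ring
        push_cast
        simp only [hsq, law_add, law_const, law_const_mul, ih a (by omega), ih b (by omega),
          ih c (by omega), law_dev, law_mul_const, mul_assoc]
        split_ifs <;> push_cast <;> ring

lemma norm_exp_sub_one_sub_le (x : ℝ) : ‖exp (I * x) - 1 - I * x‖ ≤ 3 * x ^ 2 := by
  have hn : ‖I * (x : ℂ)‖ = |x| := by simp
  rcases le_or_gt |x| 1 with h | h
  · refine (norm_exp_sub_one_sub_id_le (hn.trans_le h)).trans ?_
    rw [hn, sq_abs]
    nlinarith [sq_nonneg x]
  · have h1 : ‖exp (I * x) - 1 - I * x‖ ≤ 1 + 1 + |x| := by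
      refine (norm_sub_le _ _).trans (add_le_add ((norm_sub_le _ _).trans ?_) hn.le)
      rw [norm_exp_I_mul_ofReal, norm_one]
    nlinarith [sq_abs x]

lemma norm_exp_sub_one_sub_add_le (x : ℝ) :
    ‖exp (I * x) - 1 - I * x + x ^ 2 / 2‖ ≤ 4 * |x| ^ 3 := by
  have hn : ‖I * (x : ℂ)‖ = |x| := by simp
  rcases le_or_gt |x| 1 with h | h
  · have := exp_bound (hn.trans_le h) (n := 3) (by norm_num)
    rw [hn] at this
    simp only [Finset.sum_range_succ, Finset.sum_range_zero] at this
    have h3 : exp (I * x) - 1 - I * x + x ^ 2 / 2 = exp (I * x) - (0 + (I * x) ^ 0 / (0).factorial +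
        (I * x) ^ 1 / (1).factorial + (I * x) ^ 2 / (2).factorial) := by
      simp [mul_pow, Nat.factorial]; ring
    rw [h3]
    refine this.trans ?_
    have : 0 ≤ |x| ^ 3 := by positivity
    norm_num [Nat.factorial]
    linarith
  · have h1 : ‖exp (I * x) - 1 - I * x + x ^ 2 / 2‖ ≤ 1 + 1 + |x| + |x| ^ 2 / 2 := by
      refine (norm_add_le _ _).trans (add_le_add ((norm_sub_le _ _).trans
        (add_le_add ((norm_sub_le _ _).trans ?_) hn.le)) ?_)
      · rw [norm_exp_I_mul_ofReal, norm_one]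
      · simp
    nlinarith [mul_pos (sub_pos.mpr h) (sub_pos.mpr h), sq_nonneg |x|]

/-- The characteristic function of `Y_n - (n + 1) / 25`. -/
noncomputable def psi (n : ℕ) (t : ℝ) : ℂ := law n fun y => exp (I * (t * dev n y : ℝ))

/-- The characteristic function of the Gaussian approximation of `Y_n - (n + 1) / 25`. -/
noncomputable def gauss (n : ℕ) (t : ℝ) : ℝ := Real.exp (-(38477 / 1299375 * (n + 1) * t ^ 2 / 2))

lemma norm_psi_le (n : ℕ) (t : ℝ) : ‖psi n t‖ ≤ 1 := by
  refine (norm_law_le (G := fun _ => 1) fun y => (norm_exp_I_mul_ofReal _).le).trans ?_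
  simp [law_const]

lemma psi_add_two {n : ℕ} (hn : n ≠ 2) (t : ℝ) :
    ((n : ℂ) + 1) * (n + 2) * psi (n + 2) t =
      2 * tripleSum n fun a b c => psi a t * psi b t * psi c t := by
  rw [psi, law_dev_recursion n (fun x => exp (I * (t * x : ℝ)))]
  congr 1
  refine tripleSum_congr fun a b c h => ?_
  have hexp (x y z : ℝ) : exp (I * (t * (x + y + z) : ℝ)) =
      exp (I * (t * x : ℝ)) * exp (I * (t * y : ℝ)) * exp (I * (t * z : ℝ)) := by
    rw [← exp_add, ← exp_add]; push_cast; ring_nf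
  simp only [hn, if_false, add_zero, hexp, law_const_mul, law_mul_const, psi]

lemma gauss_add_two (a b c : ℕ) (t : ℝ) :
    gauss (a + b + c + 2) t = gauss a t * gauss b t * gauss c t := by
  simp only [gauss, ← Real.exp_add]
  push_cast
  ring_nf

lemma gauss_nonneg (n : ℕ) (t : ℝ) : 0 ≤ gauss n t := (Real.exp_pos _).le

lemma gauss_le_one (n : ℕ) (t : ℝ) : gauss n t ≤ 1 := by
  rw [gauss, Real.exp_le_one_iff, neg_nonpos]; positivity

lemma abs_gauss_sub_one_le (n : ℕ) (t : ℝ) : |gauss n t - 1| ≤ (n + 1) * t ^ 2 := by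
  have h := Real.add_one_le_exp (-(38477 / 1299375 * ((n : ℝ) + 1) * t ^ 2 / 2))
  rw [abs_of_nonpos (by linarith [gauss_le_one n t]), gauss]
  have : 0 ≤ ((n : ℝ) + 1) * t ^ 2 := by positivity
  linarith

lemma abs_gauss_sub_one_add_le (n : ℕ) (t : ℝ) :
    |gauss n t - 1 + 38477 / 1299375 * (n + 1) * t ^ 2 / 2| ≤ (n + 1) ^ 2 * t ^ 4 := by
  rw [gauss]
  set u : ℝ := 38477 / 1299375 * (n + 1) * t ^ 2 / 2 with hu
  have hu0 : 0 ≤ u := by positivity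
  have h1 : u ≤ (n + 1) * t ^ 2 := by
    have : 0 ≤ ((n : ℝ) + 1) * t ^ 2 := by positivity
    linarith
  have h2 : |Real.exp (-u) - 1 + u| ≤ u ^ 2 := by
    rcases le_or_gt u 1 with h | h
    · simpa [sub_neg_eq_add] using
        Real.abs_exp_sub_one_sub_id_le (x := -u) (by rwa [abs_neg, abs_of_nonneg hu0])
    · have := Real.add_one_le_exp (-u)
      have h3 : Real.exp (-u) ≤ 1 := by rw [Real.exp_le_one_iff]; linarith
      rw [abs_of_nonneg (by linarith)]
      nlinarith
  calc _ ≤ u ^ 2 := h2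
    _ ≤ ((n + 1) * t ^ 2) ^ 2 := by gcongr
    _ = _ := by ring

lemma law_ofReal_dev_sq (n : ℕ) (p q : ℝ) :
    (law n fun y => ((p + q * dev n y ^ 2 : ℝ) : ℂ)).re = p + q * secondMoment n := by
  push_cast
  rw [law_add, law_const, law_const_mul, law_dev_sq]
  norm_cast

lemma norm_psi_sub_one_le (n : ℕ) (t : ℝ) {r : ℝ} (hr : 0 < r) :
    ‖psi n t - 1‖ ≤ |t| * (r + secondMoment n / r) := by
  have h (y : ℕ) : ‖exp (I * (t * dev n y : ℝ)) - 1‖ ≤ |t| * r + |t| / r * dev n y ^ 2 := by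
    refine Real.norm_exp_I_mul_ofReal_sub_one_le.trans ?_
    rw [Real.norm_eq_abs, abs_mul]
    have : |dev n y| ≤ r + dev n y ^ 2 / r := by
      rw [← sub_nonneg]
      have : r + dev n y ^ 2 / r - |dev n y| = (r ^ 2 + dev n y ^ 2 - r * |dev n y|) / r := by
        field_simp
      rw [this]
      refine div_nonneg ?_ hr.le
      rw [← sq_abs (dev n y)]
      nlinarith [sq_nonneg (r - |dev n y|), abs_nonneg (dev n y)]
    calc |t| * |dev n y| ≤ |t| * (r + dev n y ^ 2 / r) := by gcongr
      _ = _ := by ring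
  have := norm_law_le (n := n) h
  rw [law_sub, law_const, law_ofReal_dev_sq] at this
  refine this.trans_eq ?_
  ring

lemma norm_psi_sub_one_sub_le (n : ℕ) (t : ℝ) :
    ‖psi n t - 1 - I * t * meanDev n‖ ≤ 3 * t ^ 2 * secondMoment n := by
  have h (y : ℕ) : ‖exp (I * (t * dev n y : ℝ)) - 1 - I * t * dev n y‖ ≤
      0 + 3 * t ^ 2 * dev n y ^ 2 := by
    have := norm_exp_sub_one_sub_le (t * dev n y)
    push_cast at *
    rw [← mul_assoc] at *
    refine this.trans_eq ?_
    ring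
  have := norm_law_le (n := n) h
  rw [law_sub, law_sub, law_const, law_const_mul, law_ofReal_dev_sq, law_dev, zero_add] at this
  exact this

lemma exists_norm_psi_sub_le (n : ℕ) : ∃ C, ∀ t : ℝ,
    ‖psi n t - 1 - I * t * meanDev n + t ^ 2 / 2 * secondMoment n‖ ≤ C * |t| ^ 3 := by
  refine ⟨4 * (law n fun y => ((|dev n y| ^ 3 : ℝ) : ℂ)).re, fun t => ?_⟩
  have h (y : ℕ) : ‖exp (I * (t * dev n y : ℝ)) - 1 - I * t * dev n y +
      t ^ 2 / 2 * (dev n y : ℂ) ^ 2‖ ≤ 4 * |t| ^ 3 * |dev n y| ^ 3 := by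
    have := norm_exp_sub_one_sub_add_le (t * dev n y)
    rw [abs_mul] at this
    convert this using 1
    · push_cast; ring_nf
    · ring
  have := norm_law_le (n := n) h
  rw [law_add, law_sub, law_sub, law_const, law_const_mul, law_const_mul, law_dev,
    law_dev_sq] at this
  refine this.trans_eq ?_
  simp only [ofReal_mul (4 * |t| ^ 3)]
  rw [law_const_mul, re_ofReal_mul]
  ring

lemma norm_mul_sub_mul_le {x y z p q r : ℂ} {t e f g u v w M N : ℝ}
    (hy : ‖y‖ ≤ 1) (hz : ‖z‖ ≤ 1) (hp : ‖p‖ ≤ 1) (hq : ‖q‖ ≤ 1)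
    (h1 : ‖y * z - 1 - I * t * (f + g)‖ ≤ M) (h2 : ‖p * z - 1 - I * t * g‖ ≤ M)
    (h3 : ‖p * q - 1‖ ≤ M) (h4 : ‖y * z - 1‖ ≤ N) (h5 : ‖p * z - 1‖ ≤ N) (h6 : ‖p * q - 1‖ ≤ N) :
    ‖x * y * z - p * q * r - I * t * (e + f + g) +
      t ^ 2 / 2 * (u + v + w + 2 * (e * f + e * g + f * g))‖ ≤
    ‖x - p - I * t * e + t ^ 2 / 2 * u‖ + ‖y - q - I * t * f + t ^ 2 / 2 * v‖ +
      ‖z - r - I * t * g + t ^ 2 / 2 * w‖ + |t| * M * (|e| + |f| + |g|) +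
      t ^ 2 * N * (|u| + |v| + |w|) := by
  have key : x * y * z - p * q * r - I * t * (e + f + g) +
      t ^ 2 / 2 * (u + v + w + 2 * (e * f + e * g + f * g)) =
      (x - p - I * t * e + t ^ 2 / 2 * u) * (y * z) +
      (y - q - I * t * f + t ^ 2 / 2 * v) * (p * z) +
      (z - r - I * t * g + t ^ 2 / 2 * w) * (p * q) +
      (I * t * e * (y * z - 1 - I * t * (f + g)) + I * t * f * (p * z - 1 - I * t * g) +
        I * t * g * (p * q - 1)) -
      (t ^ 2 / 2 * u * (y * z - 1) + t ^ 2 / 2 * v * (p * z - 1) +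
        t ^ 2 / 2 * w * (p * q - 1)) := by
    linear_combination (t : ℂ) ^ 2 * (e * f + e * g + f * g) * I_sq
  have one (A B C : ℂ) (hB : ‖B‖ ≤ 1) (hC : ‖C‖ ≤ 1) : ‖A * (B * C)‖ ≤ ‖A‖ := by
    rw [norm_mul, norm_mul]
    exact mul_le_of_le_one_right (norm_nonneg _) (mul_le_one₀ hB (norm_nonneg _) hC)
  have two (s : ℝ) (A : ℂ) (hA : ‖A‖ ≤ M) : ‖I * t * s * A‖ ≤ |t| * M * |s| := by
    rw [norm_mul, norm_mul, norm_mul, norm_I, one_mul, norm_real, norm_real, mul_right_comm]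
    exact mul_le_mul_of_nonneg_right (mul_le_mul_of_nonneg_left hA (abs_nonneg _)) (abs_nonneg _)
  have three (s : ℝ) (A : ℂ) (hA : ‖A‖ ≤ N) : ‖t ^ 2 / 2 * s * A‖ ≤ t ^ 2 * N * |s| := by
    have hN : 0 ≤ N := (norm_nonneg _).trans hA
    have : ‖(t ^ 2 / 2 * s * A : ℂ)‖ = t ^ 2 / 2 * |s| * ‖A‖ := by simp
    rw [this]
    calc t ^ 2 / 2 * |s| * ‖A‖ ≤ t ^ 2 * |s| * N := by gcongr; linarith [sq_nonneg t]
      _ = _ := by ring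
  rw [key]
  refine (norm_sub_le _ _).trans ?_
  refine (add_le_add ((norm_add_le _ _).trans (add_le_add (norm_add₃_le.trans (add_le_add
    (add_le_add (one _ _ _ hy hz) (one _ _ _ hp hz)) (one _ _ _ hp hq))) (norm_add₃_le.trans
      (add_le_add (add_le_add (two e _ h1) (two f _ h2)) (two g _ h3))))) (norm_add₃_le.trans
      (add_le_add (add_le_add (three u _ h4) (three v _ h5)) (three w _ h6)))).trans_eq ?_
  ring

lemma abs_le_of_sum_abs_le {f : ℕ → ℝ} {K : ℝ}
    (h : ∀ n, ∑ i ∈ Finset.range n, |f i| ≤ K) (n : ℕ) : |f n| ≤ K :=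
  (Finset.single_le_sum (f := fun i => |f i|) (fun _ _ => abs_nonneg _)
    (Finset.self_mem_range_succ n)).trans (h (n + 1))

lemma exists_bounds : ∃ K : ℝ, 1 ≤ K ∧ (∀ n, ∑ i ∈ Finset.range n, |meanDev i| ≤ K) ∧
    (∀ n, ∑ i ∈ Finset.range n, |varDev i| ≤ K) ∧ (∀ n, secondMoment n ≤ K * (n + 1)) := by
  obtain ⟨C, hC0, hC⟩ := exists_bound_meanDev
  obtain ⟨D, hD0, hD⟩ := exists_bound_varDev
  refine ⟨1 + C + D, by linarith, fun n => (hC n).trans (by linarith),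
    fun n => (hD n).trans (by linarith), fun n => ?_⟩
  have h : |varDev n| ≤ D := abs_le_of_sum_abs_le hD n
  have h2 := le_abs_self (varDev n)
  have h3 : (0 : ℝ) ≤ n := n.cast_nonneg
  rw [secondMoment]
  nlinarith

/-- The error of the Gaussian approximation, up to second order corrections. -/
noncomputable def remainder (n : ℕ) (t : ℝ) : ℂ :=
  psi n t - gauss n t - I * t * meanDev n + t ^ 2 / 2 * varDev n

lemma norm_psi_sub_one_le_sqrt {K : ℝ} (hK : ∀ n, secondMoment n ≤ K * (n + 1)) {a L : ℕ}
    (ha : a + 1 ≤ L) (t : ℝ) : ‖psi a t - 1‖ ≤ |t| * ((1 + K) * √L) := by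
  have hL : (0 : ℝ) < L := by exact_mod_cast (show 0 < L by omega)
  have ha' : (a : ℝ) + 1 ≤ L := by exact_mod_cast ha
  refine (norm_psi_sub_one_le a t (Real.sqrt_pos.mpr hL)).trans ?_
  have hK0 : 0 ≤ K := by
    have := hK 0
    rw [secondMoment_zero] at this
    norm_num at this; linarith
  have : secondMoment a / √L ≤ K * √L := by
    rw [div_le_iff₀ (Real.sqrt_pos.mpr hL), mul_assoc, Real.mul_self_sqrt hL.le]
    exact (hK a).trans (by gcongr)
  gcongr
  linarith

lemma norm_psi_triple_le {K : ℝ} (hK1 : 1 ≤ K) (hK : ∀ n, secondMoment n ≤ K * (n + 1))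
    {a b c n : ℕ} (h : a + b + c = n) {t : ℝ} (ht : |t| ≤ 1) :
    ‖psi a t * psi b t * psi c t - gauss (n + 2) t - I * t * (meanDev a + meanDev b + meanDev c) +
      t ^ 2 / 2 * (varDev a + varDev b + varDev c +
        2 * (meanDev a * meanDev b + meanDev a * meanDev c + meanDev b * meanDev c))‖ ≤
    ‖remainder a t‖ + ‖remainder b t‖ + ‖remainder c t‖ +
      20 * K ^ 2 * |t| ^ 3 * (n + 1) * ((|meanDev a| + |meanDev b| + |meanDev c|) +
        (|varDev a| + |varDev b| + |varDev c|)) := by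
  subst h
  set L := a + b + c + 1 with hL
  have hL1 : (1 : ℝ) ≤ L := by exact_mod_cast (show 1 ≤ L by omega)
  have hsq : √(L : ℝ) ^ 2 = L := Real.sq_sqrt (by linarith)
  have hsL : √(L : ℝ) ≤ L := by
    rw [Real.sqrt_le_left (by linarith)]; nlinarith
  have ht2 : t ^ 2 ≤ |t| := by rw [← sq_abs]; nlinarith [abs_nonneg t]
  have hL0 : (0 : ℝ) ≤ L := by linarith
  have hps (i : ℕ) (hi : i + 1 ≤ L) : ‖psi i t - 1‖ ≤ 2 * K * |t| * √L :=
    (norm_psi_sub_one_le_sqrt hK hi t).trans (by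
      have : 0 ≤ |t| * √L := by positivity
      nlinarith)
  have hp2 (i : ℕ) (hi : i + 1 ≤ L) : ‖psi i t - 1 - I * t * meanDev i‖ ≤ 3 * K * t ^ 2 * L := by
    refine (norm_psi_sub_one_sub_le i t).trans ?_
    have h2 : (i : ℝ) + 1 ≤ L := by exact_mod_cast hi
    have h3 : secondMoment i ≤ K * L := (hK i).trans (by gcongr)
    calc 3 * t ^ 2 * secondMoment i ≤ 3 * t ^ 2 * (K * L) := by gcongr
      _ = _ := by ring
  have hg (i : ℕ) (hi : i + 1 ≤ L) : ‖(gauss i t : ℂ) - 1‖ ≤ t ^ 2 * L := by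
    have h2 : (i : ℝ) + 1 ≤ L := by exact_mod_cast hi
    have := abs_gauss_sub_one_le i t
    rw [← ofReal_one, ← ofReal_sub, norm_real, Real.norm_eq_abs]
    refine this.trans ?_
    rw [mul_comm]
    gcongr
  have hg1 (i : ℕ) : ‖(gauss i t : ℂ)‖ ≤ 1 := by
    rw [norm_real, Real.norm_eq_abs, abs_of_nonneg (gauss_nonneg i t)]
    exact gauss_le_one i t
  have hx : 0 ≤ t ^ 2 * L := by positivity
  have ha := a.cast_nonneg (α := ℝ)
  have mulsub (x y : ℂ) : x * y - 1 = (x - 1) * y + (y - 1) := by ring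
  have mulone (x y : ℂ) (hy : ‖y‖ ≤ 1) : ‖x * y - 1‖ ≤ ‖x - 1‖ + ‖y - 1‖ := by
    rw [mulsub]
    refine (norm_add_le _ _).trans (add_le_add_left ?_ _)
    rw [norm_mul]
    exact mul_le_of_le_one_right (norm_nonneg _) hy
  have hKsq : K ≤ K ^ 2 := by nlinarith
  have hgg : ‖(gauss a t : ℂ) * gauss b t - 1‖ ≤ 2 * (t ^ 2 * L) := by
    have := mulone (gauss a t) (gauss b t) (hg1 b)
    linarith [hg a (by omega), hg b (by omega)]
  have htL : t ^ 2 * L ≤ |t| * L := by gcongr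
  have hKx : t ^ 2 * L ≤ K ^ 2 * (t ^ 2 * L) := le_mul_of_one_le_left hx (by nlinarith)
  have hKx' : K * (t ^ 2 * L) ≤ K ^ 2 * (t ^ 2 * L) := by gcongr
  have hKy : |t| * L ≤ K ^ 2 * (|t| * L) := le_mul_of_one_le_left (by positivity) (by nlinarith)
  have hKz : K * |t| * √L ≤ K ^ 2 * (|t| * L) := by rw [← mul_assoc]; gcongr
  have main := norm_mul_sub_mul_le (x := psi a t) (y := psi b t) (z := psi c t) (p := gauss a t)
    (q := gauss b t) (r := gauss c t) (t := t) (e := meanDev a) (f := meanDev b) (g := meanDev c)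
    (u := varDev a) (v := varDev b) (w := varDev c) (M := 20 * K ^ 2 * (t ^ 2 * L))
    (N := 20 * K ^ 2 * (|t| * L))
    (norm_psi_le b t) (norm_psi_le c t) (hg1 a) (hg1 b) ?_ ?_ ?_ ?_ ?_ ?_
  · rw [gauss_add_two]
    push_cast
    refine main.trans_eq ?_
    rw [remainder, remainder, remainder]
    have h3 : t ^ 2 * |t| = |t| ^ 3 := by rw [← sq_abs]; ring
    have hL' : (a : ℝ) + b + c + 1 = L := by rw [hL]; push_cast; ring
    rw [hL', ← h3]
    ring
  · have e : psi b t * psi c t - 1 - I * t * (meanDev b + meanDev c) = (psi b t - 1) *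
        (psi c t - 1) + (psi b t - 1 - I * t * meanDev b) + (psi c t - 1 - I * t * meanDev c) := by
      ring
    rw [e]
    refine norm_add₃_le.trans ?_
    have : ‖(psi b t - 1) * (psi c t - 1)‖ ≤ 4 * (K ^ 2 * (t ^ 2 * L)) := by
      rw [norm_mul]
      calc _ ≤ (2 * K * |t| * √L) * (2 * K * |t| * √L) := by
            gcongr
            · exact hps b (by omega)
            · exact hps c (by omega)
        _ = 4 * (K ^ 2 * (|t| ^ 2 * √L ^ 2)) := by ring
        _ = _ := by rw [hsq, sq_abs]
    linarith [hp2 b (by omega), hp2 c (by omega)]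
  · have e : (gauss a t : ℂ) * psi c t - 1 - I * t * meanDev c = (gauss a t - 1) * psi c t +
        (psi c t - 1 - I * t * meanDev c) := by ring
    rw [e]
    refine (norm_add_le _ _).trans ?_
    have : ‖((gauss a t : ℂ) - 1) * psi c t‖ ≤ t ^ 2 * L := by
      rw [norm_mul]
      exact (mul_le_of_le_one_right (norm_nonneg _) (norm_psi_le c t)).trans (hg a (by omega))
    linarith [hp2 c (by omega)]
  · linarith
  · have := mulone (psi b t) (psi c t) (norm_psi_le c t)
    linarith [hps b (by omega), hps c (by omega)]
  · have := mulone (gauss a t) (psi c t) (norm_psi_le c t)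
    linarith [hg a (by omega), hps c (by omega)]
  · linarith

lemma norm_tripleSum_le {E : Type*} [SeminormedAddCommGroup E] {n : ℕ} {F : ℕ → ℕ → ℕ → E}
    {G : ℕ → ℕ → ℕ → ℝ} (h : ∀ a b c, a + b + c = n → ‖F a b c‖ ≤ G a b c) :
    ‖tripleSum n F‖ ≤ tripleSum n G := by
  refine norm_sum_le_of_le _ fun x hx => norm_sum_le_of_le _ fun y hy => h _ _ _ ?_
  rw [Finset.HasAntidiagonal.mem_antidiagonal.mp hy,
    Finset.HasAntidiagonal.mem_antidiagonal.mp hx]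

lemma tripleSum_le_of_sum_le {f : ℕ → ℝ} (hf : ∀ i, 0 ≤ f i) {K : ℝ}
    (hK : ∀ n, ∑ i ∈ Finset.range n, f i ≤ K) (n : ℕ) :
    tripleSum n (fun a b c => f a + f b + f c) ≤ 3 * ((n + 1) * K) := by
  have hl (m : ℕ) : ∑ y ∈ Finset.HasAntidiagonal.antidiagonal m, f y.1 ≤ K := by
    rw [Finset.Nat.sum_antidiagonal_eq_sum_range_succ fun i _ => f i]
    exact hK _
  have hr (m : ℕ) : ∑ y ∈ Finset.HasAntidiagonal.antidiagonal m, f y.2 ≤ K := by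
    rw [← Finset.Nat.sum_antidiagonal_swap]
    exact hl m
  have hc : ∑ _x ∈ Finset.HasAntidiagonal.antidiagonal n, K = (n + 1) * K := by
    simp
  have h3 : ∑ x ∈ Finset.HasAntidiagonal.antidiagonal n, ((x.1 : ℝ) + 1) * f x.2 ≤
      (n + 1) * K := by
    calc _ ≤ ∑ x ∈ Finset.HasAntidiagonal.antidiagonal n, ((n : ℝ) + 1) * f x.2 := by
          refine Finset.sum_le_sum fun x hx => ?_
          have : (x.1 : ℝ) ≤ n := by
            have := Finset.HasAntidiagonal.mem_antidiagonal.mp hx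
            exact_mod_cast (show x.1 ≤ n by omega)
          gcongr
          exact hf _
      _ ≤ _ := by
          rw [← Finset.mul_sum]
          gcongr
          exact hr n
  rw [tripleSum_add, tripleSum_add]
  have h1 : tripleSum n (fun a _ _ => f a) ≤ (n + 1) * K := by
    rw [← hc]; exact Finset.sum_le_sum fun x _ => hl _
  have h2 : tripleSum n (fun _ b _ => f b) ≤ (n + 1) * K := by
    rw [← hc]; exact Finset.sum_le_sum fun x _ => hr _
  have h4 : tripleSum n (fun _ _ c => f c) ≤ (n + 1) * K := by
    refine le_trans (le_of_eq ?_) h3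
    simp [tripleSum]
  linarith

lemma varDev_add_two {n : ℕ} (hn : n ≠ 2) : ((n : ℝ) + 1) * (n + 2) * varDev (n + 2) =
    2 * tripleSum n (fun a b c => varDev a + varDev b + varDev c +
      2 * (meanDev a * meanDev b + meanDev a * meanDev c + meanDev b * meanDev c)) := by
  have h := secondMoment_add_two n
  have h2 := tripleSum_add_one n
  have h3 : tripleSum n (fun a b c => secondMoment a + secondMoment b + secondMoment c +
      2 * (meanDev a * meanDev b + meanDev a * meanDev c + meanDev b * meanDev c)) =
      38477 / 1299375 * tripleSum n (fun a b c => ((a : ℝ) + 1) + (b + 1) + (c + 1)) +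
      tripleSum n (fun a b c => varDev a + varDev b + varDev c +
        2 * (meanDev a * meanDev b + meanDev a * meanDev c + meanDev b * meanDev c)) := by
    rw [← tripleSum_mul_left, ← tripleSum_add]
    simp only [secondMoment]
    congr 1; ext; ring
  rw [h3, if_neg hn, secondMoment] at h
  push_cast at h
  linear_combination h + 38477 / 1299375 * h2

lemma remainder_add_two {n : ℕ} (hn : n ≠ 2) (t : ℝ) :
    ((n : ℂ) + 1) * (n + 2) * remainder (n + 2) t = 2 * tripleSum n fun a b c =>
      psi a t * psi b t * psi c t - gauss (n + 2) t -
      I * t * (meanDev a + meanDev b + meanDev c) +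
      t ^ 2 / 2 * (varDev a + varDev b + varDev c +
        2 * (meanDev a * meanDev b + meanDev a * meanDev c + meanDev b * meanDev c)) := by
  have h1 := congr_arg ((↑) : ℝ → ℂ) (meanDev_add_two n)
  have h2 := congr_arg ((↑) : ℝ → ℂ) (varDev_add_two hn)
  rw [if_neg hn] at h1
  push_cast [ofReal_tripleSum] at h1 h2
  have h3 := psi_add_two hn t
  have h4 := ofReal_tripleSum_one n
  have e (a b c : ℕ) : psi a t * psi b t * psi c t - gauss (n + 2) t -
      I * t * (meanDev a + meanDev b + meanDev c) +
      t ^ 2 / 2 * (varDev a + varDev b + varDev c +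
        2 * (meanDev a * meanDev b + meanDev a * meanDev c + meanDev b * meanDev c)) =
      psi a t * psi b t * psi c t + (-gauss (n + 2) t) * 1 +
      (-I * t) * (meanDev a + meanDev b + meanDev c) +
      t ^ 2 / 2 * (varDev a + varDev b + varDev c +
        2 * (meanDev a * meanDev b + meanDev a * meanDev c + meanDev b * meanDev c)) := by
    ring
  simp only [e]
  rw [tripleSum_add, tripleSum_add, tripleSum_add, tripleSum_mul_left, tripleSum_mul_left,
    tripleSum_mul_left, remainder]
  linear_combination h3 + gauss (n + 2) t * h4 - I * t * h1 + t ^ 2 / 2 * h2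

lemma exists_norm_remainder_le_base (n : ℕ) : ∃ C, 0 ≤ C ∧ ∀ t : ℝ, |t| ≤ 1 →
    ‖remainder n t‖ ≤ C * |t| ^ 3 := by
  obtain ⟨C, hC⟩ := exists_norm_psi_sub_le n
  refine ⟨|C| + (n + 1) ^ 2, by positivity, fun t ht => ?_⟩
  have e : remainder n t = (psi n t - 1 - I * t * meanDev n + t ^ 2 / 2 * secondMoment n) -
      ((gauss n t - 1 + 38477 / 1299375 * (n + 1) * t ^ 2 / 2 : ℝ) : ℂ) := by
    rw [remainder, secondMoment]; push_cast; ring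
  have h1 := abs_gauss_sub_one_add_le n t
  have h2 : t ^ 4 ≤ |t| ^ 3 := by
    rw [← Even.pow_abs (by decide : Even 4) t]
    exact pow_le_pow_of_le_one (abs_nonneg t) ht (by norm_num)
  rw [e]
  refine (norm_sub_le _ _).trans ?_
  rw [norm_real, Real.norm_eq_abs, add_mul]
  refine add_le_add ((hC t).trans ?_) (h1.trans ?_)
  · gcongr; exact le_abs_self C
  · gcongr

lemma exists_norm_remainder_le : ∃ A, 0 ≤ A ∧ ∀ n t, |t| ≤ 1 →
    ‖remainder n t‖ ≤ A * (n + 1) * |t| ^ 3 := by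
  obtain ⟨K, hK1, hKe, hKw, hKv⟩ := exists_bounds
  choose C hC0 hC using exists_norm_remainder_le_base
  set C₀ := ∑ i ∈ Finset.range 5, C i with hC₀
  have hC₀0 : 0 ≤ C₀ := Finset.sum_nonneg fun i _ => hC0 i
  set B : ℝ := 120 * K ^ 3 with hB
  have hB0 : 0 ≤ B := by positivity
  refine ⟨B + C₀, by positivity, fun n t ht => ?_⟩
  suffices h : ∀ n, ‖remainder n t‖ ≤ ((B + C₀) * (n + 1) - B) * |t| ^ 3 by
    refine (h n).trans ?_
    gcongr
    linarith
  intro n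
  induction n using Nat.strong_induction_on with
  | _ n ih =>
    rcases lt_or_ge n 5 with hn | hn
    · refine (hC n t ht).trans ?_
      have : C n ≤ C₀ := Finset.single_le_sum (fun i _ => hC0 i) (Finset.mem_range.mpr hn)
      have hn0 := n.cast_nonneg (α := ℝ)
      gcongr
      nlinarith
    · obtain ⟨n, rfl⟩ : ∃ k, n = k + 2 := ⟨n - 2, by omega⟩
      have hn2 : n ≠ 2 := by omega
      have hpos : (0 : ℝ) < ((n : ℝ) + 1) * (n + 2) := by positivity
      refine le_of_mul_le_mul_left ?_ hpos
      have hrec := congr_arg norm (remainder_add_two hn2 t)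
      have hnorm : ‖((n : ℂ) + 1) * (n + 2)‖ = ((n : ℝ) + 1) * (n + 2) := by
        exact_mod_cast norm_natCast ((n + 1) * (n + 2))
      rw [norm_mul, hnorm, norm_mul] at hrec
      rw [hrec]
      set T : ℝ := |t| ^ 3 with hT
      have hT0 : 0 ≤ T := by positivity
      have hb := norm_tripleSum_le fun a b c (h : a + b + c = n) =>
        (norm_psi_triple_le hK1 hKv h ht).trans (add_le_add_left (add_le_add (add_le_add
          (ih a (by omega)) (ih b (by omega))) (ih c (by omega))) _)
      have he := tripleSum_le_of_sum_le (fun i => abs_nonneg (meanDev i)) hKe n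
      have hw := tripleSum_le_of_sum_le (fun i => abs_nonneg (varDev i)) hKw n
      have h1 : tripleSum n (fun a b c => ((B + C₀) * ((a : ℝ) + 1) - B) * T +
          ((B + C₀) * ((b : ℝ) + 1) - B) * T + ((B + C₀) * ((c : ℝ) + 1) - B) * T) =
          ((B + C₀) * (n + 3) - 3 * B) * T * tripleSum n (fun _ _ _ => (1 : ℝ)) := by
        rw [← tripleSum_mul_left]
        refine tripleSum_congr fun a b c h => ?_
        rw [← h]; push_cast; ring
      refine (mul_le_mul_of_nonneg_left hb (norm_nonneg _)).trans ?_
      rw [tripleSum_add, h1, tripleSum_mul_left, tripleSum_add]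
      have h2 := tripleSum_one n
      have hn0 := n.cast_nonneg (α := ℝ)
      have h3 : 20 * K ^ 2 * T * (n + 1) * (tripleSum n (fun a b c => |meanDev a| + |meanDev b| +
          |meanDev c|) + tripleSum n (fun a b c => |varDev a| + |varDev b| + |varDev c|)) ≤
          20 * K ^ 2 * T * (n + 1) * (6 * ((n + 1) * K)) := by
        gcongr
        linarith
      have h4 : 20 * K ^ 2 * T * (n + 1) * (6 * ((n + 1) * K)) = B * T * (n + 1) ^ 2 := by
        rw [hB]; ring
      have h5 : B * T * ((n : ℝ) + 1) ^ 2 ≤ B * T * ((n + 1) * (n + 2)) := by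
        gcongr; nlinarith
      have h6 : ‖(2 : ℂ)‖ = 2 := by simp
      rw [h6]
      have h7 : 2 * (((B + C₀) * (n + 3) - 3 * B) * T * tripleSum n (fun _ _ _ => (1 : ℝ))) =
          ((B + C₀) * (n + 3) - 3 * B) * T * (((n : ℝ) + 1) * (n + 2)) := by
        rw [← h2]; ring
      push_cast
      nlinarith

/-- The distribution of `W` under the uniformly random permutation model. -/
noncomputable def permLaw (n : ℕ) (W : Equiv.Perm (Fin n) → ℝ) : Measure ℝ :=
  (n.factorial : ENNReal)⁻¹ • ∑ π, Measure.dirac (W π)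

instance (n : ℕ) (W : Equiv.Perm (Fin n) → ℝ) : IsProbabilityMeasure (permLaw n W) := by
  constructor
  have h : (n.factorial : ENNReal) ≠ 0 := by exact_mod_cast n.factorial_ne_zero
  simp [permLaw, Fintype.card_perm, ENNReal.inv_mul_cancel h]

lemma integral_permLaw {E : Type*} [NormedAddCommGroup E] [NormedSpace ℝ E] [CompleteSpace E]
    (n : ℕ) (W : Equiv.Perm (Fin n) → ℝ) (f : ℝ → E) :
    ∫ x, f x ∂(permLaw n W) = (n.factorial : ℝ)⁻¹ • ∑ π, f (W π) := by
  rw [permLaw, integral_smul_measure, integral_finsetSum_measure]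
  · simp
  · exact fun _ _ => integrable_dirac (by simp)

lemma tendstoGauss_of_tendsto_charFun {W : (n : ℕ) → Equiv.Perm (Fin n) → ℝ} {v : NNReal}
    (h : ∀ s : ℝ, Tendsto (fun n => charFun (permLaw n (W n)) s) atTop
      (𝓝 (exp (-(v * s ^ 2 / 2))))) : TendstoGauss W v := by
  let μ (n : ℕ) : ProbabilityMeasure ℝ := ⟨permLaw n (W n), inferInstance⟩
  let ν : ProbabilityMeasure ℝ := ⟨gaussianReal 0 v, inferInstance⟩
  have hμ : Tendsto μ atTop (𝓝 ν) := by
    refine ProbabilityMeasure.tendsto_of_tendsto_charFun fun s => ?_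
    have e : charFun (ν : Measure ℝ) s = exp (-(v * s ^ 2 / 2)) := by
      change charFun (gaussianReal 0 v) s = _
      rw [charFun_gaussianReal]
      simp
    rw [e]
    exact h s
  intro f
  refine (ProbabilityMeasure.tendsto_iff_forall_integral_tendsto.mp hμ f).congr fun n => ?_
  change ∫ x, f x ∂(permLaw n (W n)) = _
  rw [integral_permLaw, pexp, smul_eq_mul, inv_mul_eq_div]

lemma charFun_permLaw_fourKeys (n : ℕ) (s : ℝ) :
    charFun (permLaw n fun π => ((countKeys 4 (mst 3 n π) : ℝ) - (n : ℝ) / 25) / √n) s =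
      exp (I * (s * (√n)⁻¹ / 25 : ℝ)) * psi n (s * (√n)⁻¹) := by
  rw [charFun_apply_real, integral_permLaw]
  have h := sum_perm_mst n fun y => exp (s * (((y : ℝ) - (n : ℝ) / 25) / √n : ℝ) * I)
  have hn : (n.factorial : ℂ) ≠ 0 := by exact_mod_cast n.factorial_ne_zero
  rw [h, real_smul]
  push_cast
  rw [inv_mul_cancel_left₀ hn, psi, ← law_const_mul]
  congr 1
  ext y
  rw [← exp_add, dev]
  push_cast
  ring_nf

lemma norm_psi_sub_gauss_le : ∃ K, ∀ n t, |t| ≤ 1 →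
    ‖psi n t - gauss n t‖ ≤ K * ((n + 1) * |t| ^ 3 + |t| + t ^ 2) := by
  obtain ⟨A, hA0, hA⟩ := exists_norm_remainder_le
  obtain ⟨K, hK1, hKe, hKw, -⟩ := exists_bounds
  refine ⟨A + K, fun n t ht => ?_⟩
  have he := abs_le_of_sum_abs_le hKe n
  have hw := abs_le_of_sum_abs_le hKw n
  have e : psi n t - gauss n t = remainder n t + I * t * meanDev n - t ^ 2 / 2 * varDev n := by
    rw [remainder]; ring
  have h1 : ‖I * t * meanDev n‖ ≤ |t| * K := by
    simp only [norm_mul, norm_I, one_mul, norm_real, Real.norm_eq_abs]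
    gcongr
  have h2 : ‖(t ^ 2 / 2 * varDev n : ℂ)‖ ≤ t ^ 2 * K := by
    have : ‖(t ^ 2 / 2 * varDev n : ℂ)‖ = t ^ 2 / 2 * |varDev n| := by simp
    rw [this]
    gcongr
    linarith [sq_nonneg t]
  rw [e]
  refine (norm_sub_le _ _).trans ((add_le_add ((norm_add_le _ _).trans
    (add_le_add (hA n t ht) h1)) h2).trans ?_)
  have h3 : 0 ≤ K * (((n : ℝ) + 1) * |t| ^ 3) := by positivity
  have h4 : 0 ≤ A * |t| := by positivity
  have h5 : 0 ≤ A * t ^ 2 := by positivity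
  linarith

lemma tendsto_psi (s : ℝ) : Tendsto (fun n : ℕ => psi n (s * (√n)⁻¹)) atTop
    (𝓝 (exp (-((38477 / 1299375 : NNReal) * s ^ 2 / 2)))) := by
  have hu : Tendsto (fun n : ℕ => (√(n : ℝ))⁻¹) atTop (𝓝 0) :=
    tendsto_inv_atTop_zero.comp (Real.tendsto_sqrt_atTop.comp tendsto_natCast_atTop_atTop)
  have hnu {n : ℕ} (hn : 1 ≤ n) : (n : ℝ) * (√(n : ℝ))⁻¹ ^ 2 = 1 := by
    have : (0 : ℝ) < n := by exact_mod_cast hn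
    rw [inv_pow, Real.sq_sqrt this.le, mul_inv_cancel₀ this.ne']
  have hg : Tendsto (fun n : ℕ => gauss n (s * (√n)⁻¹)) atTop
      (𝓝 (Real.exp (-(38477 / 1299375 * s ^ 2 / 2)))) := by
    have h1 : Tendsto (fun n : ℕ =>
        Real.exp (-(38477 / 1299375 * (1 + (√(n : ℝ))⁻¹ ^ 2) * s ^ 2 / 2))) atTop
        (𝓝 (Real.exp (-(38477 / 1299375 * (1 + 0 ^ 2) * s ^ 2 / 2)))) :=
      (Real.continuous_exp.tendsto _).comp
        (((((hu.pow 2).const_add 1).const_mul _).mul_const _).div_const _).neg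
    rw [show (1 : ℝ) + 0 ^ 2 = 1 by norm_num, mul_one] at h1
    refine h1.congr' ?_
    filter_upwards [eventually_ge_atTop 1] with n hn
    rw [gauss]
    congr 3
    linear_combination -(38477 / 1299375 * s ^ 2) * hnu hn
  have hd : Tendsto (fun n : ℕ => psi n (s * (√n)⁻¹) - gauss n (s * (√n)⁻¹)) atTop (𝓝 0) := by
    obtain ⟨K, hK⟩ := norm_psi_sub_gauss_le
    have hb : Tendsto (fun n : ℕ => K * ((1 + (√(n : ℝ))⁻¹ ^ 2) * (|s| ^ 3 * (√(n : ℝ))⁻¹) +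
        |s| * (√(n : ℝ))⁻¹ + s ^ 2 * (√(n : ℝ))⁻¹ ^ 2)) atTop
        (𝓝 (K * ((1 + 0 ^ 2) * (|s| ^ 3 * 0) + |s| * 0 + s ^ 2 * 0 ^ 2))) :=
      (((((hu.pow 2).const_add 1).mul (hu.const_mul _)).add (hu.const_mul _)).add
        ((hu.pow 2).const_mul _)).const_mul _
    have ht : ∀ᶠ n : ℕ in atTop, |s * (√(n : ℝ))⁻¹| ≤ 1 := by
      have := (hu.const_mul s).abs
      rw [mul_zero, abs_zero] at this
      exact this.eventually_le_const one_pos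
    rw [show K * ((1 + 0 ^ 2) * (|s| ^ 3 * 0) + |s| * 0 + s ^ 2 * 0 ^ 2) = 0 by ring] at hb
    refine squeeze_zero_norm' ?_ hb
    filter_upwards [ht, eventually_ge_atTop 1] with n hn hn1
    refine (hK n _ hn).trans_eq ?_
    rw [abs_mul, abs_of_nonneg (inv_nonneg.mpr (Real.sqrt_nonneg (n : ℝ)))]
    linear_combination K * |s| ^ 3 * (√(n : ℝ))⁻¹ * hnu hn1
  have := hd.add ((continuous_ofReal.tendsto _).comp hg)
  rw [zero_add] at this
  convert this using 2
  · simp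
  · push_cast; rfl

lemma tendstoGauss_fourKeys : TendstoGauss (fun n π =>
    ((countKeys 4 (mst 3 n π) : ℝ) - (n : ℝ) / 25) / Real.sqrt n)
    (38477 / 1299375 : NNReal) := by
  refine tendstoGauss_of_tendsto_charFun fun s => ?_
  simp only [charFun_permLaw_fourKeys]
  have hu : Tendsto (fun n : ℕ => s * (√(n : ℝ))⁻¹ / 25) atTop (𝓝 (s * 0 / 25)) :=
    ((tendsto_inv_atTop_zero.comp (Real.tendsto_sqrt_atTop.comp
      tendsto_natCast_atTop_atTop)).const_mul s).div_const _
  have he : Tendsto (fun n : ℕ => exp (I * (s * (√(n : ℝ))⁻¹ / 25 : ℝ))) atTop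
      (𝓝 (exp (I * (s * 0 / 25 : ℝ)))) :=
    (continuous_exp.tendsto _).comp (((continuous_ofReal.tendsto _).comp hu).const_mul I)
  simpa using he.mul (tendsto_psi s)

lemma pexp_fourKeys (n : ℕ) :
    pexp n (fun π => (countKeys 4 (mst 3 n π) : ℝ)) - (n : ℝ) / 25 = meanDev n + 1 / 25 := by
  have h := sum_perm_mst n fun y => (y : ℂ)
  have hn : (n.factorial : ℂ) ≠ 0 := by exact_mod_cast n.factorial_ne_zero
  have e : (law n fun y => (y : ℂ)) = meanDev n + (n + 1) / 25 := by
    rw [← law_dev, ← law_const n (((n : ℂ) + 1) / 25), ← law_add]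
    congr 1; ext y; rw [dev]; push_cast; ring
  apply ofReal_injective
  rw [pexp]
  push_cast
  rw [h, mul_div_cancel_left₀ _ hn, e]
  ring

lemma isLittleO_pexp_fourKeys : Asymptotics.IsLittleO atTop
    (fun n : ℕ => pexp n (fun π => (countKeys 4 (mst 3 n π) : ℝ)) - (n : ℝ) / 25)
    (fun n : ℕ => Real.sqrt n) := by
  obtain ⟨K, hK1, hKe, -, -⟩ := exists_bounds
  simp only [pexp_fourKeys]
  refine Asymptotics.IsBigO.trans_isLittleO (g := fun _ => (1 : ℝ)) ?_ ?_
  · refine Asymptotics.isBigO_of_le' (c := K + 1 / 25) _ fun n => ?_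
    have he := abs_le_of_sum_abs_le hKe n
    rw [norm_one, mul_one]
    refine (norm_add_le _ _).trans (add_le_add he ?_)
    norm_num
  · rw [Asymptotics.isLittleO_const_left]
    refine Or.inr ?_
    exact tendsto_norm_atTop_atTop.comp
      (Real.tendsto_sqrt_atTop.comp tendsto_natCast_atTop_atTop)

end Fourier

/-- **Theorem (fringe subtrees with 4 keys in random ternary search trees).**
Let `Y_{n,4}` be the number of fringe subtrees with exactly `4` keys in the random
ternary search tree (`m = 3`) with `n` keys. Then `n^{-1/2}(Y_{n,4} - n/25)`
converges in distribution to `N(0, 38477/1299375)`, and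
`E Y_{n,4} = n/25 + o(n^{1/2})`. -/
theorem ternary_four_keys_clt :
    TendstoGauss (fun n π =>
        ((countKeys 4 (mst 3 n π) : ℝ) - (n : ℝ) / 25) / Real.sqrt n)
      (38477 / 1299375 : NNReal) ∧
    Asymptotics.IsLittleO Filter.atTop
      (fun n : ℕ => pexp n (fun π => (countKeys 4 (mst 3 n π) : ℝ)) - (n : ℝ) / 25)
      (fun n : ℕ => Real.sqrt n) := by
  exact ⟨tendstoGauss_fourKeys, isLittleO_pexp_fourKeys⟩

end MSTpaper
end
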